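/- Let 1 < p < ∞. There exists a bounded operator T : L^p([0,1]) → L^p([0,1]) (with Lebesgue measure) which is p-polynomially bounded but does not admit any loose dilation. -/

import Mathlib

open MeasureTheory Polynomial unitInterval
open scoped ENNReal

/-- The map `k ↦ k - 1` preserves the counting measure on `ℤ`. -/
theorem shift_measurePreserving :
    MeasurePreserving (fun k : ℤ => k - 1) Measure.count Measure.count := by
  constructor
  · exact Measurable.of_discrete
  · ext s hs
    rw [Measure.map_apply Measurable.of_discrete hs]
    have h : (fun k : ℤ => k - 1) ⁻¹' s = (fun k : ℤ => k + 1) '' s := by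
      ext k
      constructor
      · intro hk; exact ⟨k - 1, hk, by ring⟩
      · rintro ⟨a, ha, rfl⟩; simpa using ha
    rw [h, Measure.count_injective_image (fun a b hab => by simpa using hab)]

/-- The shift operator `S` on `ℓ^p(ℤ)`, realized as `L^p` of the counting measure on `ℤ`:
`(S t) k = t (k - 1)`. -/
noncomputable def shiftOp (P : ℝ≥0∞) [Fact (1 ≤ P)] :
    Lp ℂ P (Measure.count : Measure ℤ) →L[ℂ] Lp ℂ P (Measure.count : Measure ℤ) :=
  (Lp.compMeasurePreservingₗᵢ ℂ (fun k : ℤ => k - 1) shift_measurePreserving).toContinuousLinearMap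

/-- `T` admits a loose dilation: `T^n = Q U^n J` with `J, Q` bounded and `U` an isomorphism
with `(U^n)_{n ∈ ℤ}` bounded, on `L^p` of some other measure space. -/
def LooseDilation (P : ℝ≥0∞) [Fact (1 ≤ P)] {Ω : Type*} [MeasurableSpace Ω] {μ : Measure Ω}
    (T : Lp ℂ P μ →L[ℂ] Lp ℂ P μ) : Prop :=
  ∃ (Ω' : Type) (_ : MeasurableSpace Ω') (μ' : Measure Ω')
    (J : Lp ℂ P μ →L[ℂ] Lp ℂ P μ') (Q : Lp ℂ P μ' →L[ℂ] Lp ℂ P μ)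
    (U : Lp ℂ P μ' ≃L[ℂ] Lp ℂ P μ'),
      (∃ K : ℝ, ∀ n : ℤ, ‖(U ^ n).toContinuousLinearMap‖ ≤ K) ∧
      ∀ n : ℕ, (T ^ n) = Q.comp (((U ^ (n : ℤ)).toContinuousLinearMap).comp J)

namespace PB

theorem shiftOp_apply (P : ℝ≥0∞) [Fact (1 ≤ P)] (y : Lp ℂ P (Measure.count : Measure ℤ)) (k : ℤ) :
    shiftOp P y k = y (k - 1) := by
  have h := Lp.coeFn_compMeasurePreserving y shift_measurePreserving
  rw [Filter.EventuallyEq, Measure.ae_count_iff] at h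
  exact h k

theorem Lp_count_eventually (P : ℝ≥0∞) (h0 : P ≠ 0) (hT : P ≠ ∞) [Fact (1 ≤ P)]
    (y : Lp ℂ P (Measure.count : Measure ℤ)) (ε : ℝ) (hε : 0 < ε) :
    {k : ℤ | ε ≤ ‖y k‖}.Finite := by
  have h := (Lp.memLp y).meas_ge_lt_top (ε := ε.toNNReal) h0 hT (by simpa using hε)
  rw [Measure.count_apply_lt_top] at h
  refine h.subset ?_
  intro k hk
  simp only [Set.mem_ofPred_eq] at hk ⊢
  rw [← NNReal.coe_le_coe, coe_nnnorm]
  simpa [hε.le] using hk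

theorem shift_spectrum (P : ℝ≥0∞) (h0 : P ≠ 0) (hT : P ≠ ∞) [Fact (1 ≤ P)] (z : ℂ) (hz : ‖z‖ = 1) :
    z ∈ spectrum ℂ (shiftOp P) := by
  rw [spectrum.mem_iff]
  intro hu
  obtain ⟨u, hu⟩ := hu
  let e : Lp ℂ P (Measure.count : Measure ℤ) :=
    indicatorConstLp P (measurableSet_singleton (0:ℤ)) (by simp) 1
  have he : ∀ k : ℤ, e k = if k = 0 then 1 else 0 := by
    have h := indicatorConstLp_coeFn (p := P) (hs := measurableSet_singleton (0:ℤ))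
      (hμs := by simp) (c := (1:ℂ)) (μ := (Measure.count : Measure ℤ))
    rw [Filter.EventuallyEq, Measure.ae_count_iff] at h
    intro k
    rw [h k]
    simp [Set.indicator]
  let y := (↑u⁻¹ : Lp ℂ P (Measure.count : Measure ℤ) →L[ℂ] Lp ℂ P (Measure.count : Measure ℤ)) e
  have hy : z • y - shiftOp P y = e := by
    have : (u : Lp ℂ P (Measure.count : Measure ℤ) →L[ℂ] Lp ℂ P (Measure.count : Measure ℤ)) y = e := by
      have := u.mul_inv
      have h2 := congrArg (fun F => F e) this
      exact h2
    rw [hu] at this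
    simpa [Algebra.algebraMap_eq_smul_one] using this
  have hyk : ∀ k : ℤ, z * y k - y (k-1) = if k = 0 then 1 else 0 := by
    intro k
    rw [← he k, ← hy]
    have h1 := Lp.coeFn_sub (z • y) (shiftOp P y)
    have h2 := Lp.coeFn_smul z y
    rw [Filter.EventuallyEq, Measure.ae_count_iff] at h1 h2
    rw [h1 k, Pi.sub_apply, h2 k, shiftOp_apply]
    simp
  have hstep : ∀ k : ℤ, k ≠ 0 → ‖y k‖ = ‖y (k-1)‖ := by
    intro k hk
    have := hyk k
    rw [if_neg hk, sub_eq_zero] at this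
    rw [← this, norm_mul, hz, one_mul]
  have hpos : ∀ n : ℕ, ‖y (n:ℤ)‖ = ‖y 0‖ := by
    intro n
    induction n with
    | zero => simp
    | succ n ih =>
      rw [hstep _ (by omega), ← ih]; simp
  have hneg : ∀ n : ℕ, ‖y (-1 - (n:ℤ))‖ = ‖y (-1)‖ := by
    intro n
    induction n with
    | zero => simp
    | succ n ih =>
      rw [← ih, hstep (-1 - (n:ℤ)) (by omega)]; 
      have h3 : -1 - ((n + 1 : ℕ) : ℤ) = -1 - (n:ℤ) - 1 := by push_cast; ring
      rw [h3]
  have hy0 : y 0 = 0 := by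
    by_contra hne
    have hf := Lp_count_eventually P h0 hT y ‖y 0‖ (by positivity)
    refine Set.infinite_of_injective_forall_mem (f := fun n : ℕ => (n:ℤ)) ?_ ?_ hf
    · intro a b; simp
    · intro n; simp [hpos n]
  have hy1 : y (-1) = 0 := by
    by_contra hne
    have hf := Lp_count_eventually P h0 hT y ‖y (-1)‖ (by positivity)
    refine Set.infinite_of_injective_forall_mem (f := fun n : ℕ => (-1 - (n:ℤ))) ?_ ?_ hf
    · intro a b; simp
    · intro n; simp [hneg n]
  have := hyk 0
  simp [hy0, hy1] at this

/-- the sup norm of a polynomial on the circle is dominated by its `p`-norm -/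
theorem eval_le_shift (P : ℝ≥0∞) (h0 : P ≠ 0) (hT : P ≠ ∞) [Fact (1 ≤ P)] (φ : ℂ[X]) (z : ℂ)
    (hz : ‖z‖ = 1) : ‖φ.eval z‖ ≤ ‖aeval (shiftOp P) φ‖ := by
  have h1 := shift_spectrum P h0 hT z hz
  have h2 := spectrum.subset_polynomial_aeval (shiftOp P) φ ⟨z, h1, rfl⟩
  have : Nontrivial (Lp ℂ P (Measure.count : Measure ℤ)) := by
    by_contra hn
    rw [not_nontrivial_iff_subsingleton] at hn
    have : Subsingleton (Lp ℂ P (Measure.count : Measure ℤ) →L[ℂ] Lp ℂ P (Measure.count : Measure ℤ)) := ⟨fun a b => by ext x; rw [Subsingleton.elim (a x) (b x)]⟩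
    rw [spectrum.of_subsingleton] at h1
    exact h1
  exact spectrum.norm_le_norm_of_mem h2

end PB

namespace PB

/-- A family of anticommuting self-adjoint unitaries -/
structure Cliff {H : Type*} [NormedAddCommGroup H] [InnerProductSpace ℂ H]
    (C : ℕ → H →L[ℂ] H) : Prop where
  sa : ∀ r x y, inner ℂ (C r x) y = inner ℂ x (C r y)
  sq : ∀ r x, C r (C r x) = x
  ac : ∀ r q x, r ≠ q → C r (C q x) = - C q (C r x)

section cliff
variable {H : Type*} [NormedAddCommGroup H] [InnerProductSpace ℂ H] {C : ℕ → H →L[ℂ] H}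

theorem Cliff.norm (hC : Cliff C) (r : ℕ) (x : H) : ‖C r x‖ = ‖x‖ := by
  have h : inner ℂ (C r x) (C r x) = inner ℂ x x := by rw [hC.sa, hC.sq]
  rw [inner_self_eq_norm_sq_to_K, inner_self_eq_norm_sq_to_K] at h
  have h2 : ‖C r x‖ ^ 2 = ‖x‖ ^ 2 := by exact_mod_cast h
  exact (sq_eq_sq₀ (norm_nonneg _) (norm_nonneg _)).1 h2

/-- the main anticommutation consequence -/
theorem Cliff.add_inner (hC : Cliff C) (r q : ℕ) (x y : H) :
    inner ℂ (C r x) (C q y) + inner ℂ (C q x) (C r y) = if r = q then 2 * inner ℂ x y else 0 := by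
  rw [hC.sa, hC.sa]
  split_ifs with h
  · subst h; rw [hC.sq]; ring
  · rw [hC.ac r q y h, inner_neg_right]; ring

theorem Cliff.sum_norm (hC : Cliff C) (R : ℕ) (a : ℕ → ℂ) (x : H) :
    ‖∑ r ∈ Finset.range R, a r • C r x‖ ^ 2 ≤
      2 * (∑ r ∈ Finset.range R, ‖a r‖ ^ 2) * ‖x‖ ^ 2 := by
  set V := ∑ r ∈ Finset.range R, a r • C r x with hV
  set W := ∑ r ∈ Finset.range R, (starRingEnd ℂ (a r)) • C r x with hW
  have h1 : inner ℂ V V + inner ℂ W W =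
      ((2 * (∑ r ∈ Finset.range R, ‖a r‖ ^ 2) * ‖x‖ ^ 2 : ℝ) : ℂ) := by
    have e1 : inner ℂ V V = ∑ r ∈ Finset.range R, ∑ q ∈ Finset.range R,
        (starRingEnd ℂ (a r)) * a q * inner ℂ (C r x) (C q x) := by
      rw [hV, sum_inner]
      refine Finset.sum_congr rfl fun r _ => ?_
      rw [inner_sum]
      refine Finset.sum_congr rfl fun q _ => ?_
      rw [inner_smul_left, inner_smul_right]; ring
    have e2 : inner ℂ W W = ∑ r ∈ Finset.range R, ∑ q ∈ Finset.range R,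
        (starRingEnd ℂ (a r)) * a q * inner ℂ (C q x) (C r x) := by
      rw [hW, sum_inner]
      conv_rhs => rw [Finset.sum_comm]
      refine Finset.sum_congr rfl fun r _ => ?_
      rw [inner_sum]
      refine Finset.sum_congr rfl fun q _ => ?_
      rw [inner_smul_left, inner_smul_right]; simp only [RCLike.conj_conj]; ring
    rw [e1, e2, ← Finset.sum_add_distrib]
    simp_rw [← Finset.sum_add_distrib, ← mul_add, hC.add_inner]
    simp only [mul_ite, mul_zero, Finset.sum_ite_eq]
    push_cast
    rw [Finset.mul_sum, Finset.sum_mul]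
    refine Finset.sum_congr rfl fun r hr => ?_
    rw [if_pos hr, inner_self_eq_norm_sq_to_K, ← Complex.normSq_eq_conj_mul_self,
      Complex.normSq_eq_norm_sq]
    push_cast
    simp
    ring
  rw [inner_self_eq_norm_sq_to_K, inner_self_eq_norm_sq_to_K] at h1
  have h2 : ‖V‖ ^ 2 + ‖W‖ ^ 2 = 2 * (∑ r ∈ Finset.range R, ‖a r‖ ^ 2) * ‖x‖ ^ 2 := by
    apply Complex.ofReal_injective
    rw [← h1]
    push_cast; rfl
  nlinarith [sq_nonneg ‖W‖]

theorem Cliff.row (hC : Cliff C) (R : ℕ) (x y : H) :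
    ∑ r ∈ Finset.range R, ‖(inner ℂ y (C r x) : ℂ)‖ ^ 2 ≤ 2 * ‖x‖ ^ 2 * ‖y‖ ^ 2 := by
  set A := ∑ r ∈ Finset.range R, ‖(inner ℂ y (C r x) : ℂ)‖ ^ 2 with hA
  have h1 := hC.sum_norm R (fun r => starRingEnd ℂ (inner ℂ y (C r x))) x
  simp only [RCLike.norm_conj] at h1
  rw [← hA] at h1
  set V := ∑ r ∈ Finset.range R, (starRingEnd ℂ (inner ℂ y (C r x))) • C r x with hV
  have h2 : inner ℂ y V = (A : ℂ) := by
    rw [hV, inner_sum, hA]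
    push_cast
    refine Finset.sum_congr rfl fun r _ => ?_
    rw [inner_smul_right, ← Complex.normSq_eq_conj_mul_self, Complex.normSq_eq_norm_sq]
    push_cast; rfl
  have hA0 : 0 ≤ A := Finset.sum_nonneg fun _ _ => by positivity
  have h3 : A ≤ ‖y‖ * ‖V‖ := by
    have := norm_inner_le_norm (𝕜 := ℂ) y V
    rw [h2] at this
    simpa [abs_of_nonneg hA0] using this
  have h4 : A ^ 2 ≤ ‖y‖ ^ 2 * (2 * A * ‖x‖ ^ 2) := by
    calc A ^ 2 ≤ (‖y‖ * ‖V‖) ^ 2 := by gcongr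
      _ = ‖y‖ ^ 2 * ‖V‖ ^ 2 := by ring
      _ ≤ _ := by gcongr
  rcases hA0.eq_or_lt with h | h
  · rw [← h]; positivity
  · have : A * A ≤ A * (2 * ‖x‖ ^ 2 * ‖y‖ ^ 2) := by nlinarith
    exact le_of_mul_le_mul_left this h

theorem Cliff.conv (hC : Cliff C) (N : ℕ) (d : ℕ → ℤ) (x : ℤ → H) (hx : x.support.Finite) :
    ∑' m : ℤ, ‖∑ r ∈ Finset.range N, C r (x (m + d r))‖ ^ 2 ≤ 2 * N * ∑' m : ℤ, ‖x m‖ ^ 2 := by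
  have hfin : ∀ c : ℤ, (Function.support fun m => x (m + c)).Finite := by
    intro c
    have : (Function.support fun m => x (m + c)) = (Equiv.addRight c) ⁻¹' x.support := by
      ext m; simp
    rw [this]
    exact hx.preimage (Equiv.injective _).injOn
  have hS : ∀ (c c' : ℤ) (A B : H →L[ℂ] H), Summable fun m => inner ℂ (A (x (m + c))) (B (x (m + c'))) := by
    intro c c' A B
    apply summable_of_hasFiniteSupport
    refine (hfin c).subset ?_
    intro m hm h0
    apply hm
    simp only [] at h0
    simp [h0]
  have hI : ∀ (d : ℕ → ℤ), ((∑' m : ℤ, ‖∑ r ∈ Finset.range N, C r (x (m + d r))‖ ^ 2 : ℝ) : ℂ) =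
      ∑ r ∈ Finset.range N, ∑ q ∈ Finset.range N,
        ∑' m : ℤ, inner ℂ (C r (x (m + d r))) (C q (x (m + d q))) := by
    intro d
    rw [Complex.ofReal_tsum]
    have : ∀ m, ((‖∑ r ∈ Finset.range N, C r (x (m + d r))‖ ^ 2 : ℝ) : ℂ) =
      ∑ r ∈ Finset.range N, ∑ q ∈ Finset.range N, inner ℂ (C r (x (m + d r))) (C q (x (m + d q))) := by
      intro m
      push_cast
      have := inner_self_eq_norm_sq_to_K (𝕜 := ℂ) (∑ r ∈ Finset.range N, C r (x (m + d r)))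
      refine this.symm.trans ?_
      rw [sum_inner]
      refine Finset.sum_congr rfl fun r _ => ?_
      rw [inner_sum]
    simp_rw [this]
    rw [Summable.tsum_finsetSum]
    · refine Finset.sum_congr rfl fun r _ => ?_
      rw [Summable.tsum_finsetSum]
      intro q _
      exact hS _ _ _ _
    · intro r _
      exact summable_sum fun q _ => hS _ _ _ _
  have h1 := hI d
  have h2 := hI (fun r => - d r)
  have key : ∀ r q, ∑' m : ℤ, inner ℂ (C r (x (m + d r))) (C q (x (m + d q))) +
      ∑' m : ℤ, inner ℂ (C q (x (m + - d q))) (C r (x (m + - d r))) =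
      if r = q then 2 * ((∑' m : ℤ, ‖x m‖ ^ 2 : ℝ) : ℂ) else 0 := by
    intro r q
    have e1 : ∑' m : ℤ, inner ℂ (C r (x (m + d r))) (C q (x (m + d q))) = 
        ∑' m : ℤ, inner ℂ (C r (x (m + 0))) (C q (x (m + (d q - d r)))) := by
      rw [← Equiv.tsum_eq (Equiv.addRight (- d r))]
      refine tsum_congr fun m => ?_
      simp only [Equiv.coe_addRight]
      rw [show m + -d r + d r = m + 0 by ring, show m + -d r + d q = m + (d q - d r) by ring]
    have e2 : ∑' m : ℤ, inner ℂ (C q (x (m + - d q))) (C r (x (m + - d r))) = 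
        ∑' m : ℤ, inner ℂ (C q (x (m + 0))) (C r (x (m + (d q - d r)))) := by
      rw [← Equiv.tsum_eq (Equiv.addRight (d q))]
      refine tsum_congr fun m => ?_
      simp only [Equiv.coe_addRight]
      rw [show m + d q + -d q = m + 0 by ring, show m + d q + -d r = m + (d q - d r) by ring]
    rw [e1, e2, ← Summable.tsum_add (hS _ _ _ _) (hS _ _ _ _)]
    simp_rw [hC.add_inner]
    split_ifs with h
    · subst h
      rw [tsum_mul_left, Complex.ofReal_tsum]
      congr 1
      refine tsum_congr fun m => ?_
      simp
    · simp
  have h3 : ((∑' m : ℤ, ‖∑ r ∈ Finset.range N, C r (x (m + d r))‖ ^ 2 : ℝ) : ℂ) +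
      ((∑' m : ℤ, ‖∑ r ∈ Finset.range N, C r (x (m + - d r))‖ ^ 2 : ℝ) : ℂ) =
      ((2 * N * ∑' m : ℤ, ‖x m‖ ^ 2 : ℝ) : ℂ) := by
    rw [h1, h2, Finset.sum_comm (s := Finset.range N) (t := Finset.range N)
      (f := fun r q => ∑' m : ℤ, inner ℂ (C r (x (m + - d r))) (C q (x (m + - d q)))),
      ← Finset.sum_add_distrib]
    simp_rw [← Finset.sum_add_distrib, key]
    simp only [Finset.sum_ite_eq]
    rw [Finset.sum_congr rfl (g := fun _ => 2 * ((∑' m : ℤ, ‖x m‖ ^ 2 : ℝ) : ℂ))]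
    · simp; ring
    · intro r hr; rw [if_pos hr]
  have h4 : (∑' m : ℤ, ‖∑ r ∈ Finset.range N, C r (x (m + d r))‖ ^ 2 : ℝ) +
      (∑' m : ℤ, ‖∑ r ∈ Finset.range N, C r (x (m + - d r))‖ ^ 2 : ℝ) =
      2 * N * ∑' m : ℤ, ‖x m‖ ^ 2 := by exact_mod_cast h3
  have h5 : 0 ≤ ∑' m : ℤ, ‖∑ r ∈ Finset.range N, C r (x (m + - d r))‖ ^ 2 :=
    tsum_nonneg fun _ => by positivity
  linarith

end cliff
end PB

open scoped ENNReal symmDiff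
set_option linter.unusedSimpArgs false

namespace PB

/-- the basic Hilbert space -/
noncomputable abbrev H0 := lp (fun _ : Finset ℕ => ℂ) 2

/-- Clifford sign -/
def sg (r : ℕ) (s : Finset ℕ) : ℂ := (-1) ^ (s.filter (· < r)).card

theorem sg_mul_self (r : ℕ) (s : Finset ℕ) : sg r s * sg r s = 1 := by
  unfold sg; rw [← pow_add, ← two_mul, pow_mul]; simp

theorem norm_sg (r : ℕ) (s : Finset ℕ) : ‖sg r s‖ = 1 := by simp [sg]

theorem conj_sg (r : ℕ) (s : Finset ℕ) : starRingEnd ℂ (sg r s) = sg r s := by simp [sg]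

theorem sg_toggle (r q : ℕ) (s : Finset ℕ) :
    sg r (s ∆ {q}) = (if q < r then -1 else 1) * sg r s := by
  unfold sg
  split_ifs with h
  · by_cases hq : q ∈ s
    · have h1 : (s.filter (· < r)) = insert q ((s ∆ {q}).filter (· < r)) := by
        ext a; simp [Finset.mem_symmDiff]; by_cases ha : a = q
        · subst ha; simp [hq, h]
        · simp [ha]
      rw [h1, Finset.card_insert_of_notMem (by simp [Finset.mem_symmDiff, hq]), pow_succ]; ring
    · have h1 : ((s ∆ {q}).filter (· < r)) = insert q (s.filter (· < r)) := by
        ext a; simp [Finset.mem_symmDiff]; by_cases ha : a = q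
        · subst ha; simp [hq, h]
        · simp [ha]
      rw [h1, Finset.card_insert_of_notMem (by simp [hq]), pow_succ]; ring
  · have h1 : ((s ∆ {q}).filter (· < r)) = (s.filter (· < r)) := by
      ext a; simp only [Finset.mem_filter, Finset.mem_symmDiff, Finset.mem_singleton]
      by_cases ha : a = q
      · subst ha; simp [h]
      · simp [ha]
    rw [h1]; ring

/-- toggling `r` -/
def tog (r : ℕ) : Equiv.Perm (Finset ℕ) :=
  Function.Involutive.toPerm (fun s => s ∆ {r}) (fun s => by simp [symmDiff_assoc])

@[simp] theorem tog_apply (r : ℕ) (s : Finset ℕ) : tog r s = s ∆ {r} := rfl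

theorem Cl_memlp (r : ℕ) (x : H0) : Memℓp (fun t => sg r t * x (t ∆ {r})) 2 := by
  have h := lp.memℓp x
  rw [memℓp_gen_iff (by norm_num)] at h ⊢
  have h2 := (tog r).summable_iff.2 h
  refine h2.congr fun t => ?_
  simp [norm_sg]

/-- Clifford operator -/
noncomputable def Cl (r : ℕ) : H0 →L[ℂ] H0 :=
  LinearMap.mkContinuous
    { toFun := fun x => ⟨fun t => sg r t * x (t ∆ {r}), Cl_memlp r x⟩
      map_add' := fun x y => by ext t; simp [mul_add]; rfl
      map_smul' := fun c x => by ext t; simp; ring } 1 (by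
    intro x
    rw [one_mul]
    apply le_of_eq
    rw [lp.norm_eq_tsum_rpow (by norm_num), lp.norm_eq_tsum_rpow (by norm_num)]
    congr 1
    rw [← Equiv.tsum_eq (tog r) (fun t => ‖x t‖ ^ _)]
    refine tsum_congr fun t => ?_
    simp [norm_sg])

@[simp] theorem Cl_apply (r : ℕ) (x : H0) (t : Finset ℕ) : Cl r x t = sg r t * x (t ∆ {r}) := rfl

theorem Cl_cliff : Cliff Cl where
  sa r x y := by
    rw [lp.inner_eq_tsum, lp.inner_eq_tsum, ← Equiv.tsum_eq (tog r)]
    refine tsum_congr fun t => ?_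
    simp [sg_toggle, conj_sg, symmDiff_assoc]; ring
  sq r x := by
    ext t
    simp [sg_toggle, symmDiff_assoc]
    rw [← mul_assoc, sg_mul_self, one_mul]
  ac r q x h := by
    ext t
    simp [sg_toggle, symmDiff_assoc, symmDiff_comm ({q} : Finset ℕ) {r}]
    rcases lt_or_gt_of_ne h with h | h
    · simp [h, h.le, not_lt.2 h.le]; ring
    · simp [h, h.le, not_lt.2 h.le]; ring

/-- basis vectors -/
noncomputable def e0 (s : Finset ℕ) : H0 := lp.single 2 s (1:ℂ)

theorem e0_apply (s t : Finset ℕ) : e0 s t = if t = s then 1 else 0 := by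
  unfold e0
  split_ifs with h
  · subst h; simp
  · exact lp.single_apply_ne _ _ _ h

theorem inner_e0 (s : Finset ℕ) (x : H0) : inner ℂ (e0 s) x = x s := by
  unfold e0
  rw [lp.inner_single_left]; simp

theorem norm_sum_e0 (A : Finset (Finset ℕ)) (a : Finset ℕ → ℂ) :
    ‖∑ s ∈ A, a s • e0 s‖ ^ 2 = ∑ s ∈ A, ‖a s‖ ^ 2 := by
  have h := lp.norm_sum_single (E := fun _ : Finset ℕ => ℂ) (p := 2) (by norm_num) a A
  have : ∀ s, lp.single 2 s (a s) = a s • e0 s := by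
    intro s; unfold e0; rw [← lp.single_smul]; simp
  simp_rw [this] at h
  simpa using h

end PB

namespace PB

/-- `n`-th roots of unity -/
noncomputable def rt (n a : ℕ) : ℂ := Complex.exp (2 * Real.pi * Complex.I / n) ^ a

theorem norm_rt1 (n : ℕ) : ‖Complex.exp (2 * Real.pi * Complex.I / n)‖ = 1 := by
  have : (2 * Real.pi * Complex.I / n : ℂ) = ((2 * Real.pi / n : ℝ) : ℂ) * Complex.I := by
    push_cast; ring
  rw [this, Complex.norm_exp_ofReal_mul_I]

theorem norm_rt (n a : ℕ) : ‖rt n a‖ = 1 := by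
  unfold rt; rw [norm_pow, norm_rt1, one_pow]

theorem rt_orth (n : ℕ) (hn : 0 < n) (i j : ℕ) (hi : i < n) (hj : j < n) :
    ∑ a ∈ Finset.range n, (starRingEnd ℂ (rt n a)) ^ i * (rt n a) ^ j = if i = j then (n:ℂ) else 0 := by
  set z := Complex.exp (2 * Real.pi * Complex.I / n) with hz
  have hp : IsPrimitiveRoot z n := Complex.isPrimitiveRoot_exp n hn.ne'
  have hz1 : ‖z‖ = 1 := norm_rt1 n
  have hz0 : z ≠ 0 := by intro h; rw [h] at hz1; simp at hz1
  have hconj : starRingEnd ℂ z = z⁻¹ := by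
    rw [Complex.inv_def, Complex.normSq_eq_norm_sq, hz1]; simp
  set u := z ^ j * (z⁻¹) ^ i with hu
  have hterm : ∀ a, (starRingEnd ℂ (rt n a)) ^ i * (rt n a) ^ j = u ^ a := by
    intro a
    unfold rt
    rw [← hz, map_pow, hconj, hu, mul_pow, ← pow_mul, ← pow_mul, ← pow_mul, ← pow_mul]
    rw [mul_comm a i, mul_comm a j]; ring
  simp_rw [hterm]
  split_ifs with h
  · subst h
    have : u = 1 := by rw [hu, ← mul_pow, mul_inv_cancel₀ hz0, one_pow]
    simp [this]
  · have hne : u ≠ 1 := by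
      intro h1
      apply h
      apply hp.pow_inj hi hj
      have h2 : u * z ^ i = z ^ j := by
        rw [hu, mul_assoc, ← mul_pow, inv_mul_cancel₀ hz0]; simp
      rw [← h2, h1, one_mul]
    have hun : u ^ n = 1 := by
      rw [hu, mul_pow, ← pow_mul, ← pow_mul, mul_comm j, mul_comm i, pow_mul, pow_mul, inv_pow,
        hp.pow_eq_one]; simp
    have := mul_neg_geom_sum u n
    rw [hun, sub_self] at this
    rcases mul_eq_zero.1 this with h1 | h1
    · exact absurd (sub_eq_zero.1 h1).symm hne
    · exact h1

theorem parseval_gen {H : Type*} [NormedAddCommGroup H] [InnerProductSpace ℂ H] (n : ℕ)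
    (c : ℕ → ℕ → ℂ) (m : ℕ) 
    (hc : ∀ i < m, ∀ j < m, ∑ a ∈ Finset.range n, starRingEnd ℂ (c a i) * c a j =
      if i = j then (n:ℂ) else 0) (v : ℕ → H) :
    ∑ a ∈ Finset.range n, ‖∑ j ∈ Finset.range m, c a j • v j‖ ^ 2 =
      n * ∑ j ∈ Finset.range m, ‖v j‖ ^ 2 := by
  apply Complex.ofReal_injective
  push_cast
  have : ∀ a, ((‖∑ j ∈ Finset.range m, c a j • v j‖ : ℂ)) ^ 2 =
      ∑ i ∈ Finset.range m, ∑ j ∈ Finset.range m, starRingEnd ℂ (c a i) * c a j * inner ℂ (v i) (v j) := by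
    intro a
    refine (inner_self_eq_norm_sq_to_K (𝕜 := ℂ) (∑ j ∈ Finset.range m, c a j • v j)).symm.trans ?_
    rw [sum_inner]
    refine Finset.sum_congr rfl fun i _ => ?_
    rw [inner_sum]
    refine Finset.sum_congr rfl fun j _ => ?_
    rw [inner_smul_left, inner_smul_right]; ring
  simp_rw [this]
  rw [Finset.sum_comm, Finset.mul_sum]
  refine Finset.sum_congr rfl fun i hi => ?_
  rw [Finset.sum_comm]
  simp_rw [← Finset.sum_mul]
  rw [Finset.sum_eq_single i]
  · rw [hc i (Finset.mem_range.1 hi) i (Finset.mem_range.1 hi), if_pos rfl,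
      inner_self_eq_norm_sq_to_K]; rfl
  · intro j hj hij
    rw [hc i (Finset.mem_range.1 hi) j (Finset.mem_range.1 hj), if_neg hij.symm, zero_mul]
  · intro h; exact absurd hi h

theorem parseval_vec {H : Type*} [NormedAddCommGroup H] [InnerProductSpace ℂ H] (n : ℕ) (hn : 0 < n)
    (m : ℕ) (hm : m ≤ n) (v : ℕ → H) :
    ∑ a ∈ Finset.range n, ‖∑ j ∈ Finset.range m, (rt n a) ^ j • v j‖ ^ 2 =
      n * ∑ j ∈ Finset.range m, ‖v j‖ ^ 2 := by
  apply parseval_gen n (fun a j => (rt n a) ^ j) m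
  intro i hi j hj
  simp_rw [map_pow]
  exact rt_orth n hn i j (by omega) (by omega)

theorem parseval_vec_conj {H : Type*} [NormedAddCommGroup H] [InnerProductSpace ℂ H] (n : ℕ)
    (hn : 0 < n) (m : ℕ) (hm : m ≤ n) (v : ℕ → H) :
    ∑ a ∈ Finset.range n, ‖∑ j ∈ Finset.range m, (starRingEnd ℂ (rt n a)) ^ j • v j‖ ^ 2 =
      n * ∑ j ∈ Finset.range m, ‖v j‖ ^ 2 := by
  apply parseval_gen n (fun a j => (starRingEnd ℂ (rt n a)) ^ j) m
  intro i hi j hj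
  simp_rw [map_pow, RCLike.conj_conj]
  have := rt_orth n hn j i (by omega) (by omega)
  simp_rw [mul_comm (_ ^ i)]
  rw [this]
  simp [eq_comm]

theorem parseval_poly (n : ℕ) (f : ℂ[X]) (hf : f.natDegree < n) :
    ∑ a ∈ Finset.range n, ‖f.eval (rt n a)‖ ^ 2 = n * ∑ j ∈ Finset.range n, ‖f.coeff j‖ ^ 2 := by
  rw [← parseval_vec n (by omega) n le_rfl (fun j => f.coeff j)]
  refine Finset.sum_congr rfl fun a _ => ?_
  rw [eval_eq_sum_range' hf]
  simp [mul_comm]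

theorem avg_poly (n : ℕ) (f : ℂ[X]) (hf : f.natDegree < n) :
    ∑ a ∈ Finset.range n, f.eval (rt n a) = n * f.coeff 0 := by
  simp_rw [eval_eq_sum_range' hf]
  rw [Finset.sum_comm]
  simp_rw [← Finset.mul_sum]
  have : ∀ j < n, ∑ a ∈ Finset.range n, rt n a ^ j = if 0 = j then (n:ℂ) else 0 := by
    intro j hj
    simpa using rt_orth n (by omega) 0 j (by omega) hj
  rw [Finset.sum_eq_single 0]
  · rw [this 0 (by omega)]; simp [mul_comm]
  · intro j hj hj0
    rw [this j (Finset.mem_range.1 hj), if_neg hj0.symm, mul_zero]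
  · intro h; simp at h; omega

/-- coefficients are bounded by the sup on the circle -/
theorem coeff_le_sup (f : ℂ[X]) (A : ℝ) (hA : ∀ z : ℂ, ‖z‖ = 1 → ‖f.eval z‖ ≤ A) (m : ℕ) :
    ‖f.coeff m‖ ≤ A := by
  have hA0 : 0 ≤ A := (norm_nonneg _).trans (hA 1 (by simp))
  set n := f.natDegree + m + 1 with hn
  have h1 := parseval_poly n f (by omega)
  have hn0 : (0:ℝ) < n := by rw [hn]; positivity
  have h2 : ∑ a ∈ Finset.range n, ‖f.eval (rt n a)‖ ^ 2 ≤ n * A ^ 2 := by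
    calc _ ≤ ∑ a ∈ Finset.range n, A ^ 2 := by
          refine Finset.sum_le_sum fun a _ => ?_
          have := hA _ (norm_rt n a)
          gcongr
      _ = _ := by simp
  have h3 : ‖f.coeff m‖ ^ 2 ≤ ∑ j ∈ Finset.range n, ‖f.coeff j‖ ^ 2 :=
    Finset.single_le_sum (f := fun j => ‖f.coeff j‖ ^ 2) (fun _ _ => by positivity)
      (by simp; omega)
  rw [h1] at h2
  have h4 := le_of_mul_le_mul_left h2 hn0
  exact (sq_le_sq₀ (norm_nonneg _) hA0).1 (h3.trans h4)

/-- `ℓ²` norm of a product with a bounded polynomial -/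
theorem l2_mul_le (φ : ℂ[X]) (M : ℝ) (hM : ∀ z : ℂ, ‖z‖ = 1 → ‖φ.eval z‖ ≤ M) (g : ℂ[X]) (n : ℕ)
    (hn : (φ * g).natDegree < n) (hn2 : g.natDegree < n) :
    ∑ j ∈ Finset.range n, ‖(φ * g).coeff j‖ ^ 2 ≤ M ^ 2 * ∑ j ∈ Finset.range n, ‖g.coeff j‖ ^ 2 := by
  have hn0 : (0:ℝ) < n := by exact_mod_cast (Nat.zero_le _).trans_lt hn
  have h1 := parseval_poly n _ hn
  have h2 := parseval_poly n _ hn2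
  have h3 : ∑ a ∈ Finset.range n, ‖(φ * g).eval (rt n a)‖ ^ 2 ≤
      M ^ 2 * ∑ a ∈ Finset.range n, ‖g.eval (rt n a)‖ ^ 2 := by
    rw [Finset.mul_sum]
    refine Finset.sum_le_sum fun a _ => ?_
    rw [eval_mul, norm_mul, mul_pow]
    have := hM _ (norm_rt n a)
    gcongr
  rw [h1, h2] at h3
  refine le_of_mul_le_mul_left ?_ hn0
  linarith

theorem dyadic_sum (m R : ℕ) :
    (m ≤ 2 ^ R → ∑ r ∈ Finset.range R, (if m ≤ 2 ^ r then ((m:ℝ) / 2 ^ r) ^ 2 else 0) ≤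
      4 / 3 * (1 - ((m:ℝ) / 2 ^ R) ^ 2)) ∧
    (2 ^ R < m → ∑ r ∈ Finset.range R, (if m ≤ 2 ^ r then ((m:ℝ) / 2 ^ r) ^ 2 else 0) = 0) := by
  induction R with
  | zero =>
    refine ⟨fun h => ?_, fun _ => by simp⟩
    have : (m:ℝ) ≤ 1 := by exact_mod_cast h
    have h0 : (0:ℝ) ≤ m := by positivity
    simp
    nlinarith
  | succ R ih =>
    rw [Finset.sum_range_succ]
    have hp : (2:ℝ) ^ R > 0 := by positivity
    rcases le_or_gt m (2 ^ R) with h | h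
    · rw [if_pos h]
      refine ⟨fun _ => ?_, fun h2 => ?_⟩
      · have := ih.1 h
        have e : ((m:ℝ) / 2 ^ (R+1)) ^ 2 = ((m:ℝ) / 2 ^ R) ^ 2 / 4 := by
          rw [pow_succ (2:ℝ) R, ← div_div, div_pow _ (2:ℝ) 2]; norm_num
        rw [e]; linarith
      · rw [pow_succ] at h2; omega
    · rw [if_neg (by omega), ih.2 h]
      refine ⟨fun h2 => ?_, fun _ => by simp⟩
      have h3 : (m:ℝ) ≤ 2 ^ (R+1) := by exact_mod_cast h2
      have h4 : (m:ℝ) / 2 ^ (R+1) ≤ 1 := by rw [div_le_one (by positivity)]; exact h3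
      have h5 : 0 ≤ (m:ℝ) / 2 ^ (R+1) := by positivity
      nlinarith

theorem dyadic_sum_le (m R : ℕ) :
    ∑ r ∈ Finset.range R, (if m ≤ 2 ^ r then ((m:ℝ) / 2 ^ r) ^ 2 else 0) ≤ 4 / 3 := by
  rcases le_or_gt m (2 ^ R) with h | h
  · refine ((dyadic_sum m R).1 h).trans ?_
    nlinarith [sq_nonneg ((m:ℝ) / 2 ^ R)]
  · rw [(dyadic_sum m R).2 h]; norm_num

theorem hankel_cs (h : ℂ[X]) (K : ℕ → ℂ[X]) (R n : ℕ) (hn : 2 ^ R ≤ n) :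
    ‖∑ r ∈ Finset.range R, (1 / 2 ^ r : ℂ) * (X * derivative h * K r).coeff (2 ^ r)‖ ^ 2 ≤
      4 / 3 * (∑ j ∈ Finset.range n, ‖h.coeff j‖ ^ 2) *
        ∑ r ∈ Finset.range R, ∑ j ∈ Finset.range n, ‖(K r).coeff j‖ ^ 2 := by
  have hc : ∀ m, (X * derivative h).coeff m = m * h.coeff m := by
    intro m
    cases m with
    | zero => simp
    | succ m => rw [coeff_X_mul, coeff_derivative]; push_cast; ring
  have e1 : ∀ r, (1 / 2 ^ r : ℂ) * (X * derivative h * K r).coeff (2 ^ r) =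
      ∑ m ∈ Finset.range (2 ^ r + 1), ((m:ℂ) / 2 ^ r * h.coeff m) * (K r).coeff (2 ^ r - m) := by
    intro r
    have := Finset.Nat.sum_antidiagonal_eq_sum_range_succ
      (fun a b => (X * derivative h).coeff a * (K r).coeff b) (2 ^ r)
    rw [coeff_mul, this, Finset.mul_sum]
    refine Finset.sum_congr rfl fun m _ => ?_
    rw [hc]; ring
  have e2 : ‖∑ r ∈ Finset.range R, (1 / 2 ^ r : ℂ) * (X * derivative h * K r).coeff (2 ^ r)‖ ≤
      ∑ x ∈ (Finset.range R).sigma (fun r => Finset.range (2 ^ r + 1)),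
        ((x.2:ℝ) / 2 ^ x.1 * ‖h.coeff x.2‖) * ‖(K x.1).coeff (2 ^ x.1 - x.2)‖ := by
    rw [Finset.sum_sigma]
    refine (norm_sum_le _ _).trans (Finset.sum_le_sum fun r _ => ?_)
    rw [e1]
    refine (norm_sum_le _ _).trans (Finset.sum_le_sum fun m _ => ?_)
    simp
  have e3 := Finset.sum_mul_sq_le_sq_mul_sq ((Finset.range R).sigma (fun r => Finset.range (2 ^ r + 1)))
    (fun x => (x.2:ℝ) / 2 ^ x.1 * ‖h.coeff x.2‖) (fun x => ‖(K x.1).coeff (2 ^ x.1 - x.2)‖)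
  refine (pow_le_pow_left₀ (norm_nonneg _) e2 2).trans (e3.trans ?_)
  have hlt : ∀ r ∈ Finset.range R, 2 ^ r + 1 ≤ n := by
    intro r hr
    have : 2 ^ r < 2 ^ R := Nat.pow_lt_pow_right (by norm_num) (Finset.mem_range.1 hr)
    omega
  apply mul_le_mul
  · rw [Finset.sum_sigma]
    calc ∑ r ∈ Finset.range R, ∑ m ∈ Finset.range (2 ^ r + 1), ((m:ℝ) / 2 ^ r * ‖h.coeff m‖) ^ 2
        ≤ ∑ r ∈ Finset.range R, ∑ m ∈ Finset.range n,
            (if m ≤ 2 ^ r then ((m:ℝ) / 2 ^ r) ^ 2 else 0) * ‖h.coeff m‖ ^ 2 := by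
          refine Finset.sum_le_sum fun r hr => ?_
          calc _ = ∑ m ∈ Finset.range (2 ^ r + 1),
                (if m ≤ 2 ^ r then ((m:ℝ) / 2 ^ r) ^ 2 else 0) * ‖h.coeff m‖ ^ 2 := by
                refine Finset.sum_congr rfl fun m hm => ?_
                have : m ≤ 2 ^ r := by rw [Finset.mem_range] at hm; omega
                rw [if_pos this, mul_pow]
            _ ≤ _ := by
                apply Finset.sum_le_sum_of_subset_of_nonneg
                · exact Finset.range_mono (hlt r hr)
                · intro m _ _
                  split_ifs <;> positivity
      _ = ∑ m ∈ Finset.range n, (∑ r ∈ Finset.range R,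
            (if m ≤ 2 ^ r then ((m:ℝ) / 2 ^ r) ^ 2 else 0)) * ‖h.coeff m‖ ^ 2 := by
          rw [Finset.sum_comm]
          simp_rw [Finset.sum_mul]
      _ ≤ ∑ m ∈ Finset.range n, 4 / 3 * ‖h.coeff m‖ ^ 2 := by
          refine Finset.sum_le_sum fun m _ => ?_
          gcongr
          exact dyadic_sum_le m R
      _ = _ := by rw [Finset.mul_sum]
  · rw [Finset.sum_sigma]
    refine Finset.sum_le_sum fun r hr => ?_
    have e5 := Finset.sum_range_reflect (fun b => ‖(K r).coeff b‖ ^ 2) (2 ^ r + 1)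
    refine (le_of_eq ?_).trans (e5.le.trans ?_)
    rotate_left
    · apply Finset.sum_le_sum_of_subset_of_nonneg
      · exact Finset.range_mono (hlt r hr)
      · intro m _ _; positivity
    · refine Finset.sum_congr rfl fun m _ => ?_
      simp
  · exact Finset.sum_nonneg fun _ _ => by positivity
  · positivity

end PB

namespace PB

/-- real continuous functions on the circle are approximated by real parts of polynomials -/
theorem exists_re_poly (f : ℂ → ℝ) (hf : Continuous f) (ε : ℝ) (hε : 0 < ε) :
    ∃ g : ℂ[X], (g.coeff 0).im = 0 ∧ ∀ z : ℂ, ‖z‖ = 1 → |(g.eval z).re - f z| ≤ ε := by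
  have : Fact ((0:ℝ) < 1) := ⟨one_pos⟩
  let F : C(AddCircle (1:ℝ), ℂ) :=
    ⟨fun x => (f (AddCircle.toCircle x : ℂ) : ℂ), by
      have := AddCircle.continuous_toCircle (T := (1:ℝ))
      fun_prop⟩
  have hF : F ∈ (Submodule.span ℂ (Set.range (fourier (T := (1:ℝ))))).topologicalClosure := by
    rw [span_fourier_closure_eq_top]; trivial
  rw [← SetLike.mem_coe, Submodule.topologicalClosure_coe, Metric.mem_closure_iff] at hF
  obtain ⟨t, ht, hd⟩ := hF ε hε
  have key : ∀ t ∈ Submodule.span ℂ (Set.range (fourier (T := (1:ℝ)))),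
      ∀ c : ℂ, ∃ g : ℂ[X], ∀ x : AddCircle (1:ℝ),
        (g.eval (AddCircle.toCircle x : ℂ)).re = (c * t x).re := by
    intro t ht
    induction ht using Submodule.span_induction with
    | mem t h =>
      obtain ⟨k, rfl⟩ := h
      intro c
      obtain ⟨n, rfl | rfl⟩ := k.eq_nat_or_neg
      · refine ⟨Polynomial.C c * X ^ n, fun x => ?_⟩
        simp [fourier_apply, AddCircle.toCircle_nsmul]
      · refine ⟨Polynomial.C (starRingEnd ℂ c) * X ^ n, fun x => ?_⟩
        rw [fourier_neg]
        have e : fourier (n:ℤ) x = (AddCircle.toCircle x : ℂ) ^ n := by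
          simp [fourier_apply, AddCircle.toCircle_nsmul]
        rw [e]
        simp only [eval_mul, eval_C, eval_pow, eval_X, Complex.mul_re, Complex.conj_re,
          Complex.conj_im]
        ring
    | zero => intro c; exact ⟨0, by simp⟩
    | add a b _ _ ha hb =>
      intro c
      obtain ⟨g, h2⟩ := ha c
      obtain ⟨g', h2'⟩ := hb c
      exact ⟨g + g', by intro x; simp only [eval_add, Complex.add_re, h2, h2', ContinuousMap.add_apply, mul_add]⟩
    | smul d t _ ht =>
      intro c
      obtain ⟨g, h2⟩ := ht (c * d)
      refine ⟨g, fun x => ?_⟩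
      rw [h2, ContinuousMap.smul_apply, smul_eq_mul, mul_assoc]
  obtain ⟨g, hg⟩ := key t ht 1
  refine ⟨g - Polynomial.C (((g.coeff 0).im : ℂ) * Complex.I), by simp, fun z hz => ?_⟩
  obtain ⟨x, hx⟩ : ∃ x : AddCircle (1:ℝ), (AddCircle.toCircle x : ℂ) = z := by
    have hz' : z ∈ Submonoid.unitSphere ℂ := by simpa [Submonoid.unitSphere] using hz
    obtain ⟨x, hx⟩ := (AddCircle.homeomorphCircle (T := (1:ℝ)) one_ne_zero).surjective ⟨z, hz'⟩
    refine ⟨x, ?_⟩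
    rw [AddCircle.homeomorphCircle_apply] at hx
    rw [hx]
  have h1 : ‖F x - t x‖ ≤ ε := by
    have := ContinuousMap.dist_apply_le_dist (f := F) (g := t) x
    rw [← dist_eq_norm]; linarith
  have h2 := (Complex.abs_re_le_norm (F x - t x)).trans h1
  have h3 := hg x
  rw [hx] at h3
  rw [one_mul] at h3
  have h4 : (F x).re = f z := by
    change ((f (AddCircle.toCircle x : ℂ) : ℂ)).re = _
    rw [hx]; simp
  rw [abs_sub_comm]
  rw [Complex.sub_re, h4] at h2
  simpa [h3] using h2

/-- the outer-type majorant -/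
theorem exists_majorant (f : ℂ → ℝ) (hf : Continuous f) (hf0 : ∀ z, 0 ≤ f z) (e : ℝ) (he : 0 < e) :
    ∃ (g : ℂ[X]) (δ : ℝ), 0 < δ ∧ (∀ z : ℂ, ‖z‖ = 1 → f z ≤ ‖g.eval z‖) ∧
      (∀ z : ℂ, ‖z‖ = 1 → δ ≤ (g.eval z).re) ∧
      ∀ n, 2 * g.natDegree < n → ∑ j ∈ Finset.range n, ‖g.coeff j‖ ^ 2 ≤
        2 * (n:ℝ)⁻¹ * ∑ a ∈ Finset.range n, (f (rt n a) + e) ^ 2 := by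
  obtain ⟨g, hg0, hg⟩ := exists_re_poly (fun z => f z + 2 * e / 3) (by fun_prop) (e/3) (by positivity)
  have hlo : ∀ z : ℂ, ‖z‖ = 1 → f z + e / 3 ≤ (g.eval z).re := by
    intro z hz
    have := (abs_le.1 (hg z hz)).1
    linarith
  have hhi : ∀ z : ℂ, ‖z‖ = 1 → (g.eval z).re ≤ f z + e := by
    intro z hz
    have := (abs_le.1 (hg z hz)).2
    linarith
  refine ⟨g, e/3, by positivity, fun z hz => ?_, fun z hz => ?_, fun n hn => ?_⟩
  · have := hlo z hz
    have h2 := Complex.re_le_norm (g.eval z)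
    linarith
  · have := hlo z hz
    have h2 := hf0 z
    linarith
  · have hn0 : (0:ℝ) < n := by exact_mod_cast (Nat.zero_le _).trans_lt hn
    have h1 := parseval_poly n g (by omega)
    have h2 := avg_poly n (g ^ 2) (by
      refine (natDegree_pow_le).trans_lt ?_
      omega)
    have h3 : ∀ z : ℂ, ‖z‖ ^ 2 = 2 * z.re ^ 2 - (z ^ 2).re := by
      intro z
      rw [← Complex.normSq_eq_norm_sq, Complex.normSq_apply]
      simp [pow_two]; ring
    have h4 : ∑ a ∈ Finset.range n, ‖g.eval (rt n a)‖ ^ 2 =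
        2 * ∑ a ∈ Finset.range n, (g.eval (rt n a)).re ^ 2 - n * (g.coeff 0).re ^ 2 := by
      simp_rw [h3]
      rw [Finset.sum_sub_distrib, ← Finset.mul_sum, ← Complex.re_sum]
      simp_rw [eval_pow] at h2
      rw [h2, pow_two g, mul_coeff_zero]
      simp [hg0, pow_two]
    have h5 : ∑ a ∈ Finset.range n, (g.eval (rt n a)).re ^ 2 ≤
        ∑ a ∈ Finset.range n, (f (rt n a) + e) ^ 2 := by
      refine Finset.sum_le_sum fun a _ => ?_
      have e1 := hlo _ (norm_rt n a)
      have e2 := hhi _ (norm_rt n a)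
      have e3 := hf0 (rt n a)
      have : 0 ≤ (g.eval (rt n a)).re := by linarith
      gcongr
    have h6 : (n:ℝ) * ∑ j ∈ Finset.range n, ‖g.coeff j‖ ^ 2 ≤ 2 * ∑ a ∈ Finset.range n, (f (rt n a) + e) ^ 2 := by
      rw [← h1, h4]
      nlinarith [mul_nonneg hn0.le (sq_nonneg (g.coeff 0).re)]
    rw [mul_comm (2:ℝ), mul_assoc, ← div_eq_inv_mul, le_div_iff₀ hn0]
    linarith

theorem circle_bdd (f : ℂ[X]) : ∃ A : ℝ, 0 < A ∧ ∀ z : ℂ, ‖z‖ = 1 → ‖f.eval z‖ ≤ A := by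
  obtain ⟨A, hA⟩ := (isCompact_sphere (0:ℂ) 1).exists_bound_of_continuousOn
    (f := fun z => f.eval z) (f.continuous.continuousOn)
  refine ⟨max A 1, by positivity, fun z hz => (hA z (by simpa using hz)).trans (le_max_left _ _)⟩

/-- approximate inverse of `g` -/
theorem exists_inv (g : ℂ[X]) (δ : ℝ) (hδ : 0 < δ) (hg : ∀ z : ℂ, ‖z‖ = 1 → δ ≤ (g.eval z).re) :
    ∃ (x : ℂ[X]) (ρ : ℝ), 0 ≤ ρ ∧ ρ < 1 ∧ (∀ z : ℂ, ‖z‖ = 1 → ‖x.eval z‖ ≤ ρ) ∧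
      ∀ q : ℕ, ∃ h : ℂ[X], h * g = 1 - x ^ q := by
  obtain ⟨G, hG0, hG⟩ := circle_bdd g
  have hGd : δ ≤ G := by
    have h1 := hg 1 (by simp)
    have h2 := hG 1 (by simp)
    have h3 := Complex.re_le_norm (g.eval 1)
    linarith
  set τ : ℝ := δ / G ^ 2 with hτ
  have hτ0 : 0 < τ := by positivity
  refine ⟨1 - Polynomial.C (τ:ℂ) * g, Real.sqrt (1 - δ ^ 2 / G ^ 2), Real.sqrt_nonneg _, ?_, ?_, ?_⟩
  · rw [Real.sqrt_lt' one_pos]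
    have : 0 < δ ^ 2 / G ^ 2 := by positivity
    linarith
  · intro z hz
    apply Real.le_sqrt_of_sq_le
    set w := g.eval z with hw
    have h1 := hg z hz
    have h2 := hG z hz
    rw [← hw] at h1 h2
    have e1 : ‖(1 - Polynomial.C (τ:ℂ) * g).eval z‖ ^ 2 = 1 - 2 * τ * w.re + τ ^ 2 * ‖w‖ ^ 2 := by
      rw [← Complex.normSq_eq_norm_sq, ← Complex.normSq_eq_norm_sq, Complex.normSq_apply, Complex.normSq_apply]
      simp [← hw]
      ring
    rw [e1]
    have e2 : τ ^ 2 * ‖w‖ ^ 2 ≤ τ ^ 2 * G ^ 2 := by gcongr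
    have e3 : τ ^ 2 * G ^ 2 = δ ^ 2 / G ^ 2 := by rw [hτ]; field_simp
    have e4 : τ * δ ≤ τ * w.re := by gcongr
    have e5 : τ * δ = δ ^ 2 / G ^ 2 := by rw [hτ]; ring
    nlinarith
  · intro q
    set x := 1 - Polynomial.C (τ:ℂ) * g with hx
    refine ⟨Polynomial.C (τ:ℂ) * ∑ i ∈ Finset.range q, x ^ i, ?_⟩
    have := geom_sum_mul_neg x q
    rw [← this, hx]; ring

end PB

namespace PB
section
variable {H : Type*} [NormedAddCommGroup H] [InnerProductSpace ℂ H] {C : ℕ → H →L[ℂ] H}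

/-- the product polynomial -/
noncomputable def Fp (C : ℕ → H →L[ℂ] H) (n0 : ℕ) (v w : ℕ → H) (r : ℕ) : ℂ[X] :=
  ∑ i ∈ Finset.range n0, ∑ j ∈ Finset.range n0, monomial (i + j) (inner ℂ (w i) (C r (v j)))

theorem Fp_eval (C : ℕ → H →L[ℂ] H) (n0 : ℕ) (v w : ℕ → H) (r : ℕ) (z : ℂ) :
    (Fp C n0 v w r).eval z = inner ℂ (∑ i ∈ Finset.range n0, (starRingEnd ℂ z) ^ i • w i)
      (C r (∑ j ∈ Finset.range n0, z ^ j • v j)) := by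
  unfold Fp
  rw [sum_inner, eval_finsetSum]
  refine Finset.sum_congr rfl fun i _ => ?_
  rw [map_sum, inner_sum, eval_finsetSum]
  refine Finset.sum_congr rfl fun j _ => ?_
  rw [eval_monomial, inner_smul_left, map_smul, inner_smul_right, pow_add]
  simp; ring

/-- the bilinear form -/
noncomputable def Bf (φ : ℂ[X]) (R : ℕ) (F : ℕ → ℂ[X]) : ℂ :=
  ∑ r ∈ Finset.range R, (1 / 2 ^ r : ℂ) * (X * derivative φ * F r).coeff (2 ^ r)

theorem Bf_add (φ : ℂ[X]) (R : ℕ) (F G : ℕ → ℂ[X]) :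
    Bf φ R (fun r => F r + G r) = Bf φ R F + Bf φ R G := by
  unfold Bf
  rw [← Finset.sum_add_distrib]
  refine Finset.sum_congr rfl fun r _ => ?_
  rw [mul_add, coeff_add]; ring

theorem Bf_small (φ : ℂ[X]) (R : ℕ) (F : ℕ → ℂ[X]) (x : ℂ[X]) (ρ : ℝ) (hρ0 : 0 ≤ ρ) (hρ1 : ρ < 1)
    (hx : ∀ z : ℂ, ‖z‖ = 1 → ‖x.eval z‖ ≤ ρ) :
    Filter.Tendsto (fun q : ℕ => Bf φ R (fun r => x ^ q * F r)) Filter.atTop (nhds 0) := by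
  have : (0:ℂ) = ∑ r ∈ Finset.range R, (1 / 2 ^ r : ℂ) * 0 := by simp
  rw [this]
  unfold Bf
  refine tendsto_finsetSum _ fun r _ => Filter.Tendsto.const_mul _ ?_
  obtain ⟨A, hA0, hA⟩ := circle_bdd (X * derivative φ * F r)
  refine squeeze_zero_norm (a := fun q => A * ρ ^ q) (fun q => ?_) ?_
  · apply coeff_le_sup
    intro z hz
    have : X * derivative φ * (x ^ q * F r) = (X * derivative φ * F r) * x ^ q := by ring
    rw [this, eval_mul, norm_mul, eval_pow, norm_pow]
    have h1 := hA z hz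
    have h2 := hx z hz
    gcongr
  · have := (tendsto_pow_atTop_nhds_zero_of_lt_one hρ0 hρ1).const_mul A
    simpa using this

theorem Bf_gK (φ : ℂ[X]) (M : ℝ) (hM : ∀ z : ℂ, ‖z‖ = 1 → ‖φ.eval z‖ ≤ M) (R : ℕ) (g : ℂ[X])
    (K : ℕ → ℂ[X]) (V W : ℝ) (hV : 0 ≤ V) (n : ℕ) (hnR : 2 ^ R ≤ n) (hng : g.natDegree < n)
    (hnφg : (φ * g).natDegree < n) (hnK : ∀ r < R, (K r).natDegree < n)
    (hnφK : ∀ r < R, (φ * K r).natDegree < n)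
    (hg : ∑ j ∈ Finset.range n, ‖g.coeff j‖ ^ 2 ≤ V)
    (hK : ∑ r ∈ Finset.range R, ∑ j ∈ Finset.range n, ‖(K r).coeff j‖ ^ 2 ≤ W) :
    ‖Bf φ R (fun r => g * K r)‖ ^ 2 ≤ 6 * M ^ 2 * V * W := by
  have e : Bf φ R (fun r => g * K r) = 
      ∑ r ∈ Finset.range R, (1 / 2 ^ r : ℂ) * (X * derivative (φ * g) * K r).coeff (2 ^ r) -
      ∑ r ∈ Finset.range R, (1 / 2 ^ r : ℂ) * (X * derivative g * (φ * K r)).coeff (2 ^ r) := by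
    unfold Bf
    rw [← Finset.sum_sub_distrib]
    refine Finset.sum_congr rfl fun r _ => ?_
    rw [← mul_sub, ← coeff_sub]
    congr 2
    rw [derivative_mul]; ring
  have h1 := hankel_cs (φ * g) K R n hnR
  have h2 := hankel_cs g (fun r => φ * K r) R n hnR
  have h3 := l2_mul_le φ M hM g n hnφg hng
  have h4 : ∑ r ∈ Finset.range R, ∑ j ∈ Finset.range n, ‖(φ * K r).coeff j‖ ^ 2 ≤ M ^ 2 * W := by
    calc _ ≤ ∑ r ∈ Finset.range R, M ^ 2 * ∑ j ∈ Finset.range n, ‖(K r).coeff j‖ ^ 2 := by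
          refine Finset.sum_le_sum fun r hr => ?_
          rw [Finset.mem_range] at hr
          exact l2_mul_le φ M hM (K r) n (hnφK r hr) (hnK r hr)
      _ ≤ _ := by rw [← Finset.mul_sum]; gcongr
  have hW : 0 ≤ W := le_trans (Finset.sum_nonneg fun _ _ => Finset.sum_nonneg fun _ _ => by positivity) hK
  rw [e]
  set a := ∑ r ∈ Finset.range R, (1 / 2 ^ r : ℂ) * (X * derivative (φ * g) * K r).coeff (2 ^ r)
  set b := ∑ r ∈ Finset.range R, (1 / 2 ^ r : ℂ) * (X * derivative g * (φ * K r)).coeff (2 ^ r)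
  have h5 : ‖a‖ ^ 2 ≤ 4 / 3 * (M ^ 2 * V) * W := by
    refine h1.trans ?_
    have : ∑ j ∈ Finset.range n, ‖(φ * g).coeff j‖ ^ 2 ≤ M ^ 2 * V := h3.trans (by gcongr)
    gcongr
  have h6 : ‖b‖ ^ 2 ≤ 4 / 3 * V * (M ^ 2 * W) := by
    refine h2.trans ?_
    gcongr
  have h7 : ‖a - b‖ ≤ ‖a‖ + ‖b‖ := norm_sub_le a b
  have h8 : ‖a - b‖ ^ 2 ≤ (‖a‖ + ‖b‖) ^ 2 := by gcongr
  have h9 : 0 ≤ M ^ 2 * V * W := by positivity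
  nlinarith [sq_nonneg (‖a‖ - ‖b‖)]

theorem main_est (hC : Cliff C) (φ : ℂ[X]) (M : ℝ) (hM : ∀ z : ℂ, ‖z‖ = 1 → ‖φ.eval z‖ ≤ M)
    (R n0 : ℕ) (v w : ℕ → H) :
    ‖Bf φ R (Fp C n0 v w)‖ ≤ 20 * M * Real.sqrt (∑ j ∈ Finset.range n0, ‖v j‖ ^ 2) *
      Real.sqrt (∑ j ∈ Finset.range n0, ‖w j‖ ^ 2) := by
  set V := ∑ j ∈ Finset.range n0, ‖v j‖ ^ 2 with hV
  set W := ∑ j ∈ Finset.range n0, ‖w j‖ ^ 2 with hW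
  have hM0 : 0 ≤ M := (norm_nonneg _).trans (hM 1 (by simp))
  have hV0 : 0 ≤ V := Finset.sum_nonneg fun _ _ => by positivity
  have hW0 : 0 ≤ W := Finset.sum_nonneg fun _ _ => by positivity
  rcases hV0.eq_or_lt with hV1 | hV1
  · have hv : ∀ j ∈ Finset.range n0, v j = 0 := by
      intro j hj
      have := (Finset.sum_eq_zero_iff_of_nonneg (fun _ _ => by positivity)).1 (hV.symm.trans hV1.symm) j hj
      simpa using this
    have hF : Fp C n0 v w = fun _ => 0 := by
      funext r
      unfold Fp
      refine Finset.sum_eq_zero fun i _ => Finset.sum_eq_zero fun j hj => ?_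
      rw [hv j hj]; simp
    rw [hF]
    simp only [Bf, mul_zero, coeff_zero, Finset.sum_const_zero, norm_zero]
    positivity
  suffices h : ‖Bf φ R (Fp C n0 v w)‖ ^ 2 ≤ 400 * M ^ 2 * V * W by
    have h2 := Real.le_sqrt_of_sq_le h
    refine h2.trans (le_of_eq ?_)
    rw [Real.sqrt_mul (by positivity), Real.sqrt_mul (by positivity), Real.sqrt_mul (by positivity), Real.sqrt_sq hM0]
    rw [show (400:ℝ) = 20 ^ 2 by norm_num, Real.sqrt_sq (by norm_num)]
  let Xv : ℂ → H := fun z => ∑ j ∈ Finset.range n0, z ^ j • v j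
  let Yv : ℂ → H := fun z => ∑ i ∈ Finset.range n0, (starRingEnd ℂ z) ^ i • w i
  obtain ⟨g, δ, hδ, hg1, hg2, hg3⟩ := exists_majorant (fun z => ‖Xv z‖) (by fun_prop)
    (fun z => norm_nonneg _) (Real.sqrt V) (Real.sqrt_pos.2 hV1)
  obtain ⟨x, ρ, hρ0, hρ1, hx, hinv⟩ := exists_inv g δ hδ hg2
  choose h hh using hinv
  have hF : ∀ q, Bf φ R (Fp C n0 v w) = Bf φ R (fun r => g * (h q * Fp C n0 v w r)) +
      Bf φ R (fun r => x ^ q * Fp C n0 v w r) := by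
    intro q
    rw [← Bf_add]
    congr 1
    funext r
    have : g * (h q * Fp C n0 v w r) = (h q * g) * Fp C n0 v w r := by ring
    rw [this, hh]; ring
  have hbd : ∀ q, ‖Bf φ R (fun r => g * (h q * Fp C n0 v w r))‖ ^ 2 ≤ 6 * M ^ 2 * (8 * V) * (8 * W) := by
    intro q
    set K : ℕ → ℂ[X] := fun r => h q * Fp C n0 v w r with hK
    obtain ⟨n1, hn1⟩ : ∃ n1, ∀ r < R, (K r).natDegree < n1 ∧ (φ * K r).natDegree < n1 := by
      refine ⟨∑ r ∈ Finset.range R, ((K r).natDegree + (φ * K r).natDegree) + 1, fun r hr => ?_⟩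
      have := Finset.single_le_sum (f := fun r => (K r).natDegree + (φ * K r).natDegree)
        (fun _ _ => Nat.zero_le _) (Finset.mem_range.2 hr)
      omega
    have hpR : 0 < 2 ^ R := by positivity
    set n := n1 + 2 ^ R + 2 * g.natDegree + (φ * g).natDegree + n0 + 1 with hn
    have hn0 : (0:ℝ) < n := by rw [hn]; positivity
    have hng : 2 * g.natDegree < n := by omega
    refine Bf_gK φ M hM R g K (8 * V) (8 * W) (by positivity) n (by omega) (by omega) (by omega)
      (fun r hr => (hn1 r hr).1.trans_le (by omega)) (fun r hr => (hn1 r hr).2.trans_le (by omega)) ?_ ?_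
    · refine (hg3 n hng).trans ?_
      have p1 := parseval_vec n (by omega) n0 (by omega) v
      have e1 : ∑ a ∈ Finset.range n, (‖Xv (rt n a)‖ + Real.sqrt V) ^ 2 ≤
          ∑ a ∈ Finset.range n, (2 * ‖Xv (rt n a)‖ ^ 2 + 2 * V) := by
        refine Finset.sum_le_sum fun a _ => ?_
        nlinarith [sq_nonneg (‖Xv (rt n a)‖ - Real.sqrt V), Real.sq_sqrt hV0]
      rw [Finset.sum_add_distrib, ← Finset.mul_sum, p1] at e1
      simp only [Finset.sum_const, Finset.card_range, nsmul_eq_mul] at e1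
      calc _ ≤ 2 * (n:ℝ)⁻¹ * (2 * (n * V) + n * (2 * V)) := by gcongr
        _ = 8 * V := by field_simp; ring
    · have p1 := parseval_vec_conj n (by omega) n0 (by omega) w
      have e1 : ∀ z : ℂ, ‖z‖ = 1 → ∑ r ∈ Finset.range R, ‖(K r).eval z‖ ^ 2 ≤ 8 * ‖Yv z‖ ^ 2 := by
        intro z hz
        have r1 := hC.row R (Xv z) (Yv z)
        have r2 : ∑ r ∈ Finset.range R, ‖(K r).eval z‖ ^ 2 = ‖(h q).eval z‖ ^ 2 *
            ∑ r ∈ Finset.range R, ‖(inner ℂ (Yv z) (C r (Xv z)) : ℂ)‖ ^ 2 := by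
          rw [Finset.mul_sum]
          refine Finset.sum_congr rfl fun r _ => ?_
          rw [hK]; simp only [eval_mul, norm_mul, mul_pow, Fp_eval]; rfl
        have r3 : ‖(h q).eval z‖ * ‖g.eval z‖ ≤ 2 := by
          rw [← norm_mul, ← eval_mul, hh, eval_sub, eval_one, eval_pow]
          refine (norm_sub_le _ _).trans ?_
          rw [norm_pow, norm_one]
          have : ‖x.eval z‖ ^ q ≤ 1 := pow_le_one₀ (norm_nonneg _) ((hx z hz).trans hρ1.le)
          linarith
        have r4 : ‖(h q).eval z‖ * ‖Xv z‖ ≤ 2 :=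
          le_trans (mul_le_mul_of_nonneg_left (hg1 z hz) (norm_nonneg _)) r3
        rw [r2]
        calc _ ≤ ‖(h q).eval z‖ ^ 2 * (2 * ‖Xv z‖ ^ 2 * ‖Yv z‖ ^ 2) := by gcongr
          _ = 2 * (‖(h q).eval z‖ * ‖Xv z‖) ^ 2 * ‖Yv z‖ ^ 2 := by ring
          _ ≤ 2 * 2 ^ 2 * ‖Yv z‖ ^ 2 := by gcongr
          _ = _ := by ring
      have e2 : ∑ r ∈ Finset.range R, (n * ∑ j ∈ Finset.range n, ‖(K r).coeff j‖ ^ 2) ≤ n * (8 * W) := by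
        calc _ = ∑ r ∈ Finset.range R, ∑ a ∈ Finset.range n, ‖(K r).eval (rt n a)‖ ^ 2 := by
              refine Finset.sum_congr rfl fun r hr => ?_
              rw [parseval_poly]
              exact (hn1 r (Finset.mem_range.1 hr)).1.trans_le (by omega)
          _ ≤ ∑ a ∈ Finset.range n, 8 * ‖Yv (rt n a)‖ ^ 2 := by
              rw [Finset.sum_comm]
              exact Finset.sum_le_sum fun a _ => e1 _ (norm_rt n a)
          _ = n * (8 * W) := by
              rw [← Finset.mul_sum, p1]; ring
      rw [← Finset.mul_sum] at e2
      exact le_of_mul_le_mul_left e2 hn0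
  have hlim : Filter.Tendsto (fun q => ‖Bf φ R (fun r => g * (h q * Fp C n0 v w r))‖ ^ 2) Filter.atTop
      (nhds (‖Bf φ R (Fp C n0 v w)‖ ^ 2)) := by
    have h1 := Bf_small φ R (Fp C n0 v w) x ρ hρ0 hρ1 hx
    have h2 : Filter.Tendsto (fun q => Bf φ R (fun r => g * (h q * Fp C n0 v w r))) Filter.atTop
        (nhds (Bf φ R (Fp C n0 v w))) := by
      have h3 := (tendsto_const_nhds (x := Bf φ R (Fp C n0 v w))).sub h1
      rw [sub_zero] at h3
      refine h3.congr fun q => ?_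
      rw [sub_eq_iff_eq_add]
      exact hF q
    exact h2.norm.pow 2
  refine le_of_tendsto' hlim fun q => (hbd q).trans ?_
  have : 0 ≤ M ^ 2 * V * W := by positivity
  nlinarith

end
end PB

namespace PB

/-- the space `ℓ²(ℕ; H0)` -/
noncomputable abbrev E0 := lp (fun _ : ℕ => H0) 2

theorem E0_norm_sq (v : E0) : ‖v‖ ^ 2 = ∑' n, ‖v n‖ ^ 2 := by
  have := lp.norm_rpow_eq_tsum (p := 2) (by norm_num) v
  simpa using this

theorem E0_summable (v : E0) : Summable fun n => ‖v n‖ ^ 2 := by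
  have := (memℓp_gen_iff (p := 2) (by norm_num)).1 (lp.memℓp v)
  simpa using this

theorem E0_sum_le (v : E0) (s : Finset ℕ) : ∑ n ∈ s, ‖v n‖ ^ 2 ≤ ‖v‖ ^ 2 := by
  rw [E0_norm_sq]
  exact (E0_summable v).sum_le_tsum s fun _ _ => by positivity

theorem memE0 (f : ℕ → H0) (h : Summable fun n => ‖f n‖ ^ 2) : Memℓp f 2 := by
  rw [memℓp_gen_iff (by norm_num)]
  simpa using h

theorem E0_norm_le (v : E0) (A : ℝ) (hA : 0 ≤ A) (h : ∀ n, ∑ i ∈ Finset.range n, ‖v i‖ ^ 2 ≤ A ^ 2) :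
    ‖v‖ ≤ A := by
  have h1 : ‖v‖ ^ 2 ≤ A ^ 2 := by
    rw [E0_norm_sq]
    exact (E0_summable v).tsum_le_of_sum_range_le h
  exact (sq_le_sq₀ (norm_nonneg _) hA).1 h1

/-- shifted sequence -/
noncomputable def shf (f : ℕ → H0) : ℕ → H0 := fun n => Nat.casesOn n 0 f

/-- forward shift -/
noncomputable def Sf : E0 →L[ℂ] E0 :=
  LinearMap.mkContinuous
    { toFun := fun v => ⟨shf v, memE0 _ (by
        rw [← summable_nat_add_iff 1]
        exact E0_summable v)⟩
      map_add' := fun x y => by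
        ext1; funext n; cases n with
        | zero => exact (add_zero (0:H0)).symm
        | succ n => rfl
      map_smul' := fun c x => by
        ext1; funext n; cases n with
        | zero => simp [shf]
        | succ n => rfl } 1 (by
    intro v
    rw [one_mul]
    apply E0_norm_le _ _ (norm_nonneg _)
    intro n
    cases n with
    | zero => simp
    | succ n =>
      rw [Finset.sum_range_succ']
      have := E0_sum_le v (Finset.range n)
      simpa [shf] using this)

@[simp] theorem Sf_zero (v : E0) : Sf v 0 = 0 := rfl
@[simp] theorem Sf_succ (v : E0) (n : ℕ) : Sf v (n+1) = v n := rfl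

/-- backward shift -/
noncomputable def Bk : E0 →L[ℂ] E0 :=
  LinearMap.mkContinuous
    { toFun := fun v => ⟨fun n => v (n+1), memE0 _ ((summable_nat_add_iff 1).2 (E0_summable v))⟩
      map_add' := fun x y => rfl
      map_smul' := fun c x => rfl } 1 (by
    intro v
    rw [one_mul]
    apply E0_norm_le _ _ (norm_nonneg _)
    intro n
    have := E0_sum_le v (Finset.range (n+1))
    rw [Finset.sum_range_succ'] at this
    have h0 : 0 ≤ ‖v 0‖ ^ 2 := by positivity
    show ∑ x ∈ Finset.range n, ‖v (x + 1)‖ ^ 2 ≤ ‖v‖ ^ 2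
    linarith)

@[simp] theorem Bk_apply (v : E0) (n : ℕ) : Bk v n = v (n+1) := rfl

theorem Bk_adj (w u : E0) : inner ℂ w (Bk u) = inner ℂ (Sf w) u := by
  have h1 : inner ℂ (Sf w) u = ∑' n, inner ℂ (Sf w n) (u n) := lp.inner_eq_tsum _ _
  have h2 : inner ℂ w (Bk u) = ∑' n, inner ℂ (w n) (Bk u n) := lp.inner_eq_tsum _ _
  have h3 : Summable fun n => inner ℂ (Sf w n) (u n) := lp.summable_inner (Sf w) u
  rw [h1, h2, h3.tsum_eq_zero_add, Sf_zero, inner_zero_left, zero_add]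
  rfl

/-- Hankel block -/
noncomputable def Gr (r : ℕ) : E0 →L[ℂ] E0 :=
  LinearMap.mkContinuous
    { toFun := fun v => ⟨fun i => if i < 2 ^ r then Cl r (v (2 ^ r - 1 - i)) else 0, memE0 _ (by
        apply summable_of_hasFiniteSupport
        refine (Set.finite_lt_nat (2 ^ r)).subset fun i hi => ?_
        by_contra h
        apply hi
        have h' : ¬ i < 2 ^ r := h
        simp [h'])⟩
      map_add' := fun x y => by
        ext1; funext n; simp only [lp.coeFn_add, Pi.add_apply, map_add]
        split_ifs <;> simp
      map_smul' := fun c x => by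
        ext1; funext n; simp only [lp.coeFn_smul, Pi.smul_apply, map_smul, RingHom.id_apply]
        split_ifs <;> simp } 1 (by
    intro v
    rw [one_mul]
    apply E0_norm_le _ _ (norm_nonneg _)
    intro n
    have h1 : ∑ i ∈ Finset.range (2 ^ r), ‖v (2 ^ r - 1 - i)‖ ^ 2 ≤ ‖v‖ ^ 2 := by
      rw [Finset.sum_range_reflect (fun b => ‖v b‖ ^ 2) (2 ^ r)]
      exact E0_sum_le v _
    refine le_trans ?_ h1
    have h2 : ∀ i, ‖(if i < 2 ^ r then Cl r (v (2 ^ r - 1 - i)) else 0)‖ ^ 2 =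
      if i < 2 ^ r then ‖v (2 ^ r - 1 - i)‖ ^ 2 else 0 := by
      intro i
      split_ifs
      · rw [Cl_cliff.norm]
      · simp
    simp only [LinearMap.coe_mk, AddHom.coe_mk]
    simp_rw [h2]
    rw [← Finset.sum_filter]
    apply Finset.sum_le_sum_of_subset_of_nonneg
    · intro i hi; simp at hi ⊢; exact hi.2
    · intro _ _ _; positivity)

theorem Gr_apply (r : ℕ) (v : E0) (i : ℕ) :
    Gr r v i = if i < 2 ^ r then Cl r (v (2 ^ r - 1 - i)) else 0 := rfl

theorem Gr_norm (r : ℕ) : ‖Gr r‖ ≤ 1 := LinearMap.mkContinuous_norm_le _ zero_le_one _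

theorem Gr_comm (r : ℕ) (v : E0) : Bk (Gr r v) = Gr r (Sf v) := by
  ext1; funext i
  rw [Bk_apply, Gr_apply, Gr_apply]
  by_cases h : i + 1 < 2 ^ r
  · rw [if_pos h, if_pos (by omega)]
    have : 2 ^ r - 1 - i = (2 ^ r - 1 - (i + 1)) + 1 := by omega
    rw [this, Sf_succ]
  · rw [if_neg h]
    split_ifs with h2
    · have : 2 ^ r - 1 - i = 0 := by omega
      rw [this]; simp
    · rfl

theorem Ga_summable : Summable fun r : ℕ => (1 / 2 ^ r : ℂ) • Gr r := by
  refine Summable.of_norm_bounded (g := fun r : ℕ => (1 / 2 : ℝ) ^ r) summable_geometric_two fun r => ?_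
  rw [norm_smul]
  have := Gr_norm r
  have e : ‖(1 / 2 ^ r : ℂ)‖ = (1 / 2 : ℝ) ^ r := by simp
  rw [e]
  exact mul_le_of_le_one_right (by positivity) this

/-- the full Hankel operator -/
noncomputable def Ga : E0 →L[ℂ] E0 := ∑' r : ℕ, (1 / 2 ^ r : ℂ) • Gr r

theorem Ga_hasSum (v : E0) : HasSum (fun r : ℕ => (1 / 2 ^ r : ℂ) • Gr r v) (Ga v) := by
  have := Ga_summable.hasSum
  exact this.mapL (ContinuousLinearMap.apply ℂ E0 v)

theorem Ga_comm (v : E0) : Bk (Ga v) = Ga (Sf v) := by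
  have h1 := (Ga_hasSum v).mapL Bk
  have h2 := Ga_hasSum (Sf v)
  refine h1.unique ?_
  convert h2 using 2 with r
  rw [map_smul, Gr_comm]

/-- The Foguel-Hankel operator -/
noncomputable def T0 : E0 × E0 →L[ℂ] E0 × E0 :=
  (Bk.comp (ContinuousLinearMap.fst ℂ E0 E0) + Ga.comp (ContinuousLinearMap.snd ℂ E0 E0)).prod
    (Sf.comp (ContinuousLinearMap.snd ℂ E0 E0))

@[simp] theorem T0_apply (u v : E0) : T0 (u, v) = (Bk u + Ga v, Sf v) := rfl

theorem Bk_pow_Ga (n : ℕ) (v : E0) : (Bk ^ n) (Ga v) = Ga ((Sf ^ n) v) := by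
  induction n with
  | zero => simp
  | succ n ih =>
    rw [pow_succ', pow_succ', ContinuousLinearMap.mul_apply, ih, Ga_comm,
      ContinuousLinearMap.mul_apply]

theorem T0_pow (n : ℕ) (u v : E0) :
    (T0 ^ n) (u, v) = ((Bk ^ n) u + (n:ℂ) • Ga ((Sf ^ (n-1)) v), (Sf ^ n) v) := by
  induction n with
  | zero => simp
  | succ n ih =>
    rw [pow_succ', ContinuousLinearMap.mul_apply, ih, T0_apply, pow_succ', pow_succ']
    simp only [ContinuousLinearMap.mul_apply, map_add, map_smul, Ga_comm, Nat.add_sub_cancel]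
    congr 1
    cases n with
    | zero => simp
    | succ n =>
      have : Sf ((Sf ^ (n + 1 - 1)) v) = (Sf ^ (n+1)) v := by
        rw [pow_succ' Sf n, ContinuousLinearMap.mul_apply]; rfl
      rw [this]
      push_cast
      module

theorem T0_aeval (φ : ℂ[X]) (u v : E0) :
    (aeval T0 φ) (u, v) = (aeval Bk φ u + Ga (aeval Sf (derivative φ) v), aeval Sf φ v) := by
  induction φ using Polynomial.induction_on' with
  | add p q hp hq =>
    simp only [map_add, ContinuousLinearMap.add_apply, hp, hq, Prod.mk_add_mk]
    congr 1; abel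
  | monomial n a =>
    rw [derivative_monomial]
    simp only [aeval_monomial, Algebra.algebraMap_eq_smul_one, smul_mul_assoc, one_mul,
      ContinuousLinearMap.smul_apply, T0_pow, map_smul, Prod.smul_mk]
    congr 1
    module

theorem Sf_pow_apply (k : ℕ) (v : E0) (m : ℕ) : (Sf ^ k) v m = if k ≤ m then v (m - k) else 0 := by
  induction k generalizing m with
  | zero => simp
  | succ k ih =>
    rw [pow_succ', ContinuousLinearMap.mul_apply]
    cases m with
    | zero => simp
    | succ m => rw [Sf_succ, ih]; simp

theorem aeval_Sf (φ : ℂ[X]) (v : E0) (m : ℕ) : 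
    aeval Sf φ v m = ∑ k ∈ Finset.range (φ.natDegree + 1), φ.coeff k • (if k ≤ m then v (m - k) else 0) := by
  rw [aeval_eq_sum_range]
  simp only [ContinuousLinearMap.sum_apply, ContinuousLinearMap.smul_apply]
  rw [lp.coeFn_sum, Finset.sum_apply]
  refine Finset.sum_congr rfl fun k _ => ?_
  rw [lp.coeFn_smul, Pi.smul_apply, Sf_pow_apply]

theorem aeval_Sf_norm (φ : ℂ[X]) (M : ℝ) (hM : ∀ z : ℂ, ‖z‖ = 1 → ‖φ.eval z‖ ≤ M) (v : E0) :
    ‖aeval Sf φ v‖ ≤ M * ‖v‖ := by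
  have hM0 : 0 ≤ M := (norm_nonneg _).trans (hM 1 (by simp))
  apply E0_norm_le _ _ (by positivity)
  intro n
  set d := φ.natDegree with hd
  let v' : ℕ → H0 := fun j => if j < n then v j else 0
  let c : ℕ → H0 := fun m => ∑ k ∈ Finset.range (d + 1), φ.coeff k • (if k ≤ m then v' (m - k) else 0)
  set N := n + d + 1 with hN
  have hNpos : (0:ℝ) < N := by rw [hN]; positivity
  have e1 : ∀ z : ℂ, ∑ m ∈ Finset.range N, z ^ m • c m =
      φ.eval z • ∑ j ∈ Finset.range n, z ^ j • v j := by
    intro z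
    simp only [c, Finset.smul_sum]
    rw [Finset.sum_comm, eval_eq_sum_range]
    simp_rw [Finset.sum_smul]
    conv_rhs => rw [Finset.sum_comm]
    refine Finset.sum_congr rfl fun k hk => ?_
    have hk' : N = k + (N - k) := by rw [Finset.mem_range] at hk; omega
    rw [hk', Finset.sum_range_add, Finset.sum_eq_zero, zero_add]
    · have hsub : Finset.range n ⊆ Finset.range (N - k) := by
        apply Finset.range_mono; rw [Finset.mem_range] at hk; omega
      rw [← Finset.sum_subset hsub]
      · refine Finset.sum_congr rfl fun j hj => ?_
        rw [Finset.mem_range] at hj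
        simp only [v', Nat.le_add_right, if_true, Nat.add_sub_cancel_left, if_pos hj, smul_smul]
        congr 1; rw [pow_add]; ring
      · intro j _ hj
        rw [Finset.mem_range] at hj
        simp [v', hj]
    · intro m hm
      rw [Finset.mem_range] at hm
      simp [not_le.2 hm]
  have p1 := parseval_vec N (by omega) N le_rfl c
  have p2 := parseval_vec N (by omega) n (by omega) (fun j => v j)
  have h1 : ∑ j ∈ Finset.range N, ‖c j‖ ^ 2 ≤ M ^ 2 * ∑ j ∈ Finset.range n, ‖v j‖ ^ 2 := by
    refine le_of_mul_le_mul_left ?_ hNpos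
    calc N * ∑ j ∈ Finset.range N, ‖c j‖ ^ 2 = _ := p1.symm
      _ ≤ M ^ 2 * ∑ a ∈ Finset.range N, ‖∑ j ∈ Finset.range n, rt N a ^ j • v j‖ ^ 2 := by
          rw [Finset.mul_sum]
          refine Finset.sum_le_sum fun a _ => ?_
          rw [e1, norm_smul, mul_pow]
          have := hM _ (norm_rt N a)
          gcongr
      _ = _ := by rw [p2]; ring
  calc ∑ i ∈ Finset.range n, ‖aeval Sf φ v i‖ ^ 2 = ∑ i ∈ Finset.range n, ‖c i‖ ^ 2 := by
        refine Finset.sum_congr rfl fun i hi => ?_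
        rw [Finset.mem_range] at hi
        rw [aeval_Sf]
        congr 2
        refine Finset.sum_congr rfl fun k _ => ?_
        simp only [v']
        rw [if_pos (show i - k < n by omega)]
    _ ≤ ∑ i ∈ Finset.range N, ‖c i‖ ^ 2 :=
        Finset.sum_le_sum_of_subset_of_nonneg (Finset.range_mono (by omega)) fun _ _ _ => by positivity
    _ ≤ _ := h1
    _ ≤ (M * ‖v‖) ^ 2 := by
        rw [mul_pow]
        have := E0_sum_le v (Finset.range n)
        gcongr

theorem aeval_Bk_inner (φ : ℂ[X]) (w u : E0) :
    inner ℂ w (aeval Bk φ u) = inner ℂ (aeval Sf (φ.map (starRingEnd ℂ)) w) u := by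
  have hp : ∀ (n : ℕ) (w : E0), inner ℂ w ((Bk ^ n) u) = inner ℂ ((Sf ^ n) w) u := by
    intro n
    induction n with
    | zero => intro w; simp
    | succ n ih =>
      intro w
      rw [pow_succ', pow_succ, ContinuousLinearMap.mul_apply, Bk_adj, ih,
        ContinuousLinearMap.mul_apply]
  induction φ using Polynomial.induction_on' with
  | add p q hp hq =>
    simp only [map_add, ContinuousLinearMap.add_apply, hp, hq, inner_add_right, inner_add_left,
      Polynomial.map_add]
  | monomial n a =>
    rw [Polynomial.map_monomial]
    simp only [aeval_monomial, Algebra.algebraMap_eq_smul_one, smul_mul_assoc, one_mul,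
      ContinuousLinearMap.smul_apply, inner_smul_right, inner_smul_left, hp]
    simp

theorem aeval_Bk_norm (φ : ℂ[X]) (M : ℝ) (hM : ∀ z : ℂ, ‖z‖ = 1 → ‖φ.eval z‖ ≤ M) (u : E0) :
    ‖aeval Bk φ u‖ ≤ M * ‖u‖ := by
  have hM0 : 0 ≤ M := (norm_nonneg _).trans (hM 1 (by simp))
  have hM' : ∀ z : ℂ, ‖z‖ = 1 → ‖(φ.map (starRingEnd ℂ)).eval z‖ ≤ M := by
    intro z hz
    have h1 := hM (starRingEnd ℂ z) (by simpa using hz)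
    have h2 : (φ.map (starRingEnd ℂ)).eval z = starRingEnd ℂ (φ.eval (starRingEnd ℂ z)) := by
      have := Polynomial.eval_map_apply (f := starRingEnd ℂ) (p := φ) (x := starRingEnd ℂ z)
      simpa using this
    rw [h2]; simpa using h1
  set y := aeval Bk φ u with hy
  have h1 := aeval_Bk_inner φ y u
  have h2 : ‖y‖ ^ 2 ≤ M * ‖y‖ * ‖u‖ := by
    have h3 : ‖(inner ℂ y y : ℂ)‖ = ‖y‖ ^ 2 := by rw [inner_self_eq_norm_sq_to_K]; simp
    rw [← h3]
    refine (le_of_eq (congrArg norm h1)).trans ((norm_inner_le_norm _ _).trans ?_)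
    gcongr
    exact aeval_Sf_norm _ M hM' y
  rcases (norm_nonneg y).eq_or_lt with h | h
  · rw [← h]; positivity
  · nlinarith

end PB

namespace PB

theorem Fp_coeff (n0 : ℕ) (v w : ℕ → H0) (r l : ℕ) (hl : l < n0) :
    (Fp Cl n0 v w r).coeff l = ∑ i ∈ Finset.range (l + 1), inner ℂ (w i) (Cl r (v (l - i))) := by
  unfold Fp
  simp only [finset_sum_coeff, coeff_monomial]
  have hsub : Finset.range (l+1) ⊆ Finset.range n0 := Finset.range_mono (by omega)
  rw [← Finset.sum_subset hsub]
  · refine Finset.sum_congr rfl fun i hi => ?_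
    rw [Finset.mem_range] at hi
    rw [Finset.sum_eq_single (l - i)]
    · rw [if_pos (by omega)]
    · intro j _ hj
      rw [if_neg (by omega)]
    · intro h
      exact absurd (Finset.mem_range.2 (by omega)) h
  · intro i _ hi
    rw [Finset.mem_range] at hi
    refine Finset.sum_eq_zero fun j _ => ?_
    rw [if_neg (by omega)]

theorem inner_Gr (r : ℕ) (w u : E0) :
    inner ℂ w (Gr r u) = ∑ i ∈ Finset.range (2 ^ r), inner ℂ (w i) (Cl r (u (2 ^ r - 1 - i))) := by
  have h1 : inner ℂ w (Gr r u) = ∑' n, inner ℂ (w n) (Gr r u n) := lp.inner_eq_tsum _ _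
  rw [h1, tsum_eq_sum (s := Finset.range (2 ^ r))]
  · refine Finset.sum_congr rfl fun i hi => ?_
    rw [Gr_apply, if_pos (Finset.mem_range.1 hi)]
  · intro i hi
    rw [Gr_apply, if_neg (fun h => hi (Finset.mem_range.2 h)), inner_zero_right]

theorem inner_Gr_aeval (r n0 : ℕ) (hn : 2 ^ r ≤ n0) (ψ : ℂ[X]) (w v : E0) :
    inner ℂ w (Gr r (aeval Sf ψ v)) = (ψ * Fp Cl n0 v w r).coeff (2 ^ r - 1) := by
  have hpos : 0 < 2 ^ r := by positivity
  induction ψ using Polynomial.induction_on' with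
  | add p q hp hq =>
    simp only [map_add, ContinuousLinearMap.add_apply, hp, hq, inner_add_right, add_mul, coeff_add]
  | monomial k a =>
    rw [← C_mul_X_pow_eq_monomial, mul_assoc, coeff_C_mul, coeff_X_pow_mul']
    simp only [map_mul, map_pow, aeval_C, aeval_X, Algebra.algebraMap_eq_smul_one, smul_mul_assoc,
      one_mul, ContinuousLinearMap.smul_apply, map_smul, inner_smul_right]
    congr 1
    rw [inner_Gr]
    simp only [Sf_pow_apply]
    split_ifs with h
    · rw [Fp_coeff _ _ _ _ _ (by omega)]
      have hsub : Finset.range (2 ^ r - 1 - k + 1) ⊆ Finset.range (2 ^ r) :=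
        Finset.range_mono (by omega)
      rw [← Finset.sum_subset hsub]
      · refine Finset.sum_congr rfl fun i hi => ?_
        rw [Finset.mem_range] at hi
        rw [if_pos (by omega)]
        have : 2 ^ r - 1 - i - k = 2 ^ r - 1 - k - i := by omega
        rw [this]
      · intro i hi' hi
        rw [Finset.mem_range] at hi hi'
        rw [if_neg (by omega), map_zero, inner_zero_right]
    · refine Finset.sum_eq_zero fun i _ => ?_
      rw [if_neg (by omega), map_zero, inner_zero_right]

theorem Ga_aeval_norm (φ : ℂ[X]) (M : ℝ) (hM : ∀ z : ℂ, ‖z‖ = 1 → ‖φ.eval z‖ ≤ M) (v : E0) :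
    ‖Ga (aeval Sf (derivative φ) v)‖ ≤ 20 * M * ‖v‖ := by
  have hM0 : 0 ≤ M := (norm_nonneg _).trans (hM 1 (by simp))
  have key : ∀ w : E0, ‖inner ℂ w (Ga (aeval Sf (derivative φ) v))‖ ≤ 20 * M * ‖v‖ * ‖w‖ := by
    intro w
    have h1 := ((Ga_hasSum (aeval Sf (derivative φ) v)).mapL (innerSL ℂ w)).tendsto_sum_nat
    refine le_of_tendsto h1.norm (Filter.Eventually.of_forall fun R => ?_)
    have e : ∑ r ∈ Finset.range R, (innerSL ℂ w) ((1 / 2 ^ r : ℂ) • Gr r (aeval Sf (derivative φ) v))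
        = Bf φ R (Fp Cl (2 ^ R) v w) := by
      unfold Bf
      refine Finset.sum_congr rfl fun r hr => ?_
      rw [Finset.mem_range] at hr
      rw [map_smul, innerSL_apply_apply, smul_eq_mul,
        inner_Gr_aeval r (2 ^ R) (Nat.pow_le_pow_right (by norm_num) hr.le)]
      congr 1
      have h2 : 2 ^ r = (2 ^ r - 1) + 1 := by
        have : 0 < 2 ^ r := by positivity
        omega
      conv_rhs => rw [h2, mul_assoc, coeff_X_mul]
    rw [e]
    refine (main_est Cl_cliff φ M hM R (2 ^ R) v w).trans ?_
    have a1 : √(∑ j ∈ Finset.range (2 ^ R), ‖v j‖ ^ 2) ≤ ‖v‖ :=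
      Real.sqrt_le_iff.2 ⟨norm_nonneg _, E0_sum_le v _⟩
    have a2 : √(∑ j ∈ Finset.range (2 ^ R), ‖w j‖ ^ 2) ≤ ‖w‖ :=
      Real.sqrt_le_iff.2 ⟨norm_nonneg _, E0_sum_le w _⟩
    gcongr
  set y := Ga (aeval Sf (derivative φ) v) with hy
  have h2 := key y
  have h3 : ‖(inner ℂ y y : ℂ)‖ = ‖y‖ ^ 2 := by rw [inner_self_eq_norm_sq_to_K]; simp
  rw [h3] at h2
  rcases (norm_nonneg y).eq_or_lt with h | h
  · rw [← h]; positivity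
  · nlinarith

theorem T0_aeval_norm (φ : ℂ[X]) (M : ℝ) (hM : ∀ z : ℂ, ‖z‖ = 1 → ‖φ.eval z‖ ≤ M) :
    ‖aeval T0 φ‖ ≤ 21 * M := by
  have hM0 : 0 ≤ M := (norm_nonneg _).trans (hM 1 (by simp))
  refine ContinuousLinearMap.opNorm_le_bound _ (by positivity) fun x => ?_
  obtain ⟨u, v⟩ := x
  rw [T0_aeval, Prod.norm_def, Prod.norm_def]
  have h1 := aeval_Bk_norm φ M hM u
  have h2 := Ga_aeval_norm φ M hM v
  have h3 := aeval_Sf_norm φ M hM v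
  have a1 : ‖u‖ ≤ max ‖u‖ ‖v‖ := le_max_left _ _
  have a2 : ‖v‖ ≤ max ‖u‖ ‖v‖ := le_max_right _ _
  have b1 := mul_le_mul_of_nonneg_left a1 hM0
  have b2 := mul_le_mul_of_nonneg_left a2 hM0
  have b0 : 0 ≤ M * max ‖u‖ ‖v‖ := by positivity
  refine max_le ?_ ?_
  · refine (norm_add_le _ _).trans ?_
    linarith
  · show ‖aeval Sf φ v‖ ≤ _
    linarith

/-- vector in the zeroth coordinate -/
noncomputable def z0 (h : H0) : E0 := lp.single 2 0 h

theorem z0_apply (h : H0) (n : ℕ) : z0 h n = if n = 0 then h else 0 := by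
  rw [z0, lp.single_apply]
  rcases n with _ | n
  · simp
  · simp [Pi.single_apply]

theorem norm_z0 (h : H0) : ‖z0 h‖ = ‖h‖ := lp.norm_single (by norm_num) _ _

theorem T0_lower (r : ℕ) (h : H0) : ((T0 ^ (2 ^ r)) (0, z0 h)).1 0 = Cl r h := by
  have hpos : 0 < 2 ^ r := by positivity
  rw [T0_pow, map_zero, zero_add]
  show (((2 ^ r : ℕ) : ℂ) • Ga ((Sf ^ (2 ^ r - 1)) (z0 h))) 0 = _
  have h1 := (Ga_hasSum ((Sf ^ (2 ^ r - 1)) (z0 h))).mapL (lp.evalCLM ℂ (fun _ : ℕ => H0) 2 0)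
  have h2 : HasSum (fun q : ℕ => if q = r then (1 / 2 ^ r : ℂ) • Cl r h else 0)
      ((1 / 2 ^ r : ℂ) • Cl r h) := hasSum_ite_eq r _
  have h3 := h1.unique (a₂ := (1 / 2 ^ r : ℂ) • Cl r h) (by
    convert h2 using 2 with q
    have hq : 0 < 2 ^ q := by positivity
    rw [map_smul]
    show (1 / 2 ^ q : ℂ) • Gr q ((Sf ^ (2 ^ r - 1)) (z0 h)) 0 = _
    rw [Gr_apply, if_pos hq, Sf_pow_apply, z0_apply]
    split_ifs with c1 c2 c3 c4
    · rw [c3]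
    · exfalso
      have : 2 ^ q = 2 ^ r := by omega
      exact c3 (Nat.pow_right_injective (le_refl 2) this)
    · subst c4; omega
    · simp
    · rename_i c5; subst c5; omega
    · simp)
  have h4 : Ga ((Sf ^ (2 ^ r - 1)) (z0 h)) 0 = (1 / 2 ^ r : ℂ) • Cl r h := h3
  rw [lp.coeFn_smul, Pi.smul_apply, h4, smul_smul]
  have : (((2 ^ r : ℕ) : ℂ)) * (1 / 2 ^ r : ℂ) = 1 := by
    push_cast; field_simp
  rw [this, one_smul]

end PB

namespace PB

/-- a Rademacher-type system -/
structure Rad {κ Ω : Type} [MeasurableSpace Ω] (P : Measure Ω) (X : κ → Ω → ℝ) : Prop where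
  prob : IsProbabilityMeasure P
  meas : ∀ i, Measurable (X i)
  abs : ∀ i ω, |X i ω| = 1
  orth : ∀ i j, i ≠ j → ∫ ω, X i ω * X j ω ∂P = 0
  exp : ∀ (s : Finset κ) (a : κ → ℝ),
    ∫ ω, Real.exp (∑ i ∈ s, a i * X i ω) ∂P ≤ Real.exp ((∑ i ∈ s, a i ^ 2) / 2)

/-- fair coin -/
noncomputable def coin : Measure Bool :=
  (1/2 : ℝ≥0∞) • Measure.dirac true + (1/2 : ℝ≥0∞) • Measure.dirac false

instance : IsProbabilityMeasure coin := by
  constructor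
  simp [coin, ENNReal.inv_two_add_inv_two]

/-- sign -/
def sgn (b : Bool) : ℝ := if b then 1 else -1

theorem coin_mean : ∫ b, sgn b ∂coin = 0 := by
  have hi : ∀ b : Bool, Integrable sgn ((1/2 : ℝ≥0∞) • Measure.dirac b) := fun b =>
    (Integrable.of_finite (μ := Measure.dirac b)).smul_measure (by norm_num)
  rw [coin, integral_add_measure (hi _) (hi _), integral_smul_measure, integral_smul_measure]
  simp [sgn]

theorem rad_coin (κ : Type) :
    Rad (Measure.infinitePi fun _ : κ => coin) (fun i ω => sgn (ω i)) := by
  have hm : Measurable sgn := measurable_of_countable _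
  have hind : ProbabilityTheory.iIndepFun (fun (i : κ) (ω : κ → Bool) => sgn (ω i))
      (Measure.infinitePi fun _ : κ => coin) :=
    ProbabilityTheory.iIndepFun_infinitePi (P := fun _ : κ => coin) (X := fun _ => sgn) fun _ => hm
  have hmi : ∀ i : κ, Measurable fun ω : κ → Bool => sgn (ω i) := fun i => hm.comp (measurable_pi_apply i)
  have hmean : ∀ i : κ, ∫ ω, sgn (ω i) ∂(Measure.infinitePi fun _ : κ => coin) = 0 := by
    intro i
    have h1 := integral_map (μ := Measure.infinitePi fun _ : κ => coin)
      (measurable_pi_apply i).aemeasurable (f := sgn) hm.aestronglyMeasurable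
    rw [Measure.infinitePi_map_eval (fun _ : κ => coin) i, coin_mean] at h1
    exact h1.symm
  refine ⟨inferInstance, hmi, ?_, ?_, ?_⟩
  · intro i ω
    unfold sgn; split_ifs <;> simp
  · intro i j hij
    have := (hind.indepFun hij).integral_fun_mul_eq_mul_integral
      (hmi i).aestronglyMeasurable (hmi j).aestronglyMeasurable
    rw [this, hmean, zero_mul]
  · intro s a
    have h1 : ∀ i : κ, ProbabilityTheory.HasSubgaussianMGF (fun ω : κ → Bool => sgn (ω i))
        ((‖(1:ℝ) - (-1)‖₊ / 2) ^ 2) (Measure.infinitePi fun _ : κ => coin) := fun i =>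
      ProbabilityTheory.hasSubgaussianMGF_of_mem_Icc_of_integral_eq_zero (hmi i).aemeasurable
        (ae_of_all _ fun ω => by unfold sgn; split_ifs <;> simp) (hmean i)
    have h2 := fun i => (h1 i).const_mul (a i)
    have hind2 := hind.comp (fun i x => a i * x) (fun i => by fun_prop)
    have h3 := ProbabilityTheory.HasSubgaussianMGF.sum_of_iIndepFun (s := s) hind2 (fun i _ => h2 i)
    have h4 := h3.mgf_le 1
    simp only [ProbabilityTheory.mgf, one_mul, Function.comp] at h4
    refine h4.trans (le_of_eq ?_)
    congr 1
    have e : (‖(1:ℝ) - (-1)‖₊ / 2 : NNReal) ^ 2 = 1 := by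
      have : ‖(1:ℝ) - (-1)‖₊ = 2 := by
        ext; simp; norm_num
      rw [this]; simp
    rw [e]
    push_cast
    simp only [one_pow, mul_one]
    congr 1
    exact Finset.sum_congr rfl fun i _ => mul_one (a i ^ 2)

theorem Rad.comp {κ Ω Ω2 : Type} [MeasurableSpace Ω] [MeasurableSpace Ω2] {P : Measure Ω} {X : κ → Ω → ℝ}
    (h : Rad P X) (P2 : Measure Ω2) (g : Ω2 → Ω) (hg : Measurable g) (hP : P2.map g = P) :
    Rad P2 (fun i ω => X i (g ω)) := by
  have hX := h.meas
  refine ⟨?_, fun i => (h.meas i).comp hg, fun i ω => h.abs i _, ?_, ?_⟩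
  · have := h.prob
    rw [← hP] at this
    exact (Measure.isProbabilityMeasure_map_iff hg.aemeasurable).1 this
  · intro i j hij
    rw [← h.orth i j hij, ← hP, integral_map hg.aemeasurable]
    exact ((h.meas i).mul (h.meas j)).aestronglyMeasurable
  · intro s a
    refine le_trans (le_of_eq ?_) (h.exp s a)
    rw [← hP, integral_map hg.aemeasurable]
    apply Measurable.aestronglyMeasurable
    fun_prop

theorem exists_rad (κ : Type) [Countable κ] : ∃ X : κ → I → ℝ, Rad (volume : Measure I) X := by
  obtain ⟨g, hg, hP⟩ := MeasureTheory.Measure.exists_measurable_map_eq (Measure.infinitePi fun _ : κ => coin)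
  exact ⟨_, (rad_coin κ).comp volume g hg hP⟩

/-- Khintchine constant -/
noncomputable def Kh (q : ℝ) : ℝ := 2 * (1 + (⌈q⌉₊).factorial) * Real.exp 2

theorem Kh_pos (q : ℝ) : 0 < Kh q := by unfold Kh; positivity

theorem rpow_le_exp (q : ℝ) (hq : 0 ≤ q) (x : ℝ) (hx : 0 ≤ x) :
    x ^ q ≤ (1 + (⌈q⌉₊).factorial) * Real.exp x := by
  have h1 : 1 ≤ Real.exp x := Real.one_le_exp hx
  rcases le_total x 1 with h | h
  · have : x ^ q ≤ 1 := Real.rpow_le_one hx h hq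
    nlinarith [(Nat.cast_nonneg (⌈q⌉₊).factorial : (0:ℝ) ≤ _)]
  · have h2 : x ^ q ≤ x ^ (⌈q⌉₊ : ℕ) := by
      rw [← Real.rpow_natCast]
      exact Real.rpow_le_rpow_of_exponent_le h (Nat.le_ceil q)
    have h3 := Real.pow_div_factorial_le_exp x hx ⌈q⌉₊
    rw [div_le_iff₀ (by positivity)] at h3
    nlinarith

variable {κ Ω : Type} [MeasurableSpace Ω] {P : Measure Ω} {X : κ → Ω → ℝ}

theorem Rad.sum_norm_le (h : Rad P X) (s : Finset κ) (a : κ → ℂ) (ω : Ω) :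
    ‖∑ i ∈ s, a i * (X i ω : ℂ)‖ ≤ ∑ i ∈ s, ‖a i‖ := by
  refine (norm_sum_le _ _).trans (le_of_eq ?_)
  refine Finset.sum_congr rfl fun i _ => ?_
  rw [norm_mul, Complex.norm_real, Real.norm_eq_abs, h.abs, mul_one]

theorem Rad.sum_meas (h : Rad P X) (s : Finset κ) (a : κ → ℂ) :
    Measurable fun ω => ∑ i ∈ s, a i * (X i ω : ℂ) := by
  have := h.meas
  fun_prop

theorem Rad.sum_int (h : Rad P X) (s : Finset κ) (a : κ → ℂ) (q : ℝ) (hq : 0 ≤ q) :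
    Integrable (fun ω => ‖∑ i ∈ s, a i * (X i ω : ℂ)‖ ^ q) P := by
  have := h.prob
  refine Integrable.of_bound (C := (∑ i ∈ s, ‖a i‖) ^ q) ?_ (ae_of_all _ fun ω => ?_)
  · have := h.sum_meas s a
    apply Measurable.aestronglyMeasurable
    fun_prop
  · rw [Real.norm_of_nonneg (by positivity)]
    exact Real.rpow_le_rpow (norm_nonneg _) (h.sum_norm_le s a ω) hq

theorem Rad.exp_int (h : Rad P X) (s : Finset κ) (a : κ → ℝ) :
    Integrable (fun ω => Real.exp (∑ i ∈ s, a i * X i ω)) P := by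
  have := h.prob
  refine Integrable.of_bound (C := Real.exp (∑ i ∈ s, |a i|)) ?_ (ae_of_all _ fun ω => ?_)
  · have := h.meas
    apply Measurable.aestronglyMeasurable
    fun_prop
  · rw [Real.norm_of_nonneg (by positivity)]
    apply Real.exp_le_exp.2
    refine Finset.sum_le_sum fun i _ => ?_
    refine (le_abs_self _).trans ?_
    rw [abs_mul, h.abs, mul_one]

theorem Rad.upper1 (h : Rad P X) (s : Finset κ) (a : κ → ℂ) (q : ℝ) (hq : 0 ≤ q)
    (ha : ∑ i ∈ s, ‖a i‖ ^ 2 ≤ 1) :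
    ∫ ω, ‖∑ i ∈ s, a i * (X i ω : ℂ)‖ ^ q ∂P ≤ Kh q := by
  have hprob := h.prob
  set c : ℝ := 1 + (⌈q⌉₊).factorial with hc
  have hc0 : 0 ≤ c := by positivity
  let F : (κ → ℝ) → Ω → ℝ := fun b ω => Real.exp (∑ i ∈ s, b i * X i ω)
  have hF : ∀ b : κ → ℝ, (∀ i, b i ^ 2 ≤ 4 * ‖a i‖ ^ 2) → ∫ ω, F b ω ∂P ≤ Real.exp 2 := by
    intro b hb
    refine (h.exp s b).trans (Real.exp_le_exp.2 ?_)
    have : ∑ i ∈ s, b i ^ 2 ≤ ∑ i ∈ s, 4 * ‖a i‖ ^ 2 := Finset.sum_le_sum fun i _ => hb i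
    rw [← Finset.mul_sum] at this
    linarith
  have hre : ∀ i, (a i).re ^ 2 ≤ ‖a i‖ ^ 2 := fun i => by
    rw [← sq_abs]; gcongr; exact Complex.abs_re_le_norm _
  have him : ∀ i, (a i).im ^ 2 ≤ ‖a i‖ ^ 2 := fun i => by
    rw [← sq_abs]; gcongr; exact Complex.abs_im_le_norm _
  have i1 := hF (fun i => 2 * (a i).re) (fun i => by nlinarith [hre i])
  have i2 := hF (fun i => -2 * (a i).re) (fun i => by nlinarith [hre i])
  have i3 := hF (fun i => 2 * (a i).im) (fun i => by nlinarith [him i])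
  have i4 := hF (fun i => -2 * (a i).im) (fun i => by nlinarith [him i])
  have j1 := h.exp_int s (fun i => 2 * (a i).re)
  have j2 := h.exp_int s (fun i => -2 * (a i).re)
  have j3 := h.exp_int s (fun i => 2 * (a i).im)
  have j4 := h.exp_int s (fun i => -2 * (a i).im)
  have hpt : ∀ ω, ‖∑ i ∈ s, a i * (X i ω : ℂ)‖ ^ q ≤ c / 2 * (F (fun i => 2 * (a i).re) ω
      + F (fun i => -2 * (a i).re) ω + (F (fun i => 2 * (a i).im) ω + F (fun i => -2 * (a i).im) ω)) := by
    intro ω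
    set S := ∑ i ∈ s, a i * (X i ω : ℂ) with hS
    have hSre : S.re = ∑ i ∈ s, (a i).re * X i ω := by
      rw [hS, Complex.re_sum]; refine Finset.sum_congr rfl fun i _ => by simp
    have hSim : S.im = ∑ i ∈ s, (a i).im * X i ω := by
      rw [hS, Complex.im_sum]; refine Finset.sum_congr rfl fun i _ => by simp
    have f1 : F (fun i => 2 * (a i).re) ω = Real.exp (2 * S.re) := by
      simp only [F, hSre, Finset.mul_sum, mul_assoc]
    have f2 : F (fun i => -2 * (a i).re) ω = Real.exp (-2 * S.re) := by
      simp only [F, hSre, Finset.mul_sum, mul_assoc]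
    have f3 : F (fun i => 2 * (a i).im) ω = Real.exp (2 * S.im) := by
      simp only [F, hSim, Finset.mul_sum, mul_assoc]
    have f4 : F (fun i => -2 * (a i).im) ω = Real.exp (-2 * S.im) := by
      simp only [F, hSim, Finset.mul_sum, mul_assoc]
    rw [f1, f2, f3, f4]
    have g1 : ‖S‖ ^ q ≤ c * Real.exp ‖S‖ := rpow_le_exp q hq _ (norm_nonneg _)
    have g2 : Real.exp ‖S‖ ≤ Real.exp |S.re| * Real.exp |S.im| := by
      rw [← Real.exp_add]; exact Real.exp_le_exp.2 (Complex.norm_le_abs_re_add_abs_im S)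
    have ge : ∀ x : ℝ, Real.exp |x| ^ 2 ≤ Real.exp (2 * x) + Real.exp (-2 * x) := by
      intro x
      rw [← Real.exp_nat_mul]
      have p1 := Real.exp_pos (2 * x)
      have p2 := Real.exp_pos (-2 * x)
      rcases abs_cases x with ⟨hx, _⟩ | ⟨hx, _⟩
      · rw [hx]; push_cast; linarith
      · rw [hx]; push_cast
        have : (2:ℝ) * -x = -2 * x := by ring
        rw [this]; linarith
    have g3 := ge S.re
    have g4 := ge S.im
    have g5 : Real.exp ‖S‖ ≤ (Real.exp (2 * S.re) + Real.exp (-2 * S.re) + (Real.exp (2 * S.im) + Real.exp (-2 * S.im))) / 2 := by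
      nlinarith [sq_nonneg (Real.exp |S.re| - Real.exp |S.im|)]
    calc _ ≤ _ := g1
      _ ≤ c * _ := mul_le_mul_of_nonneg_left g5 hc0
      _ = _ := by ring
  have hIntg := integral_mono (h.sum_int s a q hq) (((j1.add j2).add (j3.add j4)).const_mul (c/2)) hpt
  refine hIntg.trans ?_
  rw [integral_const_mul, integral_add' (j1.add j2) (j3.add j4), integral_add' j1 j2, integral_add' j3 j4]
  have : Kh q = c / 2 * (4 * Real.exp 2) := by unfold Kh; rw [hc]; ring
  rw [this]
  apply mul_le_mul_of_nonneg_left _ (by positivity)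
  simp only [F] at i1 i2 i3 i4
  linarith

theorem Rad.upper (h : Rad P X) (s : Finset κ) (a : κ → ℂ) (q : ℝ) (hq : 0 < q) :
    ∫ ω, ‖∑ i ∈ s, a i * (X i ω : ℂ)‖ ^ q ∂P ≤ Kh q * (√(∑ i ∈ s, ‖a i‖ ^ 2)) ^ q := by
  set t := √(∑ i ∈ s, ‖a i‖ ^ 2) with ht
  have hs0 : 0 ≤ ∑ i ∈ s, ‖a i‖ ^ 2 := by positivity
  rcases (Real.sqrt_nonneg (∑ i ∈ s, ‖a i‖ ^ 2)).eq_or_lt with h0 | h0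
  · have hz : ∑ i ∈ s, ‖a i‖ ^ 2 = 0 := (Real.sqrt_eq_zero hs0).1 h0.symm
    have hz' : ∀ i ∈ s, a i = 0 := by
      intro i hi
      have := (Finset.sum_eq_zero_iff_of_nonneg (fun i _ => by positivity)).1 hz i hi
      simpa using this
    have : ∀ ω, ‖∑ i ∈ s, a i * (X i ω : ℂ)‖ ^ q = 0 := by
      intro ω
      rw [Finset.sum_eq_zero fun i hi => by rw [hz' i hi, zero_mul], norm_zero, Real.zero_rpow hq.ne']
    simp only [this, integral_zero]
    have := Kh_pos q
    positivity
  · rw [← ht] at h0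
    have h1 := h.upper1 s (fun i => (t:ℂ)⁻¹ * a i) q hq.le (by
      have : ∀ i, ‖(t:ℂ)⁻¹ * a i‖ ^ 2 = (t ^ 2)⁻¹ * ‖a i‖ ^ 2 := by
        intro i
        rw [norm_mul, norm_inv, Complex.norm_real, Real.norm_of_nonneg h0.le, mul_pow, inv_pow]
      simp only [this]
      rw [← Finset.mul_sum, ht, Real.sq_sqrt hs0]
      exact inv_mul_le_one)
    have h2 : ∀ ω, ‖∑ i ∈ s, a i * (X i ω : ℂ)‖ ^ q = t ^ q * ‖∑ i ∈ s, ((t:ℂ)⁻¹ * a i) * (X i ω : ℂ)‖ ^ q := by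
      intro ω
      rw [← Real.mul_rpow h0.le (norm_nonneg _)]
      congr 1
      have e1 : ∑ i ∈ s, ((t:ℂ)⁻¹ * a i) * (X i ω : ℂ) = (t:ℂ)⁻¹ * ∑ i ∈ s, a i * (X i ω : ℂ) := by
        rw [Finset.mul_sum]; refine Finset.sum_congr rfl fun i _ => by ring
      rw [e1, norm_mul, norm_inv, Complex.norm_real, Real.norm_of_nonneg h0.le, ← mul_assoc,
        mul_inv_cancel₀ h0.ne', one_mul]
    simp only [h2]
    rw [integral_const_mul, mul_comm]
    gcongr

end PB

namespace PB

section
variable {κ Ω : Type} [MeasurableSpace Ω] {P : Measure Ω} {X : κ → Ω → ℝ}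

theorem Rad.mul_int (h : Rad P X) (i j : κ) : Integrable (fun ω => X i ω * X j ω) P := by
  have := h.prob
  refine Integrable.of_bound (C := 1) ((h.meas i).mul (h.meas j)).aestronglyMeasurable
    (ae_of_all _ fun ω => ?_)
  rw [Real.norm_eq_abs, abs_mul, h.abs, h.abs, mul_one]

theorem Rad.mul_integral [DecidableEq κ] (h : Rad P X) (i j : κ) :
    ∫ ω, X i ω * X j ω ∂P = if i = j then 1 else 0 := by
  have := h.prob
  split_ifs with hij
  · subst hij
    have : ∀ ω, X i ω * X i ω = 1 := fun ω => by
      rw [← abs_mul_abs_self, h.abs, mul_one]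
    simp [this]
  · exact h.orth i j hij

theorem Rad.second_real (h : Rad P X) (s : Finset κ) (b : κ → ℝ) :
    ∫ ω, (∑ i ∈ s, b i * X i ω) ^ 2 ∂P = ∑ i ∈ s, b i ^ 2 := by
  classical
  have e : ∀ ω, (∑ i ∈ s, b i * X i ω) ^ 2 = ∑ i ∈ s, ∑ j ∈ s, (b i * b j) * (X i ω * X j ω) := by
    intro ω
    rw [sq, Finset.sum_mul_sum]
    refine Finset.sum_congr rfl fun i _ => Finset.sum_congr rfl fun j _ => by ring
  simp only [e]
  rw [integral_finsetSum _ fun i _ => integrable_finsetSum _ fun j _ => (h.mul_int i j).const_mul _]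
  refine Finset.sum_congr rfl fun i hi => ?_
  rw [integral_finsetSum _ fun j _ => (h.mul_int i j).const_mul _]
  simp only [integral_const_mul, h.mul_integral]
  simp [hi, sq]

theorem Rad.second_real_int (h : Rad P X) (s : Finset κ) (b : κ → ℝ) :
    Integrable (fun ω => (∑ i ∈ s, b i * X i ω) ^ 2) P := by
  have e : ∀ ω, (∑ i ∈ s, b i * X i ω) ^ 2 = ∑ i ∈ s, ∑ j ∈ s, (b i * b j) * (X i ω * X j ω) := by
    intro ω
    rw [sq, Finset.sum_mul_sum]
    refine Finset.sum_congr rfl fun i _ => Finset.sum_congr rfl fun j _ => by ring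
  simp only [e]
  exact integrable_finsetSum _ fun i _ => integrable_finsetSum _ fun j _ => (h.mul_int i j).const_mul _

theorem Rad.sq_eq (s : Finset κ) (a : κ → ℂ) (ω : Ω) : ‖∑ i ∈ s, a i * (X i ω : ℂ)‖ ^ 2 =
    (∑ i ∈ s, (a i).re * X i ω) ^ 2 + (∑ i ∈ s, (a i).im * X i ω) ^ 2 := by
  rw [← Complex.normSq_eq_norm_sq, Complex.normSq_apply, Complex.re_sum, Complex.im_sum]
  simp [sq]

theorem Rad.second (h : Rad P X) (s : Finset κ) (a : κ → ℂ) :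
    ∫ ω, ‖∑ i ∈ s, a i * (X i ω : ℂ)‖ ^ 2 ∂P = ∑ i ∈ s, ‖a i‖ ^ 2 := by
  simp only [Rad.sq_eq]
  rw [integral_add (h.second_real_int s _) (h.second_real_int s _), h.second_real, h.second_real,
    ← Finset.sum_add_distrib]
  refine Finset.sum_congr rfl fun i _ => ?_
  rw [← Complex.normSq_eq_norm_sq, Complex.normSq_apply]; ring

theorem Rad.second_int (h : Rad P X) (s : Finset κ) (a : κ → ℂ) :
    Integrable (fun ω => ‖∑ i ∈ s, a i * (X i ω : ℂ)‖ ^ 2) P := by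
  simp only [Rad.sq_eq]
  exact (h.second_real_int s _).add (h.second_real_int s _)

/-- lower Khintchine constant -/
noncomputable def Kl (p : ℝ) : ℝ := 8 * Kh 4 * 2 ^ p

theorem Kl_pos (p : ℝ) : 0 < Kl p := by
  have := Kh_pos 4
  unfold Kl; positivity

theorem Rad.lower1 (h : Rad P X) (s : Finset κ) (a : κ → ℂ) (p : ℝ) (hp : 0 < p)
    (ha : ∑ i ∈ s, ‖a i‖ ^ 2 = 1) :
    1 ≤ Kl p * ∫ ω, ‖∑ i ∈ s, a i * (X i ω : ℂ)‖ ^ p ∂P := by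
  have hprob := h.prob
  have hK := Kh_pos 4
  have hpt : ∀ t : ℝ, 0 ≤ t → t ^ 2 ≤ 1 / 4 + (2 * Kh 4 * 2 ^ p) * t ^ p + (2 * Kh 4)⁻¹ * t ^ (4:ℝ) := by
    intro t ht
    have p1 : 0 ≤ (2 * Kh 4 * 2 ^ p) * t ^ p := by positivity
    have p2 : 0 ≤ (2 * Kh 4)⁻¹ * t ^ (4:ℝ) := by positivity
    rcases le_total t (1/2) with h1 | h1
    · nlinarith
    · rcases le_total (t ^ 2) (2 * Kh 4) with h2 | h2
      · have h3 : 1 ≤ 2 ^ p * t ^ p := by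
          rw [← Real.mul_rpow (by norm_num) ht]
          exact Real.one_le_rpow (by linarith) hp.le
        nlinarith
      · have h4 : t ^ (4:ℝ) = t ^ 2 * t ^ 2 := by
          rw [show (4:ℝ) = ((4:ℕ):ℝ) by norm_num, Real.rpow_natCast]; ring
        have h5 : t ^ 2 ≤ (2 * Kh 4)⁻¹ * t ^ (4:ℝ) := by
          rw [h4, ← div_eq_inv_mul, le_div_iff₀ (by positivity)]
          nlinarith [sq_nonneg t]
        linarith
  have hi1 := h.sum_int s a p hp.le
  have hi2 := h.sum_int s a 4 (by norm_num)
  have hIntg := integral_mono (h.second_int s a)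
    (((integrable_const (1/4:ℝ)).add (hi1.const_mul (2 * Kh 4 * 2 ^ p))).add (hi2.const_mul ((2 * Kh 4)⁻¹)))
    (fun ω => hpt _ (norm_nonneg (∑ i ∈ s, a i * (X i ω : ℂ))))
  rw [h.second, ha, integral_add' ((integrable_const (1/4:ℝ)).add (hi1.const_mul (2 * Kh 4 * 2 ^ p))) (hi2.const_mul ((2 * Kh 4)⁻¹)),
    integral_add' (integrable_const (1/4:ℝ)) (hi1.const_mul (2 * Kh 4 * 2 ^ p)),
    integral_const_mul, integral_const_mul, integral_const] at hIntg
  have hu := h.upper1 s a 4 (by norm_num) ha.le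
  have hu2 : (2 * Kh 4)⁻¹ * ∫ ω, ‖∑ i ∈ s, a i * (X i ω : ℂ)‖ ^ (4:ℝ) ∂P ≤ 1 / 2 := by
    rw [← div_eq_inv_mul, div_le_iff₀ (by positivity)]; linarith
  simp at hIntg
  unfold Kl
  simp at hu2
  linarith

theorem Rad.lower (h : Rad P X) (s : Finset κ) (a : κ → ℂ) (p : ℝ) (hp : 0 < p) :
    (√(∑ i ∈ s, ‖a i‖ ^ 2)) ^ p ≤ Kl p * ∫ ω, ‖∑ i ∈ s, a i * (X i ω : ℂ)‖ ^ p ∂P := by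
  set t := √(∑ i ∈ s, ‖a i‖ ^ 2) with ht
  have hs0 : 0 ≤ ∑ i ∈ s, ‖a i‖ ^ 2 := by positivity
  have hK := Kl_pos p
  rcases (Real.sqrt_nonneg (∑ i ∈ s, ‖a i‖ ^ 2)).eq_or_lt with h0 | h0
  · rw [← ht] at h0
    rw [← h0, Real.zero_rpow hp.ne']
    have : 0 ≤ ∫ ω, ‖∑ i ∈ s, a i * (X i ω : ℂ)‖ ^ p ∂P := integral_nonneg fun ω => by positivity
    positivity
  · rw [← ht] at h0
    have h1 := h.lower1 s (fun i => (t:ℂ)⁻¹ * a i) p hp (by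
      have : ∀ i, ‖(t:ℂ)⁻¹ * a i‖ ^ 2 = (t ^ 2)⁻¹ * ‖a i‖ ^ 2 := by
        intro i
        rw [norm_mul, norm_inv, Complex.norm_real, Real.norm_of_nonneg h0.le, mul_pow, inv_pow]
      simp only [this]
      rw [← Finset.mul_sum, ← Real.sq_sqrt hs0, ← ht]
      exact inv_mul_cancel₀ (by positivity))
    have h2 : ∀ ω, ‖∑ i ∈ s, a i * (X i ω : ℂ)‖ ^ p = t ^ p * ‖∑ i ∈ s, ((t:ℂ)⁻¹ * a i) * (X i ω : ℂ)‖ ^ p := by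
      intro ω
      rw [← Real.mul_rpow h0.le (norm_nonneg _)]
      congr 1
      have e1 : ∑ i ∈ s, ((t:ℂ)⁻¹ * a i) * (X i ω : ℂ) = (t:ℂ)⁻¹ * ∑ i ∈ s, a i * (X i ω : ℂ) := by
        rw [Finset.mul_sum]; refine Finset.sum_congr rfl fun i _ => by ring
      rw [e1, norm_mul, norm_inv, Complex.norm_real, Real.norm_of_nonneg h0.le, ← mul_assoc,
        mul_inv_cancel₀ h0.ne', one_mul]
    simp only [h2]
    rw [integral_const_mul]
    have h3 : 0 ≤ t ^ p := by positivity
    nlinarith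

end

/-! ### norms in `Lp` -/

theorem Lp_int {Ω : Type} [MeasurableSpace Ω] (μ : Measure Ω) (p : ℝ) (hp : 1 < p)
    (f : Lp ℂ (ENNReal.ofReal p) μ) : Integrable (fun x => ‖f x‖ ^ p) μ := by
  have h := (Lp.memLp f).integrable_norm_rpow (by simp; linarith) ENNReal.ofReal_ne_top
  rwa [ENNReal.toReal_ofReal (by linarith)] at h

theorem Lp_norm {Ω : Type} [MeasurableSpace Ω] (μ : Measure Ω) (p : ℝ) (hp : 1 < p)
    (f : Lp ℂ (ENNReal.ofReal p) μ) : ‖f‖ ^ p = ∫ x, ‖f x‖ ^ p ∂μ := by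
  have h := (Lp.memLp f).eLpNorm_eq_integral_rpow_norm (by simp; linarith) ENNReal.ofReal_ne_top
  rw [ENNReal.toReal_ofReal (by linarith)] at h
  have h0 : 0 ≤ ∫ x, ‖f x‖ ^ p ∂μ := integral_nonneg fun x => by positivity
  rw [Lp.norm_def, h, ENNReal.toReal_ofReal (by positivity), ← Real.rpow_mul h0,
    inv_mul_cancel₀ (by linarith), Real.rpow_one]

theorem Lp_norm_of_ae {Ω : Type} [MeasurableSpace Ω] (μ : Measure Ω) (p : ℝ) (hp : 1 < p)
    (f : Lp ℂ (ENNReal.ofReal p) μ) (g : Ω → ℂ) (hg : f =ᵐ[μ] g) : ‖f‖ ^ p = ∫ x, ‖g x‖ ^ p ∂μ := by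
  rw [Lp_norm μ p hp]
  refine integral_congr_ae ?_
  filter_upwards [hg] with x hx
  rw [hx]

end PB

namespace PB

theorem Lp_sum_ae {Ω ι : Type} [MeasurableSpace Ω] {μ : Measure Ω} {q : ℝ≥0∞} (s : Finset ι)
    (a : ι → ℂ) (f : ι → Lp ℂ q μ) :
    ⇑(∑ i ∈ s, a i • f i) =ᵐ[μ] fun x => ∑ i ∈ s, a i * f i x := by
  classical
  induction s using Finset.induction_on with
  | empty =>
    simp only [Finset.sum_empty]
    exact Lp.coeFn_zero _ _ _
  | insert i s hi ih =>
    rw [Finset.sum_insert hi]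
    filter_upwards [Lp.coeFn_add (a i • f i) (∑ j ∈ s, a j • f j), Lp.coeFn_smul (a i) (f i), ih]
      with x h1 h2 h3
    rw [h1, Pi.add_apply, h2, h3, Finset.sum_insert hi, Pi.smul_apply, smul_eq_mul]

section
variable {κ : Type} {X : κ → I → ℝ}

theorem Rad.memLp (h : Rad (volume : Measure I) X) (q : ℝ≥0∞) (s : Finset κ) (a : κ → ℂ) :
    MemLp (fun ω => ∑ i ∈ s, a i * (X i ω : ℂ)) q (volume : Measure I) :=
  MemLp.of_bound (h.sum_meas s a).aestronglyMeasurable (∑ i ∈ s, ‖a i‖)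
    (ae_of_all _ fun ω => h.sum_norm_le s a ω)

theorem Rad.memLp1 (h : Rad (volume : Measure I) X) (q : ℝ≥0∞) (i : κ) :
    MemLp (fun ω => (X i ω : ℂ)) q (volume : Measure I) :=
  MemLp.of_bound (Complex.measurable_ofReal.comp (h.meas i)).aestronglyMeasurable 1
    (ae_of_all _ fun ω => by rw [Complex.norm_real, Real.norm_eq_abs, h.abs])

/-- the Rademacher function as an element of `Lp` -/
noncomputable def xl (h : Rad (volume : Measure I) X) (q : ℝ≥0∞) (i : κ) :
    Lp ℂ q (volume : Measure I) := (h.memLp1 q i).toLp _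

theorem xl_sum_ae (h : Rad (volume : Measure I) X) (q : ℝ≥0∞) (s : Finset κ) (a : κ → ℂ) :
    ⇑(∑ i ∈ s, a i • xl h q i) =ᵐ[volume] fun ω => ∑ i ∈ s, a i * (X i ω : ℂ) := by
  have h1 := Lp_sum_ae s a (xl h q)
  have h2 : ∀ᵐ ω ∂(volume : Measure I), ∀ i ∈ s, xl h q i ω = (X i ω : ℂ) := by
    rw [Filter.eventually_all_finset]
    intro i _
    exact (h.memLp1 q i).coeFn_toLp
  filter_upwards [h1, h2] with ω e1 e2
  rw [e1]
  exact Finset.sum_congr rfl fun i hi => by rw [e2 i hi]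

theorem xl_norm (h : Rad (volume : Measure I) X) (p : ℝ) (hp : 1 < p) [Fact (1 ≤ ENNReal.ofReal p)] (s : Finset κ) (a : κ → ℂ) :
    ‖∑ i ∈ s, a i • xl h (ENNReal.ofReal p) i‖ ≤ Kh p ^ (1 / p) * √(∑ i ∈ s, ‖a i‖ ^ 2) := by
  have hp0 : 0 < p := by linarith
  have hK := Kh_pos p
  have h1 := Lp_norm_of_ae _ p hp _ _ (xl_sum_ae h (ENNReal.ofReal p) s a)
  have h2 := h.upper s a p hp0
  rw [← h1] at h2
  have h3 : (Kh p ^ (1 / p) * √(∑ i ∈ s, ‖a i‖ ^ 2)) ^ p = Kh p * √(∑ i ∈ s, ‖a i‖ ^ 2) ^ p := by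
    rw [Real.mul_rpow (by positivity) (by positivity), ← Real.rpow_mul hK.le,
      one_div_mul_cancel hp0.ne', Real.rpow_one]
  rw [← h3] at h2
  exact (Real.rpow_le_rpow_iff (norm_nonneg _) (by positivity) hp0).1 h2

/-- the model Hilbert space -/
noncomputable abbrev Lk (κ : Type) := lp (fun _ : κ => ℂ) 2

theorem Lk_norm_sq (v : Lk κ) : ‖v‖ ^ 2 = ∑' n, ‖v n‖ ^ 2 := by
  have := lp.norm_rpow_eq_tsum (p := 2) (by norm_num) v
  simpa using this

theorem Lk_summable (v : Lk κ) : Summable fun n => ‖v n‖ ^ 2 := by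
  have := (memℓp_gen_iff (p := 2) (by norm_num)).1 (lp.memℓp v)
  simpa using this

theorem A_summable (h : Rad (volume : Measure I) X) (p : ℝ) (hp : 1 < p) [Fact (1 ≤ ENNReal.ofReal p)] (v : Lk κ) :
    Summable fun i => v i • xl h (ENNReal.ofReal p) i := by
  have hK := Kh_pos p
  set Ca := Kh p ^ (1 / p) with hCa
  have hCa0 : 0 < Ca := by positivity
  rw [summable_iff_vanishing_norm]
  intro ε hε
  obtain ⟨s, hs⟩ := summable_iff_vanishing_norm.1 (Lk_summable v) ((ε / Ca) ^ 2) (by positivity)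
  refine ⟨s, fun t ht => ?_⟩
  have h1 := xl_norm h p hp t v
  have h2 := hs t ht
  rw [Real.norm_of_nonneg (by positivity)] at h2
  have h3 : √(∑ i ∈ t, ‖v i‖ ^ 2) < ε / Ca := by
    rw [Real.sqrt_lt' (by positivity)]; exact h2
  calc _ ≤ _ := h1
    _ < Ca * (ε / Ca) := by gcongr
    _ = ε := by field_simp

/-- embedding -/
noncomputable def Aop (h : Rad (volume : Measure I) X) (p : ℝ) (hp : 1 < p) [Fact (1 ≤ ENNReal.ofReal p)] :
    Lk κ →L[ℂ] Lp ℂ (ENNReal.ofReal p) (volume : Measure I) :=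
  LinearMap.mkContinuous
    { toFun := fun v => ∑' i, v i • xl h (ENNReal.ofReal p) i
      map_add' := fun v w => by
        rw [← (A_summable h p hp v).tsum_add (A_summable h p hp w)]
        refine tsum_congr fun i => ?_
        rw [lp.coeFn_add, Pi.add_apply, add_smul]
      map_smul' := fun c v => by
        rw [RingHom.id_apply, ← (A_summable h p hp v).tsum_const_smul]
        refine tsum_congr fun i => ?_
        rw [lp.coeFn_smul, Pi.smul_apply, smul_assoc] } (Kh p ^ (1 / p)) (by
    intro v
    have hK := Kh_pos p
    refine le_of_tendsto (A_summable h p hp v).hasSum.norm (Filter.Eventually.of_forall fun s => ?_)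
    refine (xl_norm h p hp s v).trans ?_
    have : √(∑ i ∈ s, ‖v i‖ ^ 2) ≤ ‖v‖ := by
      refine Real.sqrt_le_iff.2 ⟨norm_nonneg _, ?_⟩
      rw [Lk_norm_sq]
      exact (Lk_summable v).sum_le_tsum s fun _ _ => by positivity
    gcongr)

theorem Aop_hasSum (h : Rad (volume : Measure I) X) (p : ℝ) (hp : 1 < p) [Fact (1 ≤ ENNReal.ofReal p)] (v : Lk κ) :
    HasSum (fun i => v i • xl h (ENNReal.ofReal p) i) (Aop h p hp v) :=
  (A_summable h p hp v).hasSum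

theorem mul_f_int (h : Rad (volume : Measure I) X) (q : ℝ≥0∞) (hq : 1 ≤ q) (i : κ)
    (f : Lp ℂ q (volume : Measure I)) :
    Integrable (fun ω => (X i ω : ℂ) * f ω) (volume : Measure I) := by
  have hf : Integrable f (volume : Measure I) := (Lp.memLp f).integrable hq
  refine hf.bdd_mul (c := 1) (Complex.measurable_ofReal.comp (h.meas i)).aestronglyMeasurable (ae_of_all _ fun ω => ?_)
  rw [Complex.norm_real, Real.norm_eq_abs, h.abs]

/-- coefficients -/
noncomputable def cf (X : κ → I → ℝ) {q : ℝ≥0∞} (f : Lp ℂ q (volume : Measure I)) (i : κ) : ℂ :=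
  ∫ ω, (X i ω : ℂ) * f ω

theorem cf_sum (h : Rad (volume : Measure I) X) (p : ℝ) (hp : 1 < p) [hF : Fact (1 ≤ ENNReal.ofReal p)] (f : Lp ℂ (ENNReal.ofReal p) (volume : Measure I))
    (s : Finset κ) :
    ∑ i ∈ s, ‖cf X f i‖ ^ 2 ≤ (Kh (p.conjExponent) ^ (1 / p.conjExponent) * ‖f‖) ^ 2 := by
  have hpq := Real.HolderConjugate.conjExponent hp
  set q := p.conjExponent with hq
  have hp0 : 0 < p := by linarith
  have hq0 : 0 < q := hpq.symm.pos
  have hK := Kh_pos q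
  set Cq := Kh q ^ (1 / q) with hCq
  set t := √(∑ i ∈ s, ‖cf X f i‖ ^ 2) with ht
  have hs0 : 0 ≤ ∑ i ∈ s, ‖cf X f i‖ ^ 2 := by positivity
  have ht2 : t ^ 2 = ∑ i ∈ s, ‖cf X f i‖ ^ 2 := Real.sq_sqrt hs0
  let a : κ → ℂ := fun i => starRingEnd ℂ (cf X f i)
  have e1 : ∫ ω, (∑ i ∈ s, a i * (X i ω : ℂ)) * f ω = ((∑ i ∈ s, ‖cf X f i‖ ^ 2 : ℝ) : ℂ) := by
    have : ∀ ω, (∑ i ∈ s, a i * (X i ω : ℂ)) * f ω = ∑ i ∈ s, a i * ((X i ω : ℂ) * f ω) := by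
      intro ω
      rw [Finset.sum_mul]
      exact Finset.sum_congr rfl fun i _ => by ring
    simp only [this]
    rw [integral_finsetSum _ fun i _ => (mul_f_int h _ hF.out i f).const_mul _]
    push_cast
    refine Finset.sum_congr rfl fun i _ => ?_
    rw [integral_const_mul]
    exact Complex.conj_mul' _
  have e2 : t ^ 2 ≤ ∫ ω, ‖∑ i ∈ s, a i * (X i ω : ℂ)‖ * ‖f ω‖ := by
    have := norm_integral_le_integral_norm (μ := (volume : Measure I)) (fun ω => (∑ i ∈ s, a i * (X i ω : ℂ)) * f ω)
    rw [e1, Complex.norm_real, Real.norm_of_nonneg hs0, ← ht2] at this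
    simpa only [norm_mul] using this
  have e3 := integral_mul_norm_le_Lp_mul_Lq hpq.symm (h.memLp (ENNReal.ofReal q) s a) (Lp.memLp f)
  have e4 : (∫ ω, ‖f ω‖ ^ p) ^ (1 / p) = ‖f‖ := by
    rw [← Lp_norm _ p hp f, ← Real.rpow_mul (norm_nonneg _), mul_one_div_cancel hp0.ne', Real.rpow_one]
  have e5 : (∫ ω, ‖∑ i ∈ s, a i * (X i ω : ℂ)‖ ^ q) ^ (1 / q) ≤ Cq * t := by
    have := h.upper s a q hq0
    have e6 : ∀ i, ‖a i‖ = ‖cf X f i‖ := fun i => RCLike.norm_conj _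
    simp only [e6] at this
    rw [← ht] at this
    have h7 : (Kh q * t ^ q) ^ (1 / q) = Cq * t := by
      rw [Real.mul_rpow hK.le (by positivity), ← Real.rpow_mul (by positivity), mul_one_div_cancel hq0.ne',
        Real.rpow_one]
    rw [← h7]
    refine Real.rpow_le_rpow (integral_nonneg fun ω => by positivity) this (by positivity)
  rw [e4] at e3
  have e8 : t ^ 2 ≤ Cq * t * ‖f‖ := (e2.trans e3).trans (by gcongr)
  have ht0 : 0 ≤ t := Real.sqrt_nonneg _
  have hCq0 : 0 ≤ Cq := by positivity
  rw [← ht2]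
  have e9 : t ≤ Cq * ‖f‖ := by
    rcases ht0.eq_or_lt with h0 | h0
    · rw [← h0]; positivity
    · nlinarith
  gcongr

/-- coefficient map -/
noncomputable def Bop (h : Rad (volume : Measure I) X) (p : ℝ) (hp : 1 < p) [hF : Fact (1 ≤ ENNReal.ofReal p)] :
    Lp ℂ (ENNReal.ofReal p) (volume : Measure I) →L[ℂ] Lk κ :=
  LinearMap.mkContinuous
    { toFun := fun f => ⟨cf X f, memℓp_gen' (C := (Kh (p.conjExponent) ^ (1 / p.conjExponent) * ‖f‖) ^ 2) (by
        intro s; simpa using cf_sum h p hp f s)⟩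
      map_add' := fun f g => by
        ext1; funext i
        show cf X (f + g) i = cf X f i + cf X g i
        unfold cf
        rw [← integral_add (mul_f_int h _ hF.out i f) (mul_f_int h _ hF.out i g)]
        refine integral_congr_ae ?_
        filter_upwards [Lp.coeFn_add f g] with ω hω
        rw [hω, Pi.add_apply, mul_add]
      map_smul' := fun c f => by
        ext1; funext i
        show cf X (c • f) i = c * cf X f i
        unfold cf
        rw [← integral_const_mul]
        refine integral_congr_ae ?_
        filter_upwards [Lp.coeFn_smul c f] with ω hω
        rw [hω, Pi.smul_apply, smul_eq_mul]; ring } (Kh (p.conjExponent) ^ (1 / p.conjExponent)) (by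
    intro f
    have hK := Kh_pos p.conjExponent
    refine lp.norm_le_of_forall_sum_le (by norm_num) (by positivity) fun s => ?_
    simpa using cf_sum h p hp f s)

theorem Bop_apply (h : Rad (volume : Measure I) X) (p : ℝ) (hp : 1 < p) [hF : Fact (1 ≤ ENNReal.ofReal p)] (f : Lp ℂ (ENNReal.ofReal p) (volume : Measure I)) (i : κ) :
    Bop h p hp f i = cf X f i := rfl

theorem cf_xl (h : Rad (volume : Measure I) X) [DecidableEq κ] (q : ℝ≥0∞) (i j : κ) : cf X (xl h q j) i = if i = j then 1 else 0 := by
  unfold cf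
  have h1 : ∫ ω, (X i ω : ℂ) * xl h q j ω = ∫ ω, ((X i ω * X j ω : ℝ) : ℂ) := by
    refine integral_congr_ae ?_
    filter_upwards [(h.memLp1 q j).coeFn_toLp] with ω hω
    push_cast
    show (X i ω : ℂ) * ((h.memLp1 q j).toLp _) ω = _
    rw [hω]
  rw [h1, integral_complex_ofReal, h.mul_integral]
  split_ifs <;> simp

theorem Bop_Aop (h : Rad (volume : Measure I) X) (p : ℝ) (hp : 1 < p) [hF : Fact (1 ≤ ENNReal.ofReal p)] (v : Lk κ) : Bop h p hp (Aop h p hp v) = v := by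
  classical
  ext1; funext i
  have h1 := ((Aop_hasSum h p hp v).mapL (Bop h p hp)).mapL (lp.evalCLM ℂ (fun _ : κ => ℂ) 2 i)
  have h2 : HasSum (fun j => if j = i then v i else 0) (v i) := hasSum_ite_eq i _
  refine h1.unique ?_
  refine (congrArg (fun f => HasSum f (v i)) (funext fun j => ?_)).mpr h2
  rw [map_smul, map_smul]
  show v j • cf X (xl h _ j) i = _
  rw [cf_xl h]
  by_cases hij : i = j
  · subst hij; simp
  · simp [hij, Ne.symm hij]

end

end PB

namespace PB

noncomputable abbrev W0 := WithLp 2 (E0 × E0)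

abbrev K0 := (ℕ × Finset ℕ) ⊕ (ℕ × Finset ℕ)

/-- unit vector of E0 -/
noncomputable def f0 (k : ℕ × Finset ℕ) : E0 := lp.single 2 k.1 (e0 k.2)

theorem inner_f0 (k : ℕ × Finset ℕ) (v : E0) : inner ℂ (f0 k) v = v k.1 k.2 := by
  rw [f0, lp.inner_single_left, inner_e0]

theorem f0_apply (k l : ℕ × Finset ℕ) : f0 k l.1 l.2 = if k = l then 1 else 0 := by
  rw [f0, lp.single_apply]
  obtain ⟨k1, k2⟩ := k
  obtain ⟨l1, l2⟩ := l
  by_cases h : k1 = l1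
  · subst h
    simp [e0_apply, eq_comm]
  · simp [Pi.single_apply, h, Ne.symm h]

/-- basis vectors -/
noncomputable def b0 : K0 → W0
  | Sum.inl k => WithLp.toLp 2 (f0 k, 0)
  | Sum.inr k => WithLp.toLp 2 (0, f0 k)

theorem inner_b0_inl (k : ℕ × Finset ℕ) (x : W0) : inner ℂ (b0 (Sum.inl k)) x = x.ofLp.1 k.1 k.2 := by
  rw [WithLp.prod_inner_apply]
  show inner ℂ (f0 k) x.ofLp.1 + inner ℂ (0 : E0) x.ofLp.2 = _
  rw [inner_zero_left, add_zero, inner_f0]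

theorem inner_b0_inr (k : ℕ × Finset ℕ) (x : W0) : inner ℂ (b0 (Sum.inr k)) x = x.ofLp.2 k.1 k.2 := by
  rw [WithLp.prod_inner_apply]
  show inner ℂ (0 : E0) x.ofLp.1 + inner ℂ (f0 k) x.ofLp.2 = _
  rw [inner_zero_left, zero_add, inner_f0]

theorem b0_orthonormal : Orthonormal ℂ b0 := by
  rw [orthonormal_iff_ite]
  rintro (i | i) (j | j)
  · rw [inner_b0_inl]
    show f0 j i.1 i.2 = _
    rw [f0_apply]; simp [eq_comm]
  · rw [inner_b0_inl]
    show (0 : E0) i.1 i.2 = _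
    simp
  · rw [inner_b0_inr]
    show (0 : E0) i.1 i.2 = _
    simp
  · rw [inner_b0_inr]
    show f0 j i.1 i.2 = _
    rw [f0_apply]; simp [eq_comm]

theorem b0_total : (Submodule.span ℂ (Set.range b0)).orthogonal = ⊥ := by
  rw [Submodule.eq_bot_iff]
  intro x hx
  have h : ∀ k, inner ℂ (b0 k) x = 0 := fun k =>
    hx (b0 k) (Submodule.subset_span ⟨k, rfl⟩)
  have h1 : x.ofLp.1 = 0 := by
    ext1; funext n; ext1; funext s
    have := h (Sum.inl (n, s))
    rw [inner_b0_inl] at this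
    exact this
  have h2 : x.ofLp.2 = 0 := by
    ext1; funext n; ext1; funext s
    have := h (Sum.inr (n, s))
    rw [inner_b0_inr] at this
    exact this
  have : x.ofLp = 0 := Prod.ext h1 h2
  exact (WithLp.ofLp_eq_zero 2).1 this

/-- Hilbert basis -/
noncomputable def hb0 : HilbertBasis K0 ℂ W0 := HilbertBasis.mkOfOrthogonalEqBot b0_orthonormal b0_total

theorem exists_embed (p : ℝ) (hp : 1 < p) [Fact (1 ≤ ENNReal.ofReal p)] :
    ∃ (A : E0 × E0 →L[ℂ] Lp ℂ (ENNReal.ofReal p) (volume : Measure I))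
      (B : Lp ℂ (ENNReal.ofReal p) (volume : Measure I) →L[ℂ] E0 × E0), ∀ x, B (A x) = x := by
  obtain ⟨X, h⟩ := exists_rad K0
  let e1 : W0 ≃L[ℂ] (E0 × E0) := WithLp.prodContinuousLinearEquiv 2 ℂ E0 E0
  let e2 : W0 ≃L[ℂ] Lk K0 := hb0.repr.toContinuousLinearEquiv
  let e : (E0 × E0) ≃L[ℂ] Lk K0 := e1.symm.trans e2
  refine ⟨(Aop h p hp).comp (e : (E0 × E0) →L[ℂ] Lk K0), (e.symm : Lk K0 →L[ℂ] (E0 × E0)).comp (Bop h p hp), fun x => ?_⟩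
  show e.symm (Bop h p hp (Aop h p hp (e x))) = x
  rw [Bop_Aop, ContinuousLinearEquiv.symm_apply_apply]

section
variable {V G : Type} [NormedAddCommGroup V] [NormedSpace ℂ V] [NormedAddCommGroup G] [NormedSpace ℂ G]

theorem conj_pow (A : G →L[ℂ] V) (B : V →L[ℂ] G) (hBA : ∀ x, B (A x) = x) (T : G →L[ℂ] G) (n : ℕ) (x : G) :
    ((A.comp (T.comp B)) ^ n) (A x) = A ((T ^ n) x) := by
  induction n with
  | zero => simp
  | succ n ih =>
    rw [pow_succ', ContinuousLinearMap.mul_apply, ih, pow_succ', ContinuousLinearMap.mul_apply]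
    simp [hBA]

theorem conj_aeval (A : G →L[ℂ] V) (B : V →L[ℂ] G) (hBA : ∀ x, B (A x) = x) (T : G →L[ℂ] G) (φ : ℂ[X]) :
    aeval (A.comp (T.comp B)) φ = A.comp ((aeval T φ).comp B) + φ.coeff 0 • (1 - A.comp B) := by
  induction φ using Polynomial.induction_on' with
  | add f g hf hg =>
    simp only [map_add, coeff_add, hf, hg, add_smul, ContinuousLinearMap.add_comp, ContinuousLinearMap.comp_add]
    abel
  | monomial n a =>
    simp only [aeval_monomial, Algebra.algebraMap_eq_smul_one, smul_mul_assoc, one_mul]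
    cases n with
    | zero =>
      ext x
      simp [smul_sub]
    | succ n =>
      have h0 : (monomial (n+1) a).coeff 0 = 0 := by rw [coeff_monomial]; simp
      rw [h0, zero_smul, add_zero]
      ext x
      have := conj_pow A B hBA T n (T (B x))
      rw [pow_succ, pow_succ]
      simp only [ContinuousLinearMap.smul_apply, ContinuousLinearMap.mul_apply, ContinuousLinearMap.comp_apply, map_smul]
      rw [this]
end

theorem polybdd (p : ℝ) (hp : 1 < p) [Fact (1 ≤ ENNReal.ofReal p)] 
    (A : E0 × E0 →L[ℂ] Lp ℂ (ENNReal.ofReal p) (volume : Measure I))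
    (B : Lp ℂ (ENNReal.ofReal p) (volume : Measure I) →L[ℂ] E0 × E0) (hBA : ∀ x, B (A x) = x) :
    ∃ C : ℝ, 1 ≤ C ∧ ∀ φ : ℂ[X],
      ‖aeval (A.comp (T0.comp B)) φ‖ ≤ C * ‖aeval (shiftOp (ENNReal.ofReal p)) φ‖ := by
  refine ⟨1 + (‖A‖ * (21 * ‖B‖) + ‖1 - A.comp B‖), ?_, fun φ => ?_⟩
  · have : 0 ≤ ‖A‖ * (21 * ‖B‖) + ‖1 - A.comp B‖ := by positivity
    linarith
  · set M := ‖aeval (shiftOp (ENNReal.ofReal p)) φ‖ with hM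
    have hM0 : 0 ≤ M := norm_nonneg _
    have hb : ∀ z : ℂ, ‖z‖ = 1 → ‖φ.eval z‖ ≤ M := fun z hz =>
      eval_le_shift (ENNReal.ofReal p) (by simp; linarith) ENNReal.ofReal_ne_top φ z hz
    have h1 := T0_aeval_norm φ M hb
    have h2 := coeff_le_sup φ M hb 0
    rw [conj_aeval A B hBA]
    calc _ ≤ ‖A.comp ((aeval T0 φ).comp B)‖ + ‖φ.coeff 0 • (1 - A.comp B)‖ := norm_add_le _ _
      _ ≤ ‖A‖ * (21 * M * ‖B‖) + M * ‖1 - A.comp B‖ := by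
          gcongr
          · refine (ContinuousLinearMap.opNorm_comp_le _ _).trans ?_
            gcongr
            refine (ContinuousLinearMap.opNorm_comp_le _ _).trans ?_
            gcongr
          · rw [norm_smul]; gcongr
      _ ≤ _ := by nlinarith

end PB

namespace PB

theorem ker1 (s a : ℝ) (hs : -1 < s) (ha : 0 ≤ a) :
    IntegrableOn (fun t : ℝ => if t < a then t ^ s else 0) (Set.Ioi 0) ∧
    ∫ t in Set.Ioi (0:ℝ), (if t < a then t ^ s else 0) = a ^ (s + 1) / (s + 1) := by
  have e : (fun t : ℝ => if t < a then t ^ s else 0) = (Set.Iio a).indicator (fun t => t ^ s) := by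
    funext t; simp [Set.indicator, Set.mem_Iio]
  have hset : Set.Iio a ∩ Set.Ioi 0 = Set.Ioo 0 a := by
    ext t; simp [and_comm]
  have hIntg : IntegrableOn (fun t : ℝ => t ^ s) (Set.Ioc 0 a) := by
    have := intervalIntegral.intervalIntegrable_rpow' (a := 0) (b := a) hs
    rwa [intervalIntegrable_iff_integrableOn_Ioc_of_le ha] at this
  refine ⟨?_, ?_⟩
  · rw [e, IntegrableOn, integrable_indicator_iff measurableSet_Iio, IntegrableOn,
      Measure.restrict_restrict measurableSet_Iio, hset]
    exact hIntg.mono_set Set.Ioo_subset_Ioc_self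
  · rw [e, integral_indicator measurableSet_Iio, Measure.restrict_restrict measurableSet_Iio, hset,
      ← integral_Ioc_eq_integral_Ioo, ← intervalIntegral.integral_of_le ha, integral_rpow (Or.inl hs),
      Real.zero_rpow (by linarith), sub_zero]

theorem ker2 (s a : ℝ) (hs : s < -1) (ha : 0 ≤ a) :
    IntegrableOn (fun t : ℝ => a ^ 2 * if a ≤ t then t ^ s else 0) (Set.Ioi 0) ∧
    ∫ t in Set.Ioi (0:ℝ), (a ^ 2 * if a ≤ t then t ^ s else 0) = a ^ 2 * (a ^ (s + 1) / (- (s + 1))) := by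
  rcases ha.eq_or_lt with rfl | ha
  · simp
  have e : (fun t : ℝ => if a ≤ t then t ^ s else 0) = (Set.Ici a).indicator (fun t => t ^ s) := by
    funext t; simp [Set.indicator, Set.mem_Ici]
  have hset : Set.Ici a ∩ Set.Ioi 0 = Set.Ici a := by
    ext t; simp only [Set.mem_inter_iff, Set.mem_Ici, Set.mem_Ioi, and_iff_left_iff_imp]; intro h; linarith
  have hIntg : IntegrableOn (fun t : ℝ => t ^ s) (Set.Ioi a) := integrableOn_Ioi_rpow_of_lt hs ha
  refine ⟨?_, ?_⟩
  · refine Integrable.const_mul ?_ _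
    rw [e, integrable_indicator_iff measurableSet_Ici, IntegrableOn,
      Measure.restrict_restrict measurableSet_Ici, hset]
    exact (integrableOn_Ici_iff_integrableOn_Ioi (by simp)).2 hIntg
  · rw [integral_const_mul, e, integral_indicator measurableSet_Ici, Measure.restrict_restrict measurableSet_Ici, hset,
      integral_Ici_eq_integral_Ioi, integral_Ioi_rpow_of_lt hs ha]
    congr 1
    rw [div_neg, neg_div]

section
variable {H : Type*} [NormedAddCommGroup H] [InnerProductSpace ℂ H] {C : ℕ → H →L[ℂ] H}

theorem shift_sum_le (S F : Finset ℤ) (f : ℤ → ℝ) (hf : ∀ k, 0 ≤ f k) (hS : ∀ k, k ∉ S → f k = 0) (d : ℤ) :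
    ∑ m ∈ F, f (m + d) ≤ ∑ k ∈ S, f k := by
  have h1 : ∑ m ∈ F, f (m + d) = ∑ k ∈ F.map (Equiv.addRight d).toEmbedding, f k := by
    rw [Finset.sum_map]; rfl
  rw [h1, ← Finset.sum_filter_add_sum_filter_not _ (· ∈ S)]
  rw [Finset.sum_eq_zero (s := Finset.filter (fun x => x ∉ S) _)
    (fun k hk => hS k (Finset.mem_filter.1 hk).2), add_zero]
  exact Finset.sum_le_sum_of_subset_of_nonneg (fun k hk => (Finset.mem_filter.1 hk).2) fun k _ _ => hf k

theorem conv1 (hC : Cliff C) (N : ℕ) (d : ℕ → ℤ) (x : ℤ → H) (S F : Finset ℤ) (hS : ∀ k, k ∉ S → x k = 0) :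
    ∑ m ∈ F, ‖∑ r ∈ Finset.range N, C r (x (m + d r))‖ ≤ N * ∑ k ∈ S, ‖x k‖ := by
  calc _ ≤ ∑ m ∈ F, ∑ r ∈ Finset.range N, ‖x (m + d r)‖ := by
        refine Finset.sum_le_sum fun m _ => (norm_sum_le _ _).trans_eq ?_
        exact Finset.sum_congr rfl fun r _ => hC.norm _ _
    _ = ∑ r ∈ Finset.range N, ∑ m ∈ F, ‖x (m + d r)‖ := Finset.sum_comm
    _ ≤ ∑ r ∈ Finset.range N, ∑ k ∈ S, ‖x k‖ :=
        Finset.sum_le_sum fun r _ => shift_sum_le S F (fun k => ‖x k‖) (fun _ => norm_nonneg _)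
          (fun k hk => by simp [hS k hk]) _
    _ = _ := by simp

theorem conv2 (hC : Cliff C) (N : ℕ) (d : ℕ → ℤ) (x : ℤ → H) (S F : Finset ℤ) (hS : ∀ k, k ∉ S → x k = 0) :
    ∑ m ∈ F, ‖∑ r ∈ Finset.range N, C r (x (m + d r))‖ ^ 2 ≤ 2 * N * ∑ k ∈ S, ‖x k‖ ^ 2 := by
  have hx : x.support.Finite := S.finite_toSet.subset fun k hk => by
    by_contra h; exact hk (hS k h)
  have h := hC.conv N d x hx
  rw [tsum_eq_sum (s := S) (f := fun m => ‖x m‖ ^ 2) (fun k hk => by simp [hS k hk])] at h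
  refine le_trans (Summable.sum_le_tsum F (fun _ _ => by positivity) ?_) h
  refine summable_of_finite_support ?_
  refine ((Finset.range N).biUnion fun r => S.map (Equiv.addRight (- d r)).toEmbedding).finite_toSet.subset ?_
  intro m hm
  by_contra hcon
  refine hm ?_
  have : ∀ r ∈ Finset.range N, x (m + d r) = 0 := by
    intro r hr
    refine hS _ fun hk => hcon ?_
    rw [Finset.mem_coe, Finset.mem_biUnion]
    exact ⟨r, hr, Finset.mem_map.2 ⟨_, hk, by simp⟩⟩
  show ‖∑ r ∈ Finset.range N, C r (x (m + d r))‖ ^ 2 = 0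
  rw [Finset.sum_eq_zero fun r hr => by rw [this r hr, map_zero]]; simp

theorem layer_lt (p : ℝ) (hp : 1 < p) (hp2 : p < 2) (hC : Cliff C) (N : ℕ) (d : ℕ → ℤ) (x : ℤ → H)
    (S F : Finset ℤ) (hS : ∀ k, k ∉ S → x k = 0) (t : ℝ) (ht : 0 < t) :
    ∑ m ∈ F, (if t < ‖∑ r ∈ Finset.range N, C r (x (m + d r))‖ / 2 then t ^ (p - 1) else 0) ≤
      N * (∑ k ∈ S, ‖x k‖ * (if t < ‖x k‖ then t ^ (p - 2) else 0)) +
      2 * N * ∑ k ∈ S, ‖x k‖ ^ 2 * (if ‖x k‖ ≤ t then t ^ (p - 3) else 0) := by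
  classical
  let b : ℤ → H := fun k => if t < ‖x k‖ then x k else 0
  let g : ℤ → H := fun k => if ‖x k‖ ≤ t then x k else 0
  have hbg : ∀ k, x k = b k + g k := by
    intro k; simp only [b, g]
    by_cases h : t < ‖x k‖
    · simp [h, not_le.2 h]
    · simp [h, not_lt.1 h]
  have hb := conv1 hC N d b S F (fun k hk => by simp [b, hS k hk])
  have hg := conv2 hC N d g S F (fun k hk => by simp [g, hS k hk])
  have e1 : t ^ (p - 1) = t ^ (p - 2) * t := by
    rw [← Real.rpow_add_one ht.ne']; congr 1; ring
  have e2 : t ^ (p - 2) = t ^ (p - 3) * t := by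
    rw [← Real.rpow_add_one ht.ne']; congr 1; ring
  have p3 : 0 < t ^ (p - 3) := Real.rpow_pos_of_pos ht _
  have p2 : 0 < t ^ (p - 2) := Real.rpow_pos_of_pos ht _
  calc _ ≤ ∑ m ∈ F, (t ^ (p - 2) * ‖∑ r ∈ Finset.range N, C r (b (m + d r))‖ +
            t ^ (p - 3) * ‖∑ r ∈ Finset.range N, C r (g (m + d r))‖ ^ 2) := by
        refine Finset.sum_le_sum fun m _ => ?_
        split_ifs with h
        swap
        · positivity
        have e : ∑ r ∈ Finset.range N, C r (x (m + d r)) = ∑ r ∈ Finset.range N, C r (b (m + d r)) +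
            ∑ r ∈ Finset.range N, C r (g (m + d r)) := by
          rw [← Finset.sum_add_distrib]
          exact Finset.sum_congr rfl fun r _ => by rw [← map_add, ← hbg]
        rw [e] at h
        have h' := norm_add_le (∑ r ∈ Finset.range N, C r (b (m + d r))) (∑ r ∈ Finset.range N, C r (g (m + d r)))
        set u := ‖∑ r ∈ Finset.range N, C r (b (m + d r))‖
        set v := ‖∑ r ∈ Finset.range N, C r (g (m + d r))‖
        by_cases hu : t ≤ u
        · rw [e1]
          have : t ^ (p - 2) * t ≤ t ^ (p - 2) * u := by gcongr
          have : 0 ≤ t ^ (p - 3) * v ^ 2 := by positivity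
          linarith
        · have hv : t ≤ v := by push Not at hu; linarith
          rw [e1, e2]
          have : t ^ (p - 3) * t ^ 2 ≤ t ^ (p - 3) * v ^ 2 := by gcongr
          have : 0 ≤ t ^ (p - 3) * t * u := by positivity
          linarith
    _ = t ^ (p - 2) * ∑ m ∈ F, ‖∑ r ∈ Finset.range N, C r (b (m + d r))‖ +
          t ^ (p - 3) * ∑ m ∈ F, ‖∑ r ∈ Finset.range N, C r (g (m + d r))‖ ^ 2 := by
        rw [Finset.sum_add_distrib, Finset.mul_sum, Finset.mul_sum]
    _ ≤ t ^ (p - 2) * (N * ∑ k ∈ S, ‖b k‖) + t ^ (p - 3) * (2 * N * ∑ k ∈ S, ‖g k‖ ^ 2) := by gcongr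
    _ = _ := by
        have f1 : t ^ (p - 2) * ∑ k ∈ S, ‖b k‖ = ∑ k ∈ S, ‖x k‖ * (if t < ‖x k‖ then t ^ (p - 2) else 0) := by
          rw [Finset.mul_sum]
          refine Finset.sum_congr rfl fun k _ => ?_
          simp only [b]; split_ifs <;> simp [mul_comm]
        have f2 : t ^ (p - 3) * ∑ k ∈ S, ‖g k‖ ^ 2 = ∑ k ∈ S, ‖x k‖ ^ 2 * (if ‖x k‖ ≤ t then t ^ (p - 3) else 0) := by
          rw [Finset.mul_sum]
          refine Finset.sum_congr rfl fun k _ => ?_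
          simp only [g]; split_ifs <;> simp [mul_comm]
        rw [← f1, ← f2]; ring

theorem layer_gt (p : ℝ) (hp2 : 2 < p) (hC : Cliff C) (N : ℕ) (d : ℕ → ℤ) (x : ℤ → H)
    (S F : Finset ℤ) (hS : ∀ k, k ∉ S → x k = 0) (t : ℝ) (ht : 0 < t) :
    ∑ m ∈ F, (if t < ‖∑ r ∈ Finset.range N, C r (x (m + d r))‖ / 2 then t ^ (p - 1) else 0) ≤
      2 * N * ∑ k ∈ S, ‖x k‖ ^ 2 * (if t < N * ‖x k‖ then t ^ (p - 3) else 0) := by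
  classical
  let b : ℤ → H := fun k => if t < N * ‖x k‖ then x k else 0
  let g : ℤ → H := fun k => if N * ‖x k‖ ≤ t then x k else 0
  have hbg : ∀ k, x k = b k + g k := by
    intro k; simp only [b, g]
    by_cases h : t < N * ‖x k‖
    · simp [h, not_le.2 h]
    · simp [h, not_lt.1 h]
  have hb := conv2 hC N d b S F (fun k hk => by simp [b, hS k hk])
  have hg : ∀ m, ‖∑ r ∈ Finset.range N, C r (g (m + d r))‖ ≤ t := by
    intro m
    rcases Nat.eq_zero_or_pos N with rfl | hN
    · simp [ht.le]
    have hN' : (0:ℝ) < N := by exact_mod_cast hN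
    calc _ ≤ ∑ r ∈ Finset.range N, t / N := by
          refine (norm_sum_le _ _).trans (Finset.sum_le_sum fun r _ => ?_)
          rw [hC.norm, le_div_iff₀ hN']
          simp only [g]; split_ifs with h
          · linarith
          · simp [ht.le]
      _ = t := by simp; field_simp
  have e1 : t ^ (p - 1) = t ^ (p - 3) * t ^ 2 := by
    rw [← Real.rpow_natCast t 2, ← Real.rpow_add ht]; congr 1; push_cast; ring
  have p3 : 0 < t ^ (p - 3) := Real.rpow_pos_of_pos ht _
  calc _ ≤ ∑ m ∈ F, t ^ (p - 3) * ‖∑ r ∈ Finset.range N, C r (b (m + d r))‖ ^ 2 := by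
        refine Finset.sum_le_sum fun m _ => ?_
        split_ifs with h
        swap
        · positivity
        have e : ∑ r ∈ Finset.range N, C r (x (m + d r)) = ∑ r ∈ Finset.range N, C r (b (m + d r)) +
            ∑ r ∈ Finset.range N, C r (g (m + d r)) := by
          rw [← Finset.sum_add_distrib]
          exact Finset.sum_congr rfl fun r _ => by rw [← map_add, ← hbg]
        rw [e] at h
        have h' := norm_add_le (∑ r ∈ Finset.range N, C r (b (m + d r))) (∑ r ∈ Finset.range N, C r (g (m + d r)))
        have h2 := hg m
        rw [e1]
        gcongr
        linarith
    _ = t ^ (p - 3) * ∑ m ∈ F, ‖∑ r ∈ Finset.range N, C r (b (m + d r))‖ ^ 2 := by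
        rw [Finset.mul_sum]
    _ ≤ t ^ (p - 3) * (2 * N * ∑ k ∈ S, ‖b k‖ ^ 2) := by gcongr
    _ = _ := by
        have f2 : t ^ (p - 3) * ∑ k ∈ S, ‖b k‖ ^ 2 = ∑ k ∈ S, ‖x k‖ ^ 2 * (if t < N * ‖x k‖ then t ^ (p - 3) else 0) := by
          rw [Finset.mul_sum]
          refine Finset.sum_congr rfl fun k _ => ?_
          simp only [b]; split_ifs <;> simp [mul_comm]
        rw [← f2]; ring

/-- the left-hand side layer cake -/
theorem layer_int (p : ℝ) (hp : 1 < p) (F : Finset ℤ) (y : ℤ → ℝ) (hy : ∀ m, 0 ≤ y m) :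
    IntegrableOn (fun t : ℝ => ∑ m ∈ F, (if t < y m / 2 then t ^ (p - 1) else 0)) (Set.Ioi 0) ∧
    ∫ t in Set.Ioi (0:ℝ), ∑ m ∈ F, (if t < y m / 2 then t ^ (p - 1) else 0) = (∑ m ∈ F, y m ^ p) / (2 ^ p * p) := by
  have h := fun m => ker1 (p - 1) (y m / 2) (by linarith) (by linarith [hy m])
  refine ⟨integrable_finsetSum _ fun m _ => (h m).1, ?_⟩
  rw [integral_finsetSum _ fun m _ => (h m).1, Finset.sum_div]
  refine Finset.sum_congr rfl fun m _ => ?_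
  rw [(h m).2, sub_add_cancel, Real.div_rpow (hy m) (by norm_num), div_div]

theorem sq_mul_rpow (p a : ℝ) (hp : 1 < p) (ha : 0 ≤ a) : a ^ 2 * a ^ (p - 2) = a ^ p := by
  rcases ha.eq_or_lt with rfl | ha
  · rw [Real.zero_rpow (show p ≠ 0 by linarith)]; simp
  · rw [← Real.rpow_natCast a 2, ← Real.rpow_add ha]; congr 1; push_cast; ring

theorem mul_rpow_sub (p a : ℝ) (hp : 1 < p) (ha : 0 ≤ a) : a * a ^ (p - 1) = a ^ p := by
  rcases ha.eq_or_lt with rfl | ha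
  · rw [Real.zero_rpow (show p ≠ 0 by linarith)]; simp
  · rw [mul_comm, ← Real.rpow_add_one ha.ne']; congr 1; ring

theorem convp_lt (p : ℝ) (hp : 1 < p) (hp2 : p < 2) (hC : Cliff C) (N : ℕ) (d : ℕ → ℤ) (x : ℤ → H)
    (S F : Finset ℤ) (hS : ∀ k, k ∉ S → x k = 0) :
    ∑ m ∈ F, ‖∑ r ∈ Finset.range N, C r (x (m + d r))‖ ^ p ≤
      (2 ^ p * p) * (1 / (p - 1) + 2 / (2 - p)) * N * ∑ k ∈ S, ‖x k‖ ^ p := by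
  obtain ⟨i1, v1⟩ := layer_int p hp F (fun m => ‖∑ r ∈ Finset.range N, C r (x (m + d r))‖) (fun _ => norm_nonneg _)
  have k1 := fun k => ker1 (p - 2) ‖x k‖ (by linarith) (norm_nonneg _)
  have k2 := fun k => ker2 (p - 3) ‖x k‖ (by linarith) (norm_nonneg _)
  have j1 : IntegrableOn (fun t : ℝ => N * (∑ k ∈ S, ‖x k‖ * (if t < ‖x k‖ then t ^ (p - 2) else 0))) (Set.Ioi 0) :=
    Integrable.const_mul (integrable_finsetSum _ fun k _ => Integrable.const_mul (k1 k).1 _) _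
  have j2 : IntegrableOn (fun t : ℝ => 2 * N * ∑ k ∈ S, ‖x k‖ ^ 2 * (if ‖x k‖ ≤ t then t ^ (p - 3) else 0)) (Set.Ioi 0) :=
    Integrable.const_mul (integrable_finsetSum _ fun k _ => (k2 k).1) _
  have h := setIntegral_mono_on i1 (j1.add j2) measurableSet_Ioi
    (fun t ht => layer_lt p hp hp2 hC N d x S F hS t ht)
  rw [v1] at h
  have e : ∫ t in Set.Ioi (0:ℝ), ((fun t : ℝ => (N:ℝ) * (∑ k ∈ S, ‖x k‖ * (if t < ‖x k‖ then t ^ (p - 2) else 0))) +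
      (fun t : ℝ => 2 * (N:ℝ) * ∑ k ∈ S, ‖x k‖ ^ 2 * (if ‖x k‖ ≤ t then t ^ (p - 3) else 0))) t =
      (1 / (p - 1) + 2 / (2 - p)) * N * ∑ k ∈ S, ‖x k‖ ^ p := by
    rw [integral_add' j1 j2, integral_const_mul, integral_const_mul,
      integral_finsetSum _ fun k _ => Integrable.const_mul (k1 k).1 _, integral_finsetSum _ fun k _ => (k2 k).1]
    have a1 : ∀ k ∈ S, ∫ t in Set.Ioi (0:ℝ), ‖x k‖ * (if t < ‖x k‖ then t ^ (p - 2) else 0) = ‖x k‖ ^ p * (1 / (p - 1)) := by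
      intro k _
      rw [integral_const_mul, (k1 k).2, show p - 2 + 1 = p - 1 by ring, ← mul_rpow_sub p _ hp (norm_nonneg (x k))]
      ring
    have a2 : ∀ k ∈ S, ∫ t in Set.Ioi (0:ℝ), ‖x k‖ ^ 2 * (if ‖x k‖ ≤ t then t ^ (p - 3) else 0) = ‖x k‖ ^ p * (1 / (2 - p)) := by
      intro k _
      rw [(k2 k).2, show p - 3 + 1 = p - 2 by ring, ← sq_mul_rpow p _ hp (norm_nonneg (x k)), neg_sub]
      ring
    rw [Finset.sum_congr rfl a1, Finset.sum_congr rfl a2, ← Finset.sum_mul, ← Finset.sum_mul]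
    ring
  have hpos : (0:ℝ) < 2 ^ p * p := by positivity
  rw [div_le_iff₀ hpos] at h
  refine h.trans (le_of_eq ?_)
  refine (congrArg (· * (2 ^ p * p)) e).trans ?_
  ring

theorem convp_gt (p : ℝ) (hp2 : 2 < p) (hC : Cliff C) (N : ℕ) (hN : 0 < N) (d : ℕ → ℤ) (x : ℤ → H)
    (S F : Finset ℤ) (hS : ∀ k, k ∉ S → x k = 0) :
    ∑ m ∈ F, ‖∑ r ∈ Finset.range N, C r (x (m + d r))‖ ^ p ≤
      (2 ^ p * p) * (2 / (p - 2)) * (N:ℝ) ^ (p - 1) * ∑ k ∈ S, ‖x k‖ ^ p := by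
  have hp : 1 < p := by linarith
  have hN' : (0:ℝ) < N := by exact_mod_cast hN
  obtain ⟨i1, v1⟩ := layer_int p hp F (fun m => ‖∑ r ∈ Finset.range N, C r (x (m + d r))‖) (fun _ => norm_nonneg _)
  have k1 := fun k => ker1 (p - 3) (N * ‖x k‖) (by linarith) (by positivity)
  have j1 : IntegrableOn (fun t : ℝ => 2 * N * (∑ k ∈ S, ‖x k‖ ^ 2 * (if t < N * ‖x k‖ then t ^ (p - 3) else 0))) (Set.Ioi 0) :=
    Integrable.const_mul (integrable_finsetSum _ fun k _ => Integrable.const_mul (k1 k).1 _) _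
  have h := setIntegral_mono_on i1 j1 measurableSet_Ioi
    (fun t ht => layer_gt p hp2 hC N d x S F hS t ht)
  rw [v1] at h
  have e : ∫ t in Set.Ioi (0:ℝ), 2 * (N:ℝ) * (∑ k ∈ S, ‖x k‖ ^ 2 * (if t < N * ‖x k‖ then t ^ (p - 3) else 0)) =
      (2 / (p - 2)) * (N:ℝ) ^ (p - 1) * ∑ k ∈ S, ‖x k‖ ^ p := by
    rw [integral_const_mul,
      integral_finsetSum _ fun k _ => Integrable.const_mul (k1 k).1 _]
    have a1 : ∀ k ∈ S, ∫ t in Set.Ioi (0:ℝ), ‖x k‖ ^ 2 * (if t < N * ‖x k‖ then t ^ (p - 3) else 0) =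
        ‖x k‖ ^ p * ((N:ℝ) ^ (p - 2) / (p - 2)) := by
      intro k _
      rw [integral_const_mul, (k1 k).2, show p - 3 + 1 = p - 2 by ring, ← sq_mul_rpow p _ hp (norm_nonneg (x k)),
        Real.mul_rpow hN'.le (norm_nonneg _)]
      ring
    rw [Finset.sum_congr rfl a1, ← Finset.sum_mul, show p - 1 = p - 2 + 1 by ring, Real.rpow_add_one hN'.ne']
    ring
  have hpos : (0:ℝ) < 2 ^ p * p := by positivity
  rw [div_le_iff₀ hpos, e] at h
  refine h.trans (le_of_eq ?_)
  ring

theorem convp (p : ℝ) (hp : 1 < p) : ∃ c : ℝ, 0 < c ∧ ∃ θ : ℝ, θ < p ∧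
    ∀ (H : Type) [NormedAddCommGroup H] [InnerProductSpace ℂ H] (C : ℕ → H →L[ℂ] H), Cliff C →
    ∀ (N : ℕ) (_ : 0 < N) (d : ℕ → ℤ) (x : ℤ → H)
    (S F : Finset ℤ) (_ : ∀ k, k ∉ S → x k = 0),
    ∑ m ∈ F, ‖∑ r ∈ Finset.range N, C r (x (m + d r))‖ ^ p ≤ c * (N:ℝ) ^ θ * ∑ k ∈ S, ‖x k‖ ^ p := by
  rcases lt_trichotomy p 2 with h | h | h
  · refine ⟨(2 ^ p * p) * (1 / (p - 1) + 2 / (2 - p)), ?_, 1, hp, ?_⟩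
    · have : 0 < p - 1 := by linarith
      have : 0 < 2 - p := by linarith
      positivity
    · intro H _ _ C hC N _ d x S F hS
      rw [Real.rpow_one]
      exact convp_lt p hp h hC N d x S F hS
  · refine ⟨2, by norm_num, 1, hp, ?_⟩
    intro H _ _ C hC N _ d x S F hS
    subst h
    have := conv2 hC N d x S F hS
    simpa using this
  · refine ⟨(2 ^ p * p) * (2 / (p - 2)), ?_, p - 1, by linarith, ?_⟩
    · have : 0 < p - 2 := by linarith
      positivity
    · intro H _ _ C hC N hN d x S F hS
      exact convp_gt p h hC N hN d x S F hS

end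
end PB

namespace PB

/-- a finite average over signs -/
structure Signs {ι Θ : Type} [DecidableEq ι] [Fintype Θ] (A : Finset ι) (w : Θ → ℝ) (ε : Θ → ι → ℝ) : Prop where
  w0 : ∀ θ, 0 ≤ w θ
  w1 : ∑ θ, w θ = 1
  abs : ∀ θ, ∀ i ∈ A, |ε θ i| = 1
  orth : ∀ i ∈ A, ∀ j ∈ A, ∑ θ, w θ * (ε θ i * ε θ j) = if i = j then 1 else 0
  upper : ∀ q : ℝ, 0 < q → ∀ a : ι → ℂ,
    ∑ θ, w θ * ‖∑ i ∈ A, (ε θ i : ℂ) * a i‖ ^ q ≤ Kh q * (√(∑ i ∈ A, ‖a i‖ ^ 2)) ^ q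
  lower : ∀ q : ℝ, 0 < q → ∀ a : ι → ℂ,
    (√(∑ i ∈ A, ‖a i‖ ^ 2)) ^ q ≤ Kl q * ∑ θ, w θ * ‖∑ i ∈ A, (ε θ i : ℂ) * a i‖ ^ q

theorem exists_signs {ι : Type} [DecidableEq ι] (A : Finset ι) :
    ∃ (Θ : Type) (_ : Fintype Θ) (w : Θ → ℝ) (ε : Θ → ι → ℝ), Signs A w ε := by
  have h := rad_coin {i // i ∈ A}
  have hprob := h.prob
  set P : Measure ({i // i ∈ A} → Bool) := (Measure.infinitePi fun _ : {i // i ∈ A} => coin) with hP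
  have hfin : ∀ f : ({i // i ∈ A} → Bool) → ℝ, ∫ θ, f θ ∂P = ∑ θ, P.real {θ} * f θ := by
    intro f
    rw [integral_fintype Integrable.of_finite]; rfl
  have hsum : ∀ (θ : {i // i ∈ A} → Bool) (a : ι → ℂ),
      ∑ i ∈ A, ((if hi : i ∈ A then sgn (θ ⟨i, hi⟩) else 0 : ℝ) : ℂ) * a i =
      ∑ i : {i // i ∈ A}, a i * ((sgn (θ i) : ℝ) : ℂ) := by
    intro θ a
    rw [← Finset.sum_coe_sort A]
    refine Finset.sum_congr rfl fun i _ => ?_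
    rw [dif_pos i.2, mul_comm]
  have hsq : ∀ a : ι → ℂ, ∑ i ∈ A, ‖a i‖ ^ 2 = ∑ i : {i // i ∈ A}, ‖a i‖ ^ 2 := by
    intro a; rw [← Finset.sum_coe_sort A]
  refine ⟨{i // i ∈ A} → Bool, inferInstance, fun θ => P.real {θ},
    fun θ i => if hi : i ∈ A then sgn (θ ⟨i, hi⟩) else 0, ?_⟩
  refine ⟨fun θ => measureReal_nonneg, ?_, ?_, ?_, ?_, ?_⟩
  · have := hfin (fun _ => 1)
    simpa using this.symm
  · intro θ i hi
    rw [dif_pos hi]; exact h.abs ⟨i, hi⟩ θ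
  · intro i hi j hj
    have := h.mul_integral ⟨i, hi⟩ ⟨j, hj⟩
    rw [hfin] at this
    simp only [Subtype.mk.injEq] at this
    simp only [dif_pos hi, dif_pos hj]
    exact this
  · intro q hq a
    have := h.upper Finset.univ (fun i => a i) q hq
    rw [hfin] at this
    simp only [hsum, hsq]
    exact this
  · intro q hq a
    have := h.lower Finset.univ (fun i => a i) q hq
    rw [hfin] at this
    simp only [hsum, hsq]
    exact this

section
variable {ι Θ : Type} [DecidableEq ι] [Fintype Θ] {A : Finset ι} {w : Θ → ℝ} {ε : Θ → ι → ℝ}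
variable {Ω : Type} [MeasurableSpace Ω] {μ : Measure Ω}

theorem Signs.avg_int (p : ℝ) (hp : 1 < p) (z : ι → Lp ℂ (ENNReal.ofReal p) μ) (θ : Θ) :
    Integrable (fun x => w θ * ‖∑ i ∈ A, (ε θ i : ℂ) * z i x‖ ^ p) μ := by
  refine Integrable.const_mul ?_ _
  refine (Lp_int μ p hp (∑ i ∈ A, (ε θ i : ℂ) • z i)).congr ?_
  filter_upwards [Lp_sum_ae A (fun i => (ε θ i : ℂ)) z] with x hx
  rw [hx]

theorem Signs.avg (p : ℝ) (hp : 1 < p) (z : ι → Lp ℂ (ENNReal.ofReal p) μ) :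
    ∑ θ, w θ * ‖∑ i ∈ A, (ε θ i : ℂ) • z i‖ ^ p =
      ∫ x, ∑ θ, w θ * ‖∑ i ∈ A, (ε θ i : ℂ) * z i x‖ ^ p ∂μ := by
  rw [integral_finsetSum _ fun θ _ => Signs.avg_int p hp z θ]
  refine Finset.sum_congr rfl fun θ _ => ?_
  rw [integral_const_mul, Lp_norm_of_ae μ p hp _ _ (Lp_sum_ae A (fun i => (ε θ i : ℂ)) z)]

theorem Signs.sq_int (h : Signs A w ε) (p : ℝ) (hp : 1 < p) (z : ι → Lp ℂ (ENNReal.ofReal p) μ) :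
    Integrable (fun x => (√(∑ i ∈ A, ‖z i x‖ ^ 2)) ^ p) μ := by
  have h1 : Integrable (fun x => Kl p * ∑ θ, w θ * ‖∑ i ∈ A, (ε θ i : ℂ) * z i x‖ ^ p) μ :=
    Integrable.const_mul (integrable_finsetSum _ fun θ _ => Signs.avg_int p hp z θ) _
  refine h1.mono' ?_ (ae_of_all _ fun x => ?_)
  · refine AEMeasurable.aestronglyMeasurable ?_
    refine AEMeasurable.pow_const ?_ p
    refine Real.continuous_sqrt.measurable.comp_aemeasurable ?_
    refine Finset.aemeasurable_fun_sum A fun i _ => ?_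
    exact ((Lp.aestronglyMeasurable (z i)).norm.aemeasurable).pow_const 2
  · rw [Real.norm_of_nonneg (by positivity)]
    exact h.lower p (by linarith) (fun i => z i x)

theorem Signs.upper_Lp (h : Signs A w ε) (p : ℝ) (hp : 1 < p) (z : ι → Lp ℂ (ENNReal.ofReal p) μ) :
    ∑ θ, w θ * ‖∑ i ∈ A, (ε θ i : ℂ) • z i‖ ^ p ≤ Kh p * ∫ x, (√(∑ i ∈ A, ‖z i x‖ ^ 2)) ^ p ∂μ := by
  rw [Signs.avg p hp z, ← integral_const_mul]
  refine integral_mono (integrable_finsetSum _ fun θ _ => Signs.avg_int p hp z θ)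
    (Integrable.const_mul (h.sq_int p hp z) _) fun x => ?_
  exact h.upper p (by linarith) (fun i => z i x)

theorem Signs.lower_Lp (h : Signs A w ε) (p : ℝ) (hp : 1 < p) (z : ι → Lp ℂ (ENNReal.ofReal p) μ) :
    ∫ x, (√(∑ i ∈ A, ‖z i x‖ ^ 2)) ^ p ∂μ ≤ Kl p * ∑ θ, w θ * ‖∑ i ∈ A, (ε θ i : ℂ) • z i‖ ^ p := by
  rw [Signs.avg p hp z, ← integral_const_mul]
  refine integral_mono (h.sq_int p hp z)
    (Integrable.const_mul (integrable_finsetSum _ fun θ _ => Signs.avg_int p hp z θ) _) fun x => ?_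
  exact h.lower p (by linarith) (fun i => z i x)

/-- the trace estimate -/
theorem Signs.trace {A : Finset (Finset ℕ)} {w : Θ → ℝ} {ε : Θ → Finset ℕ → ℝ} (h : Signs A w ε)
    {V : Type} [NormedAddCommGroup V] [NormedSpace ℂ V] (R : V →L[ℂ] H0) (z : Finset ℕ → V) (p : ℝ) (hp : 1 < p) :
    ‖∑ t ∈ A, R (z t) t‖ ^ p ≤ (√(A.card) * ‖R‖) ^ p * ∑ θ, w θ * ‖∑ i ∈ A, (ε θ i : ℂ) • z i‖ ^ p := by
  have e : ∑ t ∈ A, R (z t) t = ∑ θ, (w θ : ℂ) * inner ℂ (∑ u ∈ A, (ε θ u : ℂ) • e0 u) (R (∑ i ∈ A, (ε θ i : ℂ) • z i)) := by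
    have : ∀ θ, (w θ : ℂ) * inner ℂ (∑ u ∈ A, (ε θ u : ℂ) • e0 u) (R (∑ i ∈ A, (ε θ i : ℂ) • z i)) =
        ∑ u ∈ A, ∑ i ∈ A, ((w θ * (ε θ u * ε θ i) : ℝ) : ℂ) * R (z i) u := by
      intro θ
      rw [sum_inner, Finset.mul_sum]
      refine Finset.sum_congr rfl fun u _ => ?_
      rw [map_sum, inner_sum, Finset.mul_sum]
      refine Finset.sum_congr rfl fun i _ => ?_
      rw [inner_smul_left, map_smul, inner_smul_right, inner_e0, Complex.conj_ofReal]
      push_cast; ring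
    simp_rw [this]
    rw [Finset.sum_comm]
    refine Finset.sum_congr rfl fun u hu => ?_
    rw [Finset.sum_comm]
    have : ∀ i ∈ A, ∑ θ, ((w θ * (ε θ u * ε θ i) : ℝ) : ℂ) * R (z i) u = if u = i then R (z i) u else 0 := by
      intro i hi
      rw [← Finset.sum_mul, ← Complex.ofReal_sum, h.orth u hu i hi]
      split_ifs <;> simp
    rw [Finset.sum_congr rfl this, Finset.sum_ite_eq, if_pos hu]
  have hE : ∀ θ, ‖∑ u ∈ A, (ε θ u : ℂ) • e0 u‖ = √(A.card) := by
    intro θ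
    have h1 := norm_sum_e0 A (fun u => (ε θ u : ℂ))
    rw [Finset.sum_congr rfl (g := fun _ => (1:ℝ)) (fun u hu => by
      rw [Complex.norm_real, Real.norm_eq_abs, h.abs θ u hu]; norm_num)] at h1
    rw [← Real.sqrt_sq (norm_nonneg _), h1]; simp
  have h2 : ‖∑ t ∈ A, R (z t) t‖ ≤ (√(A.card) * ‖R‖) * ∑ θ, w θ * ‖∑ i ∈ A, (ε θ i : ℂ) • z i‖ := by
    rw [e, Finset.mul_sum]
    refine (norm_sum_le _ _).trans (Finset.sum_le_sum fun θ _ => ?_)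
    rw [norm_mul, Complex.norm_real, Real.norm_of_nonneg (h.w0 θ)]
    have h3 := norm_inner_le_norm (𝕜 := ℂ) (∑ u ∈ A, (ε θ u : ℂ) • e0 u) (R (∑ i ∈ A, (ε θ i : ℂ) • z i))
    rw [hE] at h3
    have h4 := R.le_opNorm (∑ i ∈ A, (ε θ i : ℂ) • z i)
    calc _ ≤ w θ * (√(A.card) * (‖R‖ * ‖∑ i ∈ A, (ε θ i : ℂ) • z i‖)) := by
          refine mul_le_mul_of_nonneg_left (h3.trans ?_) (h.w0 θ)
          gcongr
      _ = _ := by ring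
  have hs : 0 ≤ ∑ θ, w θ * ‖∑ i ∈ A, (ε θ i : ℂ) • z i‖ :=
    Finset.sum_nonneg fun θ _ => mul_nonneg (h.w0 θ) (norm_nonneg _)
  calc _ ≤ ((√(A.card) * ‖R‖) * ∑ θ, w θ * ‖∑ i ∈ A, (ε θ i : ℂ) • z i‖) ^ p := by gcongr
    _ = (√(A.card) * ‖R‖) ^ p * (∑ θ, w θ * ‖∑ i ∈ A, (ε θ i : ℂ) • z i‖) ^ p := Real.mul_rpow (by positivity) hs
    _ ≤ _ := by
      gcongr
      exact Real.rpow_arith_mean_le_arith_mean_rpow _ _ _ (fun θ _ => h.w0 θ) h.w1 (fun _ _ => norm_nonneg _) hp.le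

end
end PB

open scoped ENNReal symmDiff

namespace PB

section
variable {Ω : Type} [MeasurableSpace Ω] {μ : Measure Ω} {p : ℝ} [Fact (1 ≤ ENNReal.ofReal p)]

/-- the orbit vectors -/
noncomputable def Wv (U : Lp ℂ (ENNReal.ofReal p) μ ≃L[ℂ] Lp ℂ (ENNReal.ofReal p) μ)
    (X : H0 →L[ℂ] Lp ℂ (ENNReal.ofReal p) μ) (k : ℤ) (s : Finset ℕ) : Lp ℂ (ENNReal.ofReal p) μ :=
  (U ^ k) (X (e0 s))

/-- the twisted vectors -/
noncomputable def Zv (U : Lp ℂ (ENNReal.ofReal p) μ ≃L[ℂ] Lp ℂ (ENNReal.ofReal p) μ)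
    (X : H0 →L[ℂ] Lp ℂ (ENNReal.ofReal p) μ) (N : ℕ) (m : ℤ) (t : Finset ℕ) : Lp ℂ (ENNReal.ofReal p) μ :=
  ∑ r ∈ Finset.range N, sg r t • Wv U X (m + ((2 ^ r : ℕ) : ℤ)) (t ∆ {r})

variable (U : Lp ℂ (ENNReal.ofReal p) μ ≃L[ℂ] Lp ℂ (ENNReal.ofReal p) μ)
    (X : H0 →L[ℂ] Lp ℂ (ENNReal.ofReal p) μ) (R : Lp ℂ (ENNReal.ofReal p) μ →L[ℂ] H0)

theorem Wv_shift (m k : ℤ) (s : Finset ℕ) : (U ^ (-m)) (Wv U X (m + k) s) = (U ^ k) (X (e0 s)) := by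
  have : U ^ k = U ^ (-m) * U ^ (m + k) := by rw [← zpow_add]; congr 1; ring
  rw [this]; rfl

theorem Zv_trace (hR : ∀ (r : ℕ) (h : H0), R ((U ^ ((2 ^ r : ℕ) : ℤ)) (X h)) = Cl r h) (N : ℕ) (m : ℤ) (t : Finset ℕ) :
    (R.comp (U ^ (-m)).toContinuousLinearMap) (Zv U X N m t) t = N := by
  have h1 : (R.comp (U ^ (-m)).toContinuousLinearMap) (Zv U X N m t) =
      ∑ r ∈ Finset.range N, sg r t • Cl r (e0 (t ∆ {r})) := by
    rw [Zv, map_sum]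
    refine Finset.sum_congr rfl fun r _ => ?_
    rw [map_smul]
    congr 1
    show R ((U ^ (-m)) (Wv U X (m + ((2 ^ r : ℕ) : ℤ)) (t ∆ {r}))) = _
    rw [Wv_shift, hR]
  rw [h1]
  have h2 : (∑ r ∈ Finset.range N, sg r t • Cl r (e0 (t ∆ {r}))) t =
      ∑ r ∈ Finset.range N, (sg r t • Cl r (e0 (t ∆ {r}))) t := by
    rw [lp.coeFn_sum, Finset.sum_apply]
  rw [h2, Finset.sum_congr rfl (g := fun _ => (1:ℂ))]
  · simp
  · intro r _
    rw [lp.coeFn_smul, Pi.smul_apply, Cl_apply, e0_apply, if_pos rfl, mul_one, smul_eq_mul, sg_mul_self]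

theorem tog_mem (N r : ℕ) (hr : r < N) (t : Finset ℕ) (ht : t ∈ (Finset.range N).powerset) :
    t ∆ {r} ∈ (Finset.range N).powerset := by
  rw [Finset.mem_powerset] at ht ⊢
  intro a ha
  rw [Finset.mem_symmDiff] at ha
  rcases ha with ⟨h, _⟩ | ⟨h, _⟩
  · exact ht h
  · rw [Finset.mem_singleton] at h; subst h; exact Finset.mem_range.2 hr

theorem sqrt_le_norm (A : Finset (Finset ℕ)) (x : H0) : √(∑ t ∈ A, ‖x t‖ ^ 2) ≤ ‖x‖ := by
  have h := lp.sum_rpow_le_norm_rpow (p := 2) (by norm_num) x A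
  rw [Real.sqrt_le_left (norm_nonneg _)]
  simpa using h

theorem norm_e0_sum (A : Finset (Finset ℕ)) (a : Finset ℕ → ℂ) :
    ‖∑ s ∈ A, a s • e0 s‖ = √(∑ s ∈ A, ‖a s‖ ^ 2) := by
  rw [← norm_sum_e0, Real.sqrt_sq (norm_nonneg _)]

theorem sum_e0_apply (A : Finset (Finset ℕ)) (a : Finset ℕ → ℂ) (t : Finset ℕ) (ht : t ∈ A) :
    (∑ s ∈ A, a s • e0 s : H0) t = a t := by
  rw [lp.coeFn_sum, Finset.sum_apply]
  have : ∀ s ∈ A, (a s • e0 s : H0) t = if t = s then a s else 0 := by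
    intro s _
    rw [lp.coeFn_smul, Pi.smul_apply, e0_apply, smul_eq_mul]
    split_ifs <;> simp
  rw [Finset.sum_congr rfl this, Finset.sum_ite_eq, if_pos ht]

/-- the pointwise estimate -/
theorem pointwise (c th : ℝ)
    (hconv : ∀ (N : ℕ) (_ : 0 < N) (d : ℕ → ℤ) (x : ℤ → H0) (S F : Finset ℤ) (_ : ∀ k, k ∉ S → x k = 0),
      ∑ m ∈ F, ‖∑ r ∈ Finset.range N, Cl r (x (m + d r))‖ ^ p ≤ c * (N:ℝ) ^ th * ∑ k ∈ S, ‖x k‖ ^ p)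
    (hp : 1 < p) (N : ℕ) (hN : 0 < N) (a : ℤ → Finset ℕ → ℂ) (S F : Finset ℤ)
    (hF : ∀ m ∈ F, ∀ r < N, m + ((2 ^ r : ℕ) : ℤ) ∈ S) :
    ∑ m ∈ F, (√(∑ t ∈ (Finset.range N).powerset,
      ‖∑ r ∈ Finset.range N, sg r t * a (m + ((2 ^ r : ℕ) : ℤ)) (t ∆ {r})‖ ^ 2)) ^ p ≤
    c * (N:ℝ) ^ th * ∑ k ∈ S, (√(∑ s ∈ (Finset.range N).powerset, ‖a k s‖ ^ 2)) ^ p := by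
  classical
  let x : ℤ → H0 := fun k => if k ∈ S then ∑ s ∈ (Finset.range N).powerset, a k s • e0 s else 0
  have h := hconv N hN (fun r => ((2 ^ r : ℕ) : ℤ)) x S F (fun k hk => by simp [x, hk])
  have e : ∑ k ∈ S, ‖x k‖ ^ p = ∑ k ∈ S, (√(∑ s ∈ (Finset.range N).powerset, ‖a k s‖ ^ 2)) ^ p := by
    refine Finset.sum_congr rfl fun k hk => ?_
    simp only [x, if_pos hk]
    rw [norm_e0_sum]
  rw [e] at h
  refine le_trans (Finset.sum_le_sum fun m hm => ?_) h
  refine Real.rpow_le_rpow (Real.sqrt_nonneg _) ?_ (by linarith)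
  refine le_trans (le_of_eq ?_) (sqrt_le_norm (Finset.range N).powerset _)
  congr 1
  refine Finset.sum_congr rfl fun t ht => ?_
  congr 2
  rw [lp.coeFn_sum, Finset.sum_apply]
  refine Finset.sum_congr rfl fun r hr => ?_
  have hr' := Finset.mem_range.1 hr
  rw [Cl_apply]
  congr 1
  simp only [x, if_pos (hF m hm r hr')]
  rw [sum_e0_apply _ _ _ (tog_mem N r hr' t ht)]

theorem Zv_int (c th : ℝ)
    (hconv : ∀ (N : ℕ) (_ : 0 < N) (d : ℕ → ℤ) (x : ℤ → H0) (S F : Finset ℤ) (_ : ∀ k, k ∉ S → x k = 0),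
      ∑ m ∈ F, ‖∑ r ∈ Finset.range N, Cl r (x (m + d r))‖ ^ p ≤ c * (N:ℝ) ^ th * ∑ k ∈ S, ‖x k‖ ^ p)
    (hp : 1 < p) (N : ℕ) (hN : 0 < N) (S F : Finset ℤ)
    (hF : ∀ m ∈ F, ∀ r < N, m + ((2 ^ r : ℕ) : ℤ) ∈ S) :
    ∑ m ∈ F, ∫ x, (√(∑ t ∈ (Finset.range N).powerset, ‖Zv U X N m t x‖ ^ 2)) ^ p ∂μ ≤
    c * (N:ℝ) ^ th * ∑ k ∈ S, ∫ x, (√(∑ s ∈ (Finset.range N).powerset, ‖Wv U X k s x‖ ^ 2)) ^ p ∂μ := by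
  obtain ⟨Θ, _, w, ε, hs⟩ := exists_signs (Finset.range N).powerset
  have i1 := fun m => hs.sq_int p hp (Zv U X N m)
  have i2 := fun k => hs.sq_int p hp (Wv U X k)
  rw [← integral_finsetSum _ fun m _ => i1 m, ← integral_finsetSum _ fun k _ => i2 k, ← integral_const_mul]
  refine integral_mono_ae (integrable_finsetSum _ fun m _ => i1 m)
    (Integrable.const_mul (integrable_finsetSum _ fun k _ => i2 k) _) ?_
  have hae : ∀ᵐ x ∂μ, ∀ m ∈ F, ∀ t ∈ (Finset.range N).powerset, Zv U X N m t x =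
      ∑ r ∈ Finset.range N, sg r t * Wv U X (m + ((2 ^ r : ℕ) : ℤ)) (t ∆ {r}) x := by
    rw [Filter.eventually_all_finset]
    intro m _
    rw [Filter.eventually_all_finset]
    intro t _
    exact Lp_sum_ae (Finset.range N) (fun r => sg r t) (fun r => Wv U X (m + ((2 ^ r : ℕ) : ℤ)) (t ∆ {r}))
  filter_upwards [hae] with x hx
  refine le_trans (le_of_eq ?_) (pointwise c th hconv hp N hN (fun k s => Wv U X k s x) S F hF)
  refine Finset.sum_congr rfl fun m hm => ?_
  congr 2
  refine Finset.sum_congr rfl fun t ht => ?_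
  rw [hx m hm t ht]

theorem Wv_bound (hp : 1 < p) (K : ℝ) (hU : ∀ n : ℤ, ‖(U ^ n).toContinuousLinearMap‖ ≤ K)
    (A : Finset (Finset ℕ)) (k : ℤ) :
    ∫ x, (√(∑ s ∈ A, ‖Wv U X k s x‖ ^ 2)) ^ p ∂μ ≤ Kl p * (K * ‖X‖ * √(A.card)) ^ p := by
  have hK : 0 ≤ K := (norm_nonneg _).trans (hU 0)
  obtain ⟨Θ, _, w, ε, hs⟩ := exists_signs A
  refine (hs.lower_Lp p hp (Wv U X k)).trans ?_
  refine mul_le_mul_of_nonneg_left ?_ (Kl_pos p).le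
  calc _ ≤ ∑ θ, w θ * (K * ‖X‖ * √(A.card)) ^ p := by
        refine Finset.sum_le_sum fun θ _ => mul_le_mul_of_nonneg_left ?_ (hs.w0 θ)
        refine Real.rpow_le_rpow (norm_nonneg _) ?_ (by linarith)
        have e : ∑ i ∈ A, (ε θ i : ℂ) • Wv U X k i =
            (U ^ k).toContinuousLinearMap (X (∑ i ∈ A, (ε θ i : ℂ) • e0 i)) := by
          simp only [map_sum, map_smul]; rfl
        have hE : ‖∑ i ∈ A, (ε θ i : ℂ) • e0 i‖ = √(A.card) := by
          rw [norm_e0_sum, Finset.sum_congr rfl (g := fun _ => (1:ℝ)) (fun u hu => by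
            rw [Complex.norm_real, Real.norm_eq_abs, hs.abs θ u hu]; norm_num)]
          simp
        rw [e]
        have h1 := (U ^ k).toContinuousLinearMap.le_opNorm (X (∑ i ∈ A, (ε θ i : ℂ) • e0 i))
        have h2 := X.le_opNorm (∑ i ∈ A, (ε θ i : ℂ) • e0 i)
        rw [hE] at h2
        calc _ ≤ _ := h1
          _ ≤ K * (‖X‖ * √(A.card)) := by
              gcongr
              exact hU k
          _ = _ := by ring
    _ = _ := by rw [← Finset.sum_mul, hs.w1, one_mul]

theorem Zv_lower (hp : 1 < p) (K : ℝ) (hU : ∀ n : ℤ, ‖(U ^ n).toContinuousLinearMap‖ ≤ K)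
    (hR : ∀ (r : ℕ) (h : H0), R ((U ^ ((2 ^ r : ℕ) : ℤ)) (X h)) = Cl r h)
    (A : Finset (Finset ℕ)) (N : ℕ) (m : ℤ) :
    (A.card * N : ℝ) ^ p ≤ (√(A.card) * (‖R‖ * K)) ^ p *
      (Kh p * ∫ x, (√(∑ t ∈ A, ‖Zv U X N m t x‖ ^ 2)) ^ p ∂μ) := by
  have hK : 0 ≤ K := (norm_nonneg _).trans (hU 0)
  obtain ⟨Θ, _, w, ε, hs⟩ := exists_signs A
  have h := hs.trace (R.comp (U ^ (-m)).toContinuousLinearMap) (Zv U X N m) p hp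
  rw [Finset.sum_congr rfl fun t _ => Zv_trace U X R hR N m t] at h
  have e : ‖∑ t ∈ A, (N:ℂ)‖ = A.card * N := by simp
  rw [e] at h
  refine h.trans ?_
  have hn : ‖R.comp (U ^ (-m)).toContinuousLinearMap‖ ≤ ‖R‖ * K :=
    (ContinuousLinearMap.opNorm_comp_le _ _).trans (mul_le_mul_of_nonneg_left (hU _) (norm_nonneg _))
  have h0 : 0 ≤ ∑ θ, w θ * ‖∑ i ∈ A, (ε θ i : ℂ) • Zv U X N m i‖ ^ p :=
    Finset.sum_nonneg fun θ _ => mul_nonneg (hs.w0 θ) (by positivity)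
  refine mul_le_mul ?_ (hs.upper_Lp p hp (Zv U X N m)) h0 (by positivity)
  gcongr

theorem no_dil (hp : 1 < p) (K : ℝ) (hU : ∀ n : ℤ, ‖(U ^ n).toContinuousLinearMap‖ ≤ K)
    (hR : ∀ (r : ℕ) (h : H0), R ((U ^ ((2 ^ r : ℕ) : ℤ)) (X h)) = Cl r h) : False := by
  have hK : 0 ≤ K := (norm_nonneg _).trans (hU 0)
  obtain ⟨c, hc, th, hth, hconv⟩ := convp p hp
  have hconv' := hconv H0 Cl Cl_cliff
  have hKh := Kh_pos p
  have hKl := Kl_pos p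
  set G : ℝ := 2 * ((‖R‖ * K) ^ p * Kh p * c * Kl p * (K * ‖X‖) ^ p) with hG
  have key : ∀ N : ℕ, 0 < N → (N:ℝ) ^ (p - th) ≤ G := by
    intro N hN
    have hN' : (0:ℝ) < N := by exact_mod_cast hN
    set D : ℝ := (2:ℝ) ^ N with hD
    have hDpos : 0 < D := by positivity
    have hcard : (((Finset.range N).powerset.card : ℕ) : ℝ) = D := by simp [hD]
    have h1 := fun m => Zv_lower U X R hp K hU hR (Finset.range N).powerset N m
    have h2 := fun k => Wv_bound U X hp K hU (Finset.range N).powerset k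
    have h3 := Zv_int U X c th hconv' hp N hN (Finset.Ico 0 (2 ^ N + 2 ^ N)) (Finset.Ico 0 (2 ^ N)) (by
      intro m hm r hr
      rw [Finset.mem_Ico] at hm ⊢
      have hlt : (2:ℤ) ^ r < 2 ^ N := pow_lt_pow_right₀ (by norm_num) hr
      have : (0:ℤ) < 2 ^ r := by positivity
      push_cast
      constructor <;> linarith)
    rw [hcard] at h1 h2
    have cF : (((Finset.Ico (0:ℤ) (2 ^ N)).card : ℕ) : ℝ) = D := by
      rw [Int.card_Ico, sub_zero]
      have : ((2:ℤ) ^ N).toNat = 2 ^ N := by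
        have : ((2:ℤ) ^ N) = ((2 ^ N : ℕ) : ℤ) := by push_cast; rfl
        rw [this, Int.toNat_natCast]
      rw [this]; push_cast; rfl
    have cS : (((Finset.Ico (0:ℤ) (2 ^ N + 2 ^ N)).card : ℕ) : ℝ) = 2 * D := by
      rw [Int.card_Ico, sub_zero]
      have : ((2:ℤ) ^ N + 2 ^ N).toNat = 2 ^ N + 2 ^ N := by
        have : ((2:ℤ) ^ N + 2 ^ N) = ((2 ^ N + 2 ^ N : ℕ) : ℤ) := by push_cast; rfl
        rw [this, Int.toNat_natCast]
      rw [this]; push_cast; rw [hD]; ring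
    have h4 : D * (D * N) ^ p ≤ (√D * (‖R‖ * K)) ^ p * (Kh p *
        (c * (N:ℝ) ^ th * (2 * D * (Kl p * (K * ‖X‖ * √D) ^ p)))) := by
      calc D * (D * N) ^ p = ∑ m ∈ Finset.Ico (0:ℤ) (2 ^ N), (D * N) ^ p := by
            rw [Finset.sum_const, nsmul_eq_mul, cF]
        _ ≤ ∑ m ∈ Finset.Ico (0:ℤ) (2 ^ N), (√D * (‖R‖ * K)) ^ p *
            (Kh p * ∫ x, (√(∑ t ∈ (Finset.range N).powerset, ‖Zv U X N m t x‖ ^ 2)) ^ p ∂μ) :=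
            Finset.sum_le_sum fun m _ => h1 m
        _ = (√D * (‖R‖ * K)) ^ p * (Kh p * ∑ m ∈ Finset.Ico (0:ℤ) (2 ^ N),
             ∫ x, (√(∑ t ∈ (Finset.range N).powerset, ‖Zv U X N m t x‖ ^ 2)) ^ p ∂μ) := by
            rw [Finset.mul_sum, Finset.mul_sum]
        _ ≤ _ := by
            gcongr
            refine h3.trans ?_
            gcongr
            refine (Finset.sum_le_sum fun k _ => h2 k).trans (le_of_eq ?_)
            rw [Finset.sum_const, nsmul_eq_mul, cS]
    have hsD : √D ^ p * √D ^ p = D ^ p := by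
      rw [← Real.mul_rpow (Real.sqrt_nonneg _) (Real.sqrt_nonneg _), Real.mul_self_sqrt hDpos.le]
    have h5 : (D * D ^ p) * (N:ℝ) ^ p ≤ (D * D ^ p) * (G * (N:ℝ) ^ th) := by
      rw [Real.mul_rpow hDpos.le hN'.le, Real.mul_rpow (Real.sqrt_nonneg _) (by positivity),
        Real.mul_rpow (by positivity) (Real.sqrt_nonneg _)] at h4
      calc _ = D * (D ^ p * (N:ℝ) ^ p) := by ring
        _ ≤ _ := h4
        _ = (D * (√D ^ p * √D ^ p)) * (G * (N:ℝ) ^ th) := by rw [hG]; ring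
        _ = _ := by rw [hsD]
    have h6 : (N:ℝ) ^ p ≤ G * (N:ℝ) ^ th := le_of_mul_le_mul_left h5 (by positivity)
    rw [Real.rpow_sub hN', div_le_iff₀ (by positivity)]
    exact h6
  have ht : Filter.Tendsto (fun N : ℕ => (N:ℝ) ^ (p - th)) Filter.atTop Filter.atTop :=
    (tendsto_rpow_atTop (by linarith)).comp tendsto_natCast_atTop_atTop
  obtain ⟨N, hN1, hN2⟩ := ((ht.eventually_gt_atTop G).and (Filter.eventually_gt_atTop 0)).exists
  exact absurd (key N hN2) (not_le.2 hN1)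

end

/-- the embedding of the base space -/
noncomputable def zL : H0 →L[ℂ] E0 :=
  LinearMap.mkContinuous
    { toFun := z0
      map_add' := fun x y => by
        ext1; funext n
        rw [lp.coeFn_add, Pi.add_apply, z0_apply, z0_apply, z0_apply]
        split_ifs <;> simp
      map_smul' := fun a x => by
        ext1; funext n
        rw [RingHom.id_apply, lp.coeFn_smul, Pi.smul_apply, z0_apply, z0_apply]
        split_ifs <;> simp } 1 (fun x => by
    rw [one_mul]; exact (norm_z0 x).le)

theorem final (p : ℝ) (hp : 1 < p) [Fact (1 ≤ ENNReal.ofReal p)]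
    (A : E0 × E0 →L[ℂ] Lp ℂ (ENNReal.ofReal p) (volume : Measure I))
    (B : Lp ℂ (ENNReal.ofReal p) (volume : Measure I) →L[ℂ] E0 × E0) (hBA : ∀ x, B (A x) = x) :
    ¬ LooseDilation (ENNReal.ofReal p) (A.comp (T0.comp B)) := by
  rintro ⟨Ω', _, μ', J, Q, U, ⟨K, hU⟩, hT⟩
  refine no_dil U (J.comp (A.comp ((ContinuousLinearMap.inr ℂ E0 E0).comp zL)))
    ((lp.evalCLM ℂ (fun _ : ℕ => H0) 2 0).comp ((ContinuousLinearMap.fst ℂ E0 E0).comp (B.comp Q))) hp K hU ?_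
  intro r h
  have h1 := hT (2 ^ r)
  have h2 := conj_pow A B hBA T0 (2 ^ r) (0, z0 h)
  rw [h1] at h2
  have h3 := congrArg (fun f => (B f).1 0) h2
  simp only [hBA] at h3
  rw [T0_lower] at h3
  exact h3

end PB

/-- for `1 < p < ∞`, there exists a bounded operator `T` on `L^p([0,1])` which
is `p`-polynomially bounded but does not admit any loose dilation. -/
theorem stmt_16 (p : ℝ) (hp : 1 < p) :
    letI : Fact (1 ≤ ENNReal.ofReal p) :=
      ⟨by rw [← ENNReal.ofReal_one]; exact ENNReal.ofReal_le_ofReal hp.le⟩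
    ∃ T : Lp ℂ (ENNReal.ofReal p) (volume : Measure unitInterval) →L[ℂ]
        Lp ℂ (ENNReal.ofReal p) (volume : Measure unitInterval),
      (∃ C : ℝ, 1 ≤ C ∧ ∀ φ : Polynomial ℂ,
        ‖aeval T φ‖ ≤ C * ‖aeval (shiftOp (ENNReal.ofReal p)) φ‖) ∧
      ¬ LooseDilation (ENNReal.ofReal p) T := by
  haveI : Fact (1 ≤ ENNReal.ofReal p) :=
    ⟨by rw [← ENNReal.ofReal_one]; exact ENNReal.ofReal_le_ofReal hp.le⟩
  obtain ⟨A, B, hBA⟩ := PB.exists_embed p hp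
  exact ⟨A.comp (PB.T0.comp B), PB.polybdd p hp A B hBA, PB.final p hp A B hBA⟩
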